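/- arXiv:2201.11334 — 2 statements merged into one kernel-verified Lean document; each statement's English description precedes it below -/
import Mathlib

section
/- Let k be a non-negative integer with k <= n - 1. If g and g' are two distinct polynomials in P_k, then S_{g,k} ∩ S_{g',k} = ∅; moreover, the union of S_{g,k} over all g in P_k equals S_k. In other words, the sets S_{g,k} for g in P_k form a partition of the set S_k of all k-normal elements of F_{q^n} over F_q. -/
open Polynomial UniqueFactorizationMonoid
open scoped Classical

noncomputable section

/-- The action `h ∘ β = Σ_i a_i β^{q^i}` of a polynomial `h = Σ_i a_i x^i` over `F_q`
on an element `β` of an extension field. -/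
def polyAct {Fq F : Type*} [Field Fq] [Field F] [Algebra Fq F]
    (q : ℕ) (h : Fq[X]) (β : F) : F :=
  h.sum fun i a => algebraMap Fq F a * β ^ q ^ i

/-- `h` is the `F_q`-order of `β`: the monic divisor of `x^n - 1` of least degree
annihilating `β`. -/
def IsFqOrder {Fq F : Type*} [Field Fq] [Field F] [Algebra Fq F]
    (q n : ℕ) (h : Fq[X]) (β : F) : Prop :=
  h.Monic ∧ h ∣ (X ^ n - 1 : Fq[X]) ∧ polyAct q h β = 0 ∧
    ∀ h' : Fq[X], h'.Monic → h' ∣ (X ^ n - 1 : Fq[X]) → polyAct q h' β = 0 →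
      h.natDegree ≤ h'.natDegree

/-- `α` is `k`-normal over `F_q`: its `F_q`-order has degree `n - k`. -/
def IsKNormal (Fq : Type*) {F : Type*} [Field Fq] [Field F] [Algebra Fq F]
    (q n k : ℕ) (α : F) : Prop :=
  ∃ h : Fq[X], IsFqOrder q n h α ∧ h.natDegree = n - k

/-- `β` is `h`-free: `gcd(h, (x^n - 1)/Ord_q(β)) = 1`. -/
def IsPolyFree {Fq F : Type*} [Field Fq] [Field F] [Algebra Fq F]
    (q n : ℕ) (h : Fq[X]) (β : F) : Prop :=
  ∃ f : Fq[X], IsFqOrder q n f β ∧ IsCoprime h ((X ^ n - 1 : Fq[X]) / f)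

/-- `rad(m)`: product of the distinct primes dividing `m`. -/
def radN (m : ℕ) : ℕ := ∏ p ∈ m.primeFactors, p

/-- `W(m)`: number of squarefree divisors of `m`. -/
def Wnat (m : ℕ) : ℕ := (m.divisors.filter Squarefree).card

/-- `rad(f)`: product of the distinct monic irreducible factors of `f`. -/
def radPoly {Fq : Type*} [Field Fq] (f : Fq[X]) : Fq[X] :=
  (normalizedFactors f).toFinset.prod id

/-- `W(f)`: number of monic squarefree divisors of `f`. -/
def Wpoly {Fq : Type*} [Field Fq] (f : Fq[X]) : ℕ :=
  {g : Fq[X] | g.Monic ∧ Squarefree g ∧ g ∣ f}.ncard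

/-- The primes `p_1, …, p_s` in the decomposition `r = u·p_1^{b_1}···p_s^{b_s}`:
primes `p ∣ r` such that `p^{b_p + 1} ∣ M` where `b_p` is the multiplicity of `p`
in `r` (here `M = q^n - 1`). -/
def rBadPrimes (r M : ℕ) : Finset ℕ :=
  r.primeFactors.filter fun p => p ^ (r.factorization p + 1) ∣ M

/-- `Q_r^d`: the set of `α ∈ F_{q^n}^*` that are `d`-free, are `r`-th powers, but are
not `λ_j = p_j^{b_j+1}`-th powers for any of the primes `p_j` in the decomposition
of `r`. -/
def QSet (F : Type*) [Field F] (q n r d : ℕ) : Set F :=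
  {α | α ≠ 0 ∧ Nat.gcd d ((q ^ n - 1) / orderOf α) = 1 ∧
    (∃ β : F, β ^ r = α) ∧
    ∀ p ∈ rBadPrimes r (q ^ n - 1), ∀ β : F, β ^ p ^ (r.factorization p + 1) ≠ α}

/-- The irreducible factors `f_1, …, f_t` in the decomposition
`g = π·f_1^{b_1}···f_t^{b_t}`: monic irreducible `f ∣ g` with `f^{b_f + 1} ∣ M`
where `b_f` is the multiplicity of `f` in `g` (here `M = x^n - 1`). -/
def gBadFactors {Fq : Type*} [Field Fq] (g M : Fq[X]) : Finset (Fq[X]) :=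
  (normalizedFactors g).toFinset.filter
    fun f => f ^ ((normalizedFactors g).count f + 1) ∣ M

/-- `T_{g,k}^H`: the set of `α ∈ F_{q^n}` that are `H`-free, of the form `g∘β`, but
not of the form `Λ_i∘β` for `Λ_i = f_i^{b_i+1}`. -/
def TSet {Fq : Type*} (F : Type*) [Field Fq] [Field F] [Algebra Fq F]
    (q n : ℕ) (g H : Fq[X]) : Set F :=
  {α | IsPolyFree q n H α ∧ (∃ β : F, polyAct q g β = α) ∧
    ∀ f ∈ gBadFactors g (X ^ n - 1 : Fq[X]), ∀ β : F,
      polyAct q (f ^ ((normalizedFactors g).count f + 1)) β ≠ α}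

/-- `N_{r,k,g}(h, d, H)`: the number of `β ∈ F_{q^n}` such that `β` is `h`-free,
`g∘β ∈ Q_r^d` and `(g∘β)⁻¹ ∈ T_{g,k}^H`. -/
def Ncnt {Fq : Type*} (F : Type*) [Field Fq] [Field F] [Algebra Fq F]
    (q n r : ℕ) (g h : Fq[X]) (d : ℕ) (H : Fq[X]) : ℕ :=
  {β : F | IsPolyFree q n h β ∧ polyAct q g β ∈ QSet F q n r d ∧
    (polyAct q g β)⁻¹ ∈ TSet F q n g H}.ncard

section FrobeniusModule

open FiniteField

variable {Fq F : Type*} [Field Fq] [Field F] [Fintype Fq] [Algebra Fq F]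

/-- The action of `h` is evaluation of `h` at the Frobenius endomorphism. -/
lemma polyAct_eq_aeval_frobenius (h : Fq[X]) (β : F) :
    polyAct (Fintype.card Fq) h β = aeval (frobeniusAlgHom Fq F).toLinearMap h β := by
  rw [aeval_eq_sum_range, polyAct, sum_over_range _ (by simp), LinearMap.sum_apply]
  refine Finset.sum_congr rfl fun i _ => ?_
  rw [LinearMap.smul_apply, Algebra.smul_def, Module.End.coe_pow, AlgHom.coe_toLinearMap,
    coe_frobeniusAlgHom, pow_iterate]

lemma polyAct_mul (f g : Fq[X]) (β : F) :
    polyAct (Fintype.card Fq) (f * g) β =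
      polyAct (Fintype.card Fq) f (polyAct (Fintype.card Fq) g β) := by
  simp only [polyAct_eq_aeval_frobenius, map_mul, Module.End.mul_apply]

lemma polyAct_X_pow_finrank_sub_one [Finite F] (β : F) :
    polyAct (Fintype.card Fq) (X ^ Module.finrank Fq F - 1 : Fq[X]) β = 0 := by
  rw [polyAct_eq_aeval_frobenius, ← minpoly_frobeniusAlgHom, minpoly.aeval,
    LinearMap.zero_apply]

/-- A finite extension of `F_q` is a cyclic `F_q[x]`-module with annihilator generated by
`x^n - 1`. -/
lemma exists_polyAct_generator [Finite F] :
    ∃ θ : F, (∀ f : Fq[X], polyAct (Fintype.card Fq) f θ = 0 →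
        X ^ Module.finrank Fq F - 1 ∣ f) ∧
      ∀ α : F, ∃ f : Fq[X], polyAct (Fintype.card Fq) f θ = α := by
  set φ := (frobeniusAlgHom Fq F).toLinearMap
  obtain ⟨x, hx⟩ := Module.exists_ker_toSpanSingleton_eq_annihilator Fq[X] (Module.AEval' φ)
  obtain ⟨θ, rfl⟩ := (Module.AEval'.of φ).surjective x
  rw [← span_minpoly_eq_annihilator, minpoly_frobeniusAlgHom] at hx
  have hdvd : ∀ f : Fq[X], aeval φ f θ = 0 → X ^ Module.finrank Fq F - 1 ∣ f := by
    intro f hf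
    rw [← Ideal.mem_span_singleton, ← hx, LinearMap.mem_ker, LinearMap.toSpanSingleton_apply,
      ← Module.AEval.of_aeval_smul]
    exact (congrArg _ hf).trans (map_zero _)
  refine ⟨θ, fun f hf => hdvd f (by rwa [← polyAct_eq_aeval_frobenius]), fun α => ?_⟩
  let n := Module.finrank Fq F
  let ev : degreeLT Fq n →ₗ[Fq] F :=
    (LinearMap.applyₗ θ ∘ₗ (aeval φ).toLinearMap) ∘ₗ (degreeLT Fq n).subtype
  have hinj : Function.Injective ev := by
    rw [← LinearMap.ker_eq_bot, LinearMap.ker_eq_bot']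
    rintro ⟨f, hf⟩ h0
    have hd := hdvd f h0
    refine Subtype.ext (eq_zero_of_dvd_of_degree_lt hd ?_)
    have hdeg := degree_X_pow_sub_C (R := Fq) (Module.finrank_pos (R := Fq) (M := F)) 1
    rw [map_one] at hdeg
    rw [hdeg]
    exact mem_degreeLT.mp hf
  have : Module.Finite Fq (degreeLT Fq n) := .equiv (degreeLTEquiv Fq n).symm
  have hrank : Module.finrank Fq (degreeLT Fq n) = Module.finrank Fq F := by
    rw [(degreeLTEquiv Fq n).finrank_eq, Module.finrank_fin_fun]
  obtain ⟨f, hf⟩ :=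
    (LinearMap.injective_iff_surjective_of_finrank_eq_finrank hrank).mp hinj α
  exact ⟨f, by rw [polyAct_eq_aeval_frobenius]; exact hf⟩

/-- If `x^n - 1 = h g`, then every element annihilated by `h` lies in the image of `g`. -/
lemma exists_polyAct_eq_of_mul_eq [Finite F] {g h : Fq[X]}
    (hgh : X ^ Module.finrank Fq F - 1 = h * g) {α : F}
    (hα : polyAct (Fintype.card Fq) h α = 0) :
    ∃ β : F, polyAct (Fintype.card Fq) g β = α := by
  obtain ⟨θ, hann, hgen⟩ := exists_polyAct_generator (Fq := Fq) (F := F)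
  obtain ⟨f, rfl⟩ := hgen α
  rw [← polyAct_mul] at hα
  have hne : h ≠ 0 := by
    rintro rfl
    rw [zero_mul] at hgh
    exact X_pow_sub_C_ne_zero (R := Fq) (Module.finrank_pos (R := Fq) (M := F)) 1
      (by rwa [map_one])
  obtain ⟨c, rfl⟩ := (mul_dvd_mul_iff_left hne).mp (hgh ▸ hann _ hα)
  exact ⟨polyAct _ c θ, (polyAct_mul ..).symm⟩

/-- A monic divisor of `x^n - 1` annihilating `α`, of degree at most that of the `F_q`-order
of `α`, is equal to it. -/
lemma IsFqOrder.eq_of_natDegree_le {n : ℕ} {h u : Fq[X]} {α : F}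
    (hh : IsFqOrder (Fintype.card Fq) n h α) (hu : u.Monic) (hun : u ∣ X ^ n - 1)
    (huα : polyAct (Fintype.card Fq) u α = 0) (hdeg : u.natDegree ≤ h.natDegree) : u = h := by
  obtain ⟨hmon, -, hα, hmin⟩ := hh
  let d := normalize (EuclideanDomain.gcd h u)
  have hd0 : EuclideanDomain.gcd h u ≠ 0 := fun h0 =>
    hmon.ne_zero (EuclideanDomain.gcd_eq_zero_iff.mp h0).1
  have hdm : d.Monic := monic_normalize hd0
  have hdh : d ∣ h := normalize_dvd_iff.mpr (EuclideanDomain.gcd_dvd_left h u)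
  have hdu : d ∣ u := normalize_dvd_iff.mpr (EuclideanDomain.gcd_dvd_right h u)
  have hdα : polyAct (Fintype.card Fq) d α = 0 := by
    obtain ⟨c, hc⟩ : EuclideanDomain.gcd h u ∣ d := dvd_normalize_iff.mpr dvd_rfl
    rw [polyAct_eq_aeval_frobenius] at hα huα ⊢
    rw [hc, EuclideanDomain.gcd_eq_gcd_ab, mul_comm _ c, mul_comm h, mul_comm u]
    simp [hα, huα]
  have hle := hmin d hdm (hdu.trans hun) hdα
  exact (eq_of_monic_of_dvd_of_natDegree_le hdm hu hdu (hdeg.trans hle)).trans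
    (eq_of_monic_of_dvd_of_natDegree_le hdm hmon hdh hle).symm

end FrobeniusModule

/-- The sets `S_{g,k}`, for `g` ranging over the monic degree-`k` divisors of
`x^n - 1`, are pairwise disjoint and their union is the set `S_k` of all `k`-normal
elements of `F_{q^n}` over `F_q`. -/
theorem SgkSets_partition
    (q n k : ℕ) (hq : IsPrimePow q) (hn : 0 < n) (hk : k ≤ n - 1)
    (Fq F : Type*) [Field Fq] [Field F] [Fintype Fq] [Fintype F] [Algebra Fq F]
    (hcard : Fintype.card Fq = q) (hdim : Module.finrank Fq F = n) :
    (∀ g g' : Fq[X], g.Monic → g.natDegree = k → g ∣ (X ^ n - 1 : Fq[X]) →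
      g'.Monic → g'.natDegree = k → g' ∣ (X ^ n - 1 : Fq[X]) → g ≠ g' →
      {α : F | IsKNormal Fq q n k α ∧ ∃ β : F, polyAct q g β = α} ∩
        {α : F | IsKNormal Fq q n k α ∧ ∃ β : F, polyAct q g' β = α} = ∅) ∧
    (⋃ g ∈ {g : Fq[X] | g.Monic ∧ g.natDegree = k ∧ g ∣ (X ^ n - 1 : Fq[X])},
        {α : F | IsKNormal Fq q n k α ∧ ∃ β : F, polyAct q g β = α}) =
      {α : F | IsKNormal Fq q n k α} := by
  subst hcard hdim
  have hXmon : (X ^ Module.finrank Fq F - 1 : Fq[X]).Monic := by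
    simpa using monic_X_pow_sub_C (1 : Fq) hn.ne'
  have hXdeg : (X ^ Module.finrank Fq F - 1 : Fq[X]).natDegree = Module.finrank Fq F := by
    simpa using natDegree_X_pow_sub_C (n := Module.finrank Fq F) (r := (1 : Fq))
  -- The `F_q`-order of an element of `S_{g,k}` is the cofactor of `g`.
  have hcofactor : ∀ (g h : Fq[X]) (β : F), g.Monic → g.natDegree = k →
      g ∣ X ^ Module.finrank Fq F - 1 →
      IsFqOrder (Fintype.card Fq) (Module.finrank Fq F) h (polyAct (Fintype.card Fq) g β) →
      h.natDegree = Module.finrank Fq F - k → X ^ Module.finrank Fq F - 1 = g * h := by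
    rintro g h β hg hgk ⟨u, hu⟩ hh hdeg
    have hum : u.Monic := hg.of_mul_monic_left (hu ▸ hXmon)
    have hud : Module.finrank Fq F = k + u.natDegree := by
      rw [← hgk, ← hg.natDegree_mul hum, ← hu, hXdeg]
    rw [hu, hh.eq_of_natDegree_le hum ⟨g, by rw [hu, mul_comm]⟩ ?_ (by omega)]
    rw [← polyAct_mul, mul_comm, ← hu, polyAct_X_pow_finrank_sub_one]
  constructor
  · intro g g' hg hgk hgd hg' hgk' hgd' hne
    refine Set.eq_empty_iff_forall_notMem.mpr ?_
    rintro _ ⟨⟨⟨h, hh, hdeg⟩, β, rfl⟩, -, β', hβ'⟩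
    have h₁ := hcofactor g h β hg hgk hgd hh hdeg
    have h₂ := hcofactor g' h β' hg' hgk' hgd' (hβ' ▸ hh) hdeg
    exact hne (mul_right_cancel₀ hh.1.ne_zero (h₁.symm.trans h₂))
  · ext α
    simp only [Set.mem_iUnion, Set.mem_ofPred_eq, exists_prop]
    refine ⟨fun ⟨_, _, hα, _⟩ => hα, fun hα => ?_⟩
    obtain ⟨h, ⟨hm, ⟨g, hg⟩, h0, -⟩, hdeg⟩ := id hα
    have hgm : g.Monic := hm.of_mul_monic_left (hg ▸ hXmon)
    have hgd : Module.finrank Fq F = h.natDegree + g.natDegree := by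
      rw [← hm.natDegree_mul hgm, ← hg, hXdeg]
    exact ⟨g, ⟨hgm, by omega, ⟨h, by rw [hg, mul_comm]⟩⟩, hα,
      exists_polyAct_eq_of_mul_eq hg h0⟩

end
end

section
/- Let r > 0 and k >= 0 be integers, q a prime power, and n a positive integer such that r divides q^n - 1 and there exists a polynomial g in P_k. Let g in P_k, let h be a monic divisor of x^n - 1, d a divisor of R, and H a monic divisor of G. If q^{n/2 - ϑ} > 2·r·rad(r)·W(h)·W(d)·W(H), then N_{r,k,g}(h, d, H) > 0, where ϑ = 2k if gcd(q, n) = 1 and ϑ = 3k otherwise. -/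
open Polynomial UniqueFactorizationMonoid
open scoped Classical

noncomputable section

universe u

theorem Valuation.le_map_sum_of_separated {R Γ ι : Type*} [Ring R]
    [LinearOrderedCommMonoidWithZero Γ] (v : Valuation R Γ) (S : Finset ι) (f : ι → R)
    (hf : ∀ i ∈ S, ∀ j ∈ S, i ≠ j → v (f i) = v (f j) → v (f i) = 0) {i : ι} (hi : i ∈ S) :
    v (f i) ≤ v (∑ j ∈ S, f j) := by
  classical
  obtain ⟨j, hj, hmax⟩ := S.exists_max_image (fun i => v (f i)) ⟨i, hi⟩
  by_cases h0 : v (f j) = 0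
  · have := hmax i hi
    simp only [h0] at this
    exact this.trans zero_le
  · rw [Valuation.map_sum_eq_of_lt v hj]
    · exact hmax i hi
    · intro k hk
      rw [Finset.mem_sdiff, Finset.mem_singleton] at hk
      refine lt_of_le_of_ne (hmax k hk.1) fun h => h0 ?_
      rw [← h]
      exact hf k hk.1 j hj hk.2 h

theorem exists_valuation_one_lt (E : Type*) [Field E] (K : Type*) [Field K] [Algebra E[X] K]
    (hinj : Function.Injective (algebraMap E[X] K)) :
    ∃ V : ValuationSubring K, 1 < V.valuation (algebraMap E[X] K X) := by
  by_contra! hcon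
  have hz : algebraMap E[X] K X ∈ (integralClosure (Subring.closure (∅ : Set K)) K).toSubring := by
    rw [← iInf_valuationSubring_superset]
    simp only [Subring.mem_iInf]
    rintro ⟨V, hV⟩
    exact (V.valuation_le_one_iff _).1 (hcon V)
  have hz' : IsIntegral (Subring.closure (∅ : Set K)) (algebraMap E[X] K X) := hz
  have h1 : IsIntegral E (X : E[X]) := by
    obtain ⟨p, hp, hp0⟩ := hz'
    have key : ∀ x : Subring.closure (∅ : Set K), ∃ n : ℤ, (x : K) = n := by
      rintro ⟨x, hx⟩
      rw [Subring.closure_empty] at hx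
      obtain ⟨n, hn⟩ := Subring.mem_bot.1 hx
      exact ⟨n, hn.symm⟩
    choose c hc using key
    refine ⟨∑ i ∈ Finset.range p.natDegree, C (c (p.coeff i) : E) * X ^ i + X ^ p.natDegree, ?_, ?_⟩
    · rw [add_comm]
      apply monic_X_pow_add
      apply lt_of_le_of_lt (degree_sum_le _ _)
      rw [Finset.sup_lt_iff (by simp)]
      intro i hi
      refine lt_of_le_of_lt (degree_C_mul_X_pow_le _ _) ?_
      exact_mod_cast Finset.mem_range.1 hi
    · apply hinj
      rw [eval₂_eq_sum_range, Finset.sum_range_succ, hp.coeff_natDegree] at hp0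
      simp only [eval₂_add, eval₂_finsetSum, eval₂_mul, eval₂_C, eval₂_pow, eval₂_X, map_add,
        map_sum,
        map_mul, map_pow, map_zero]
      simp only [map_one, one_mul] at hp0
      rw [← hp0]
      congr 1
      refine Finset.sum_congr rfl fun i _ => ?_
      rw [map_intCast, map_intCast, ← hc]; rfl
  have := (transcendental_X E)
  exact this h1.isAlgebraic

theorem valuation_constant {E K : Type*} [Field E] [Finite E] [Field K] {Γ : Type*}
    [LinearOrderedCommGroupWithZero Γ] (v : Valuation K Γ) (f : E →+* K) {c : E} (hc : c ≠ 0) :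
    v (f c) = 1 := by
  have := Fintype.ofFinite E
  have h := congrArg (fun x => v (f x)) (FiniteField.pow_card_sub_one_eq_one c hc)
  simp only [map_pow, map_one] at h
  have hne : Fintype.card E - 1 ≠ 0 := by
    have := Fintype.one_lt_card (α := E); omega
  exact (pow_eq_one_iff.1 h).resolve_right hne

theorem valuation_algebraMap_polynomial {E K : Type*} [Field E] [Finite E] [Field K] {Γ : Type*}
    [LinearOrderedCommGroupWithZero Γ] (v : Valuation K Γ) [Algebra E[X] K]
    (hz : 1 < v (algebraMap E[X] K X)) {p : E[X]} (hp : p ≠ 0) :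
    v (algebraMap E[X] K p) = v (algebraMap E[X] K X) ^ p.natDegree := by
  classical
  have hterm : ∀ i, p.coeff i ≠ 0 →
      v (algebraMap E[X] K (C (p.coeff i) * X ^ i)) = v (algebraMap E[X] K X) ^ i := by
    intro i hi
    rw [map_mul, map_mul, map_pow, map_pow]
    rw [show algebraMap E[X] K (C (p.coeff i)) = ((algebraMap E[X] K).comp C) (p.coeff i) from rfl,
      valuation_constant v _ hi, one_mul]
  have hlead : p.coeff p.natDegree ≠ 0 := by simpa using hp
  conv_lhs => rw [p.as_sum_range_C_mul_X_pow, map_sum]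
  rw [Valuation.map_sum_eq_of_lt v (j := p.natDegree) (by simp), hterm _ hlead]
  · intro i hi
    rw [Finset.mem_sdiff, Finset.mem_singleton, Finset.mem_range] at hi
    rw [hterm _ hlead]
    by_cases h0 : p.coeff i = 0
    · simp only [h0, map_zero, zero_mul]
      exact pow_pos (zero_lt_one.trans hz) _
    · rw [hterm _ h0]
      exact pow_lt_pow_right₀ hz (by omega)

theorem exists_root_of_pow_eq_pow {Γ : Type*} [CommGroupWithZero Γ] {x y : Γ} {a b : ℕ}
    (hab : a.Coprime b) (hx : x ≠ 0) (hy : y ≠ 0) (h : y ^ a = x ^ b) :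
    ∃ π : Γ, x = π ^ a ∧ y = π ^ b := by
  have hbez : (a : ℤ) * a.gcdA b + b * a.gcdB b = 1 := by
    rw [← Nat.gcd_eq_gcd_ab, hab.gcd_eq_one]; rfl
  have h' : y ^ (a : ℤ) = x ^ (b : ℤ) := by simpa only [zpow_natCast] using h
  refine ⟨x ^ a.gcdA b * y ^ a.gcdB b, ?_, ?_⟩
  · rw [← zpow_natCast, mul_zpow, ← zpow_mul, ← zpow_mul, mul_comm (a.gcdB b), zpow_mul y, h',
      ← zpow_mul, ← zpow_add₀ hx, mul_comm (a.gcdA b), hbez, zpow_one]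
  · rw [← zpow_natCast, mul_zpow, ← zpow_mul, ← zpow_mul, mul_comm (a.gcdA b), zpow_mul x, ← h',
      ← zpow_mul, ← zpow_add₀ hy, mul_comm (a.gcdB b), hbez, zpow_one]

/-- The polynomial in `W` obtained from `y ^ s - y = A z ^ D + t + B z ^ (-D)` by the substitution
`W = z ^ D y`; its coefficients are polynomials in `z`. -/
def curvePoly {E : Type*} [Field E] (s D : ℕ) (A B t : E) : E[X][X] :=
  X ^ s - (C (X ^ (D * (s - 1))) * X +
    C (C A * X ^ (D * (s + 1)) + C t * X ^ (D * s) + C B * X ^ (D * (s - 1))))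

theorem degree_curvePoly_tail_lt {E : Type*} [Field E] {s : ℕ} (hs : 2 ≤ s) (D : ℕ) (A B t : E) :
    (C (X ^ (D * (s - 1))) * X +
      C (C A * X ^ (D * (s + 1)) + C t * X ^ (D * s) + C B * X ^ (D * (s - 1))) : E[X][X]).degree
      < s := by
  refine lt_of_le_of_lt (degree_linear_le) ?_
  exact_mod_cast hs

theorem curvePoly_monic {E : Type*} [Field E] {s : ℕ} (hs : 2 ≤ s) (D : ℕ) (A B t : E) :
    (curvePoly s D A B t).Monic :=
  (monic_X_pow s).sub_of_left (by
    rw [degree_X_pow]; exact degree_curvePoly_tail_lt hs D A B t)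

theorem curvePoly_natDegree {E : Type*} [Field E] {s : ℕ} (hs : 2 ≤ s) (D : ℕ) (A B t : E) :
    (curvePoly s D A B t).natDegree = s := by
  rw [curvePoly, natDegree_sub_eq_left_of_natDegree_lt, natDegree_X_pow]
  rw [natDegree_X_pow]
  refine lt_of_le_of_lt natDegree_linear_le (by omega)

theorem valuation_root_curvePoly {E K Γ : Type*} [Field E] [Finite E] [Field K] [Algebra E[X] K]
    [LinearOrderedCommGroupWithZero Γ] (v : Valuation K Γ) (hz : 1 < v (algebraMap E[X] K X))
    {s D : ℕ} (hs : 2 ≤ s) (hD : 0 < D) {A : E} (hA : A ≠ 0) (B t : E) {w : K}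
    (hw : (curvePoly s D A B t).eval₂ (algebraMap E[X] K) w = 0) :
    v w ^ s = v (algebraMap E[X] K X) ^ (D * (s + 1)) := by
  obtain ⟨r, rfl⟩ : ∃ r, s = r + 1 := ⟨s - 1, by omega⟩
  set z := algebraMap E[X] K X with hzdef
  set T : E[X] := C A * X ^ (D * (r + 1 + 1)) + C t * X ^ (D * (r + 1)) +
      C B * X ^ (D * (r + 1 - 1))
    with hT
  have h1 : D * (r + 1) < D * (r + 1 + 1) := by nlinarith
  have h2 : D * (r + 1 - 1) < D * (r + 1 + 1) := by simp; nlinarith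
  have hTdeg : T.natDegree = D * (r + 1 + 1) := by
    rw [hT, add_assoc, natDegree_add_eq_left_of_natDegree_lt, natDegree_C_mul_X_pow _ _ hA]
    rw [natDegree_C_mul_X_pow _ _ hA]
    refine lt_of_le_of_lt (natDegree_add_le _ _) (max_lt ?_ ?_)
    · exact lt_of_le_of_lt (natDegree_C_mul_X_pow_le _ _) h1
    · exact lt_of_le_of_lt (natDegree_C_mul_X_pow_le _ _) h2
  have hT0 : T ≠ 0 := by
    rintro h0
    rw [h0, natDegree_zero] at hTdeg
    nlinarith
  have hvT : v (algebraMap E[X] K T) = v z ^ (D * (r + 1 + 1)) := by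
    rw [valuation_algebraMap_polynomial v hz hT0, hTdeg]
  have heq : w ^ (r + 1) = z ^ (D * r) * w + algebraMap E[X] K T := by
    have := hw
    simp only [curvePoly, eval₂_sub, eval₂_add, eval₂_mul, eval₂_C, eval₂_pow, eval₂_X, map_pow,
      add_tsub_cancel_right] at this
    exact sub_eq_zero.1 this
  have hz0 : v z ≠ 0 := (zero_lt_one.trans hz).ne'
  have hle : v w ^ (r + 1) ≤ v z ^ (D * (r + 1 + 1)) := by
    by_contra! hlt
    have h3 : v w ^ (r + 1) ≤ v z ^ (D * r) * v w := by
      have h4 := v.map_add (z ^ (D * r) * w) (algebraMap E[X] K T)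
      rw [← heq, map_pow, map_mul, map_pow, hvT] at h4
      rcases le_max_iff.1 h4 with h | h
      · exact h
      · exact absurd h (not_le.2 hlt)
    have hw0 : 0 < v w := by
      rw [zero_lt_iff]; intro h0
      rw [h0, zero_pow (by omega)] at hlt
      exact not_lt_zero hlt
    have h5 : v w ^ r ≤ (v z ^ D) ^ r := by
      rw [pow_succ] at h3
      rw [← pow_mul]
      exact le_of_mul_le_mul_right h3 hw0
    have h6 : v w ≤ v z ^ D := (pow_le_pow_iff_left₀ zero_le zero_le (by omega)).1 h5
    have h7 : v w ^ (r + 1) ≤ v z ^ (D * (r + 1 + 1)) := by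
      calc v w ^ (r + 1) ≤ (v z ^ D) ^ (r + 1) := pow_le_pow_left₀ zero_le h6 _
        _ = v z ^ (D * (r + 1)) := by rw [← pow_mul]
        _ ≤ _ := pow_le_pow_right₀ hz.le h1.le
    exact absurd h7 (not_le.2 hlt)
  refine le_antisymm hle ?_
  by_contra! hlt
  have h8 : algebraMap E[X] K T = w ^ (r + 1) - z ^ (D * r) * w := by rw [heq]; ring
  have h9 := v.map_sub (w ^ (r + 1)) (z ^ (D * r) * w)
  rw [← h8, hvT, map_pow, map_mul, map_pow] at h9
  rcases le_max_iff.1 h9 with h | h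
  · exact absurd h (not_le.2 hlt)
  · have h10 : v z ^ (2 * D) ≤ v w := by
      rw [show D * (r + 1 + 1) = D * r + 2 * D by ring, pow_add] at h
      exact le_of_mul_le_mul_left h (pow_pos (zero_lt_iff.2 hz0) _)
    have h11 : v z ^ (D * (r + 1 + 1)) ≤ v w ^ (r + 1) := by
      calc _ ≤ v z ^ ((2 * D) * (r + 1)) := pow_le_pow_right₀ hz.le (by nlinarith)
        _ = (v z ^ (2 * D)) ^ (r + 1) := by rw [← pow_mul]
        _ ≤ _ := pow_le_pow_left₀ zero_le h10 _
    exact absurd h11 (not_le.2 hlt)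

theorem exists_curve_valuation {E : Type u} [Field E] [Finite E] {s D : ℕ} (hs : 2 ≤ s) (hD : 0 < D)
    (hcop : s.Coprime (D * (s + 1))) {A : E} (hA : A ≠ 0) (B t : E) :
    ∃ (Γ : Type u) (_ : LinearOrderedCommGroupWithZero Γ)
      (v : Valuation (AdjoinRoot (curvePoly s D A B t)) Γ) (π : Γ), 1 < π ∧
      (∀ p : E[X], p ≠ 0 → v (AdjoinRoot.of _ p) = π ^ (s * p.natDegree)) ∧
      v (AdjoinRoot.root _) = π ^ (D * (s + 1)) := by
  let K := AlgebraicClosure (FractionRing E[X])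
  have hinj : Function.Injective (algebraMap E[X] K) := by
    rw [IsScalarTower.algebraMap_eq E[X] (FractionRing E[X]) K]
    exact (algebraMap (FractionRing E[X]) K).injective.comp (IsFractionRing.injective _ _)
  obtain ⟨V, hV⟩ := exists_valuation_one_lt E K hinj
  obtain ⟨w, hw⟩ : ∃ w : K, (curvePoly s D A B t).eval₂ (algebraMap E[X] K) w = 0 := by
    apply IsAlgClosed.exists_eval₂_eq_zero_of_injective _ hinj
    have := degree_eq_natDegree (curvePoly_monic hs D A B t).ne_zero
    rw [this, curvePoly_natDegree hs]
    have : s ≠ 0 := by omega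
    exact_mod_cast this
  have hpow := valuation_root_curvePoly V.valuation hV hs hD hA B t hw
  have hz0 : V.valuation (algebraMap E[X] K X) ≠ 0 := (zero_lt_one.trans hV).ne'
  have hw0 : V.valuation w ≠ 0 := by
    intro h0
    rw [h0, zero_pow (by omega)] at hpow
    exact pow_ne_zero _ hz0 hpow.symm
  obtain ⟨π, hπ1, hπ2⟩ := exists_root_of_pow_eq_pow hcop hz0 hw0 hpow
  refine ⟨_, inferInstance, V.valuation.comap (AdjoinRoot.lift (algebraMap E[X] K) w hw), π,
    ?_, ?_, ?_⟩
  · rw [hπ1] at hV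
    by_contra! hle
    exact absurd (pow_le_one₀ zero_le hle) (not_le.2 hV)
  · intro p hp
    rw [Valuation.comap_apply, AdjoinRoot.lift_of, valuation_algebraMap_polynomial _ hV hp, hπ1,
      pow_mul]
  · rw [Valuation.comap_apply, AdjoinRoot.lift_root, hπ2]

/-- The element `∑ i, c i(z) w ^ i` of the coordinate ring of the curve. -/
def curveElt {E : Type*} [Field E] {s : ℕ} (G : E[X][X]) (c : Fin s → E[X]) : AdjoinRoot G :=
  ∑ i, AdjoinRoot.of G (c i) * AdjoinRoot.root G ^ (i : ℕ)

theorem curveElt_surjective {E : Type*} [Field E] {s : ℕ} {G : E[X][X]} (hG : G.Monic)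
    (hs : G.natDegree = s) (hs0 : s ≠ 0) (f : AdjoinRoot G) :
    ∃ c : Fin s → E[X], f = curveElt G c := by
  obtain ⟨p, rfl⟩ := AdjoinRoot.mk_surjective f
  refine ⟨fun i => (p %ₘ G).coeff i, ?_⟩
  have h1 : AdjoinRoot.mk G p = AdjoinRoot.mk G (p %ₘ G) := by
    rw [AdjoinRoot.mk_eq_mk]
    exact ⟨p /ₘ G, by linear_combination -(modByMonic_add_div p G)⟩
  have h2 : (p %ₘ G).natDegree < s := by
    rw [← hs]
    refine natDegree_modByMonic_lt _ hG ?_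
    rintro rfl
    simp at hs
    exact hs0 hs.symm
  rw [h1]
  conv_lhs => rw [as_sum_range' _ _ h2]
  rw [map_sum, curveElt, Finset.sum_range]
  refine Finset.sum_congr rfl fun i _ => ?_
  rw [← C_mul_X_pow_eq_monomial, map_mul, AdjoinRoot.mk_C, map_pow, AdjoinRoot.mk_X]

theorem curveElt_sub {E : Type*} [Field E] {s : ℕ} (G : E[X][X]) (c c' : Fin s → E[X]) :
    curveElt G (c - c') = curveElt G c - curveElt G c' := by
  simp [curveElt, sub_mul, Finset.sum_sub_distrib]

theorem weight_inj {s e : ℕ} (hcop : s.Coprime e) {i i' j j' : ℕ} (hi : i < s) (hi' : i' < s)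
    (h : s * j + e * i = s * j' + e * i') : i = i' ∧ j = j' := by
  have h1 : e * i ≡ e * i' [MOD s] := by
    have : (s * j + e * i) ≡ (s * j' + e * i') [MOD s] := by rw [h]
    simpa [Nat.ModEq, Nat.add_mod, Nat.mul_mod_right] using this
  have h2 : i ≡ i' [MOD s] := Nat.ModEq.cancel_left_of_coprime hcop h1
  have h3 : i = i' := Nat.ModEq.eq_of_lt_of_lt h2 hi hi'
  subst h3
  refine ⟨rfl, ?_⟩
  have : s * j = s * j' := by omega
  exact Nat.eq_of_mul_eq_mul_left (by omega) this

section weights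

variable {E Γ : Type*} [Field E] [LinearOrderedCommGroupWithZero Γ] {s e : ℕ} {G : E[X][X]}
  {v : Valuation (AdjoinRoot G) Γ} {π : Γ}

theorem curve_valuation_term
    (hof : ∀ p : E[X], p ≠ 0 → v (AdjoinRoot.of _ p) = π ^ (s * p.natDegree))
    (hroot : v (AdjoinRoot.root _) = π ^ e) {p : E[X]} (hp : p ≠ 0) (i : ℕ) :
    v (AdjoinRoot.of G p * AdjoinRoot.root G ^ i) = π ^ (s * p.natDegree + e * i) := by
  rw [map_mul, hof _ hp, map_pow, hroot, ← pow_mul, pow_add]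

theorem curve_valuation_term_le (hπ : 1 < π)
    (hof : ∀ p : E[X], p ≠ 0 → v (AdjoinRoot.of _ p) = π ^ (s * p.natDegree))
    (hroot : v (AdjoinRoot.root _) = π ^ e) (hcop : s.Coprime e) (c : Fin s → E[X]) (i : Fin s) :
    v (AdjoinRoot.of G (c i) * AdjoinRoot.root G ^ (i : ℕ)) ≤ v (curveElt G c) := by
  refine Valuation.le_map_sum_of_separated v Finset.univ
    (fun i : Fin s => AdjoinRoot.of G (c i) * AdjoinRoot.root G ^ (i : ℕ)) ?_ (Finset.mem_univ i)
  intro i _ j _ hij heq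
  by_cases hi : c i = 0
  · simp [hi]
  · by_cases hj : c j = 0
    · simpa [hj] using heq
    · exfalso
      simp only [curve_valuation_term hof hroot hi, curve_valuation_term hof hroot hj] at heq
      have := pow_right_injective₀ (zero_lt_one.trans hπ) hπ.ne' heq
      exact hij (Fin.ext (weight_inj hcop i.2 j.2 this).1)

theorem curve_valuation_lt (hπ : 1 < π)
    (hof : ∀ p : E[X], p ≠ 0 → v (AdjoinRoot.of _ p) = π ^ (s * p.natDegree))
    (hroot : v (AdjoinRoot.root _) = π ^ e) {c : Fin s → E[X]} {k : ℕ}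
    (hc : ∀ i, (c i).degree < k) :
    v (curveElt G c) < π ^ (s * (k + e)) := by
  have hπ0 := zero_lt_one.trans hπ
  refine Valuation.map_sum_lt' v (pow_pos hπ0 _) fun i _ => ?_
  by_cases hi : c i = 0
  · simpa [hi] using pow_pos hπ0 _
  · rw [curve_valuation_term hof hroot hi]
    refine pow_lt_pow_right₀ hπ ?_
    have h1 : (c i).natDegree < k := (natDegree_lt_iff_degree_lt hi).2 (hc i)
    have h2 := i.2
    nlinarith

theorem degree_lt_of_curve_valuation_lt (hπ : 1 < π)
    (hof : ∀ p : E[X], p ≠ 0 → v (AdjoinRoot.of _ p) = π ^ (s * p.natDegree))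
    (hroot : v (AdjoinRoot.root _) = π ^ e) (hcop : s.Coprime e) {c : Fin s → E[X]} {N : ℕ}
    (h : v (curveElt G c) < π ^ (s * N)) (i : Fin s) : (c i).degree < N := by
  by_cases hi : c i = 0
  · simp [hi, bot_lt_iff_ne_bot]
  · rw [← natDegree_lt_iff_degree_lt hi]
    have h1 := (curve_valuation_term_le hπ hof hroot hcop c i).trans_lt h
    rw [curve_valuation_term hof hroot hi] at h1
    have h2 := (pow_lt_pow_iff_right₀ hπ).1 h1
    by_contra! h3
    have := Nat.mul_le_mul_left s h3
    omega

theorem exists_curve_valuation_eq (hπ : 1 < π)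
    (hof : ∀ p : E[X], p ≠ 0 → v (AdjoinRoot.of _ p) = π ^ (s * p.natDegree))
    (hroot : v (AdjoinRoot.root _) = π ^ e) (hcop : s.Coprime e) {c : Fin s → E[X]} {k : ℕ}
    (hc : ∀ i, (c i).degree < k) (hc0 : c ≠ 0) :
    ∃ m < s * (k + e), v (curveElt G c) = π ^ m := by
  have hπ0 := zero_lt_one.trans hπ
  obtain ⟨i, hi⟩ : ∃ i, c i ≠ 0 := Function.ne_iff.1 hc0
  obtain ⟨j, _, hj⟩ := Finset.exists_max_image Finset.univ
    (fun i : Fin s => v (AdjoinRoot.of G (c i) * AdjoinRoot.root G ^ (i : ℕ)))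
    ⟨i, Finset.mem_univ _⟩
  have hj0 : c j ≠ 0 := by
    intro h0
    have := hj i (Finset.mem_univ _)
    simp only [curve_valuation_term hof hroot hi, h0, map_zero, zero_mul] at this
    exact absurd this (not_le.2 (pow_pos hπ0 _))
  have heq : v (curveElt G c) = π ^ (s * (c j).natDegree + e * j) := by
    rw [← curve_valuation_term hof hroot hj0]
    exact le_antisymm (Valuation.map_sum_le v fun i _ => hj i (Finset.mem_univ _))
      (curve_valuation_term_le hπ hof hroot hcop c j)
  refine ⟨_, ?_, heq⟩
  have := curve_valuation_lt hπ hof hroot hc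
  rw [heq] at this
  exact (pow_lt_pow_iff_right₀ hπ).1 this

end weights

/-- A rational point `(z, y)` with `z ≠ 0` gives a root `z ^ D * y` of `curvePoly` at `z`. -/
theorem curvePoly_eval₂_eq_zero {E : Type*} [Field E] {s D : ℕ} (hs : 2 ≤ s) {A B t z y : E}
    (hz : z ≠ 0) (h : y ^ s - y = A * z ^ D + B * (z ^ D)⁻¹ + t) :
    (curvePoly s D A B t).eval₂ (evalRingHom z) (z ^ D * y) = 0 := by
  obtain ⟨r, rfl⟩ : ∃ r, s = r + 1 := ⟨s - 1, by omega⟩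
  have h1 : y ^ (r + 1) = y + (A * z ^ D + B * (z ^ D)⁻¹ + t) := by rw [← h]; ring
  simp only [curvePoly, eval₂_sub, eval₂_add, eval₂_mul, eval₂_C, eval₂_pow, eval₂_X,
    coe_evalRingHom, eval_add, eval_mul, eval_pow, eval_X, eval_C, add_tsub_cancel_right]
  rw [mul_pow, h1]
  have : (z ^ D) ≠ 0 := pow_ne_zero _ hz
  simp only [pow_mul]
  field_simp
  ring

theorem lift_curveElt {E : Type*} [Field E] {s : ℕ} {G : E[X][X]} {z w : E}
    (h : G.eval₂ (evalRingHom z) w = 0) (c : Fin s → E[X]) :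
    AdjoinRoot.lift (evalRingHom z) w h (curveElt G c) = ∑ i, (c i).eval z * w ^ (i : ℕ) := by
  simp [curveElt]

/-- The polynomial with the given list of coefficients. -/
def polyOfFn {E : Type*} [Field E] (k : ℕ) (a : Fin k → E) : E[X] :=
  ((degreeLTEquiv E k).symm a : E[X])

theorem degree_polyOfFn_lt {E : Type*} [Field E] {k : ℕ} (a : Fin k → E) :
    (polyOfFn k a).degree < k :=
  mem_degreeLT.1 ((degreeLTEquiv E k).symm a).2

theorem polyOfFn_sub {E : Type*} [Field E] {k : ℕ} (a b : Fin k → E) :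
    polyOfFn k (a - b) = polyOfFn k a - polyOfFn k b := by
  simp [polyOfFn]

theorem polyOfFn_injective {E : Type*} [Field E] {k : ℕ} :
    Function.Injective (polyOfFn (E := E) k) :=
  Subtype.val_injective.comp (degreeLTEquiv E k).symm.injective

theorem exists_auxiliary_family {E Γ : Type*} [Field E] [Fintype E]
    [LinearOrderedCommGroupWithZero Γ] {s e : ℕ} {G : E[X][X]}
    {v : Valuation (AdjoinRoot G) Γ} {π : Γ} (hG : G.Monic) (hGs : G.natDegree = s) (hs : 2 ≤ s)
    (hπ : 1 < π) (hof : ∀ p : E[X], p ≠ 0 → v (AdjoinRoot.of _ p) = π ^ (s * p.natDegree))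
    (hroot : v (AdjoinRoot.root _) = π ^ e) (hcop : s.Coprime e)
    {p a : ℕ} [Fact p.Prime] [CharP E p] {κ M N L : ℕ} (hP : p ^ a = s * L) (hκ : κ + e = L)
    (hN : L * (s * L) + M + e ≤ N) (hcount : N < s * κ * M) :
    ∃ b : Fin s × Fin M → Fin s → E[X], b ≠ 0 ∧ (∀ j i, (b j i).degree < κ) ∧
      ∑ j, curveElt G (b j) ^ (p ^ a) *
        (AdjoinRoot.of G (X ^ (j.2 : ℕ)) * AdjoinRoot.root G ^ (j.1 : ℕ)) = 0 := by
  classical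
  have hπ0 := zero_lt_one.trans hπ
  let ν : (Fin s × Fin M → Fin s → Fin κ → E) → Fin s × Fin M → Fin s → E[X] :=
    fun x j i => polyOfFn κ (x j i)
  let δ : (Fin s × Fin M → Fin s → E[X]) → AdjoinRoot G := fun b =>
    ∑ j, curveElt G (b j) ^ (p ^ a) *
        (AdjoinRoot.of G (X ^ (j.2 : ℕ)) * AdjoinRoot.root G ^ (j.1 : ℕ))
  have hδ : ∀ x, v (δ (ν x)) < π ^ (s * N) := by
    intro x
    refine Valuation.map_sum_lt' v (pow_pos hπ0 _) fun j _ => ?_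
    have h1 := curve_valuation_lt hπ hof hroot (c := ν x j) (k := κ)
      fun i => degree_polyOfFn_lt _
    rw [map_mul, map_pow, curve_valuation_term hof hroot (pow_ne_zero _ X_ne_zero), natDegree_X_pow]
    have h2 : v (curveElt G (ν x j)) ^ p ^ a ≤ (π ^ (s * (κ + e))) ^ p ^ a :=
      pow_le_pow_left₀ zero_le h1.le _
    refine lt_of_le_of_lt (mul_le_mul_left h2 _) ?_
    rw [← pow_mul, ← pow_add]
    refine pow_lt_pow_right₀ hπ ?_
    rw [hκ, hP]
    have h3 := j.1.2
    have h4 := j.2.2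
    have h5 : s * (j.2 : ℕ) + s ≤ s * M := by nlinarith
    have h6 : e * (j.1 : ℕ) ≤ s * e := by nlinarith
    have h7 := Nat.mul_le_mul_left s hN
    have h8 : s * (L * (s * L) + M + e) = s * L * (s * L) + s * M + s * e := by ring
    omega
  have hrep : ∀ x, ∃ c : Fin s → E[X], δ (ν x) = curveElt G c ∧ ∀ i, (c i).degree < N := by
    intro x
    obtain ⟨c, hc⟩ := curveElt_surjective hG hGs (by omega) (δ (ν x))
    refine ⟨c, hc, degree_lt_of_curve_valuation_lt hπ hof hroot hcop ?_⟩
    rw [← hc]; exact hδ x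
  choose c hc hcdeg using hrep
  let code : (Fin s × Fin M → Fin s → Fin κ → E) → Fin s → Fin N → E :=
    fun x i j => (c x i).coeff j
  have hcard : Fintype.card (Fin s → Fin N → E) <
      Fintype.card (Fin s × Fin M → Fin s → Fin κ → E) := by
    simp only [Fintype.card_fun, Fintype.card_fin, Fintype.card_prod, ← pow_mul]
    refine Nat.pow_lt_pow_right Fintype.one_lt_card ?_
    have := Nat.mul_lt_mul_of_pos_left hcount (by omega : 0 < s)
    calc N * s = s * N := by ring
      _ < s * (s * κ * M) := this
      _ = _ := by ring
  obtain ⟨x, x', hne, heq⟩ := Fintype.exists_ne_map_eq_of_card_lt code hcard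
  have hcc : c x = c x' := by
    funext i
    ext j
    by_cases hj : j < N
    · exact congrFun (congrFun heq i) ⟨j, hj⟩
    · rw [coeff_eq_zero_of_degree_lt, coeff_eq_zero_of_degree_lt]
      · exact lt_of_lt_of_le (hcdeg x' i) (by exact_mod_cast not_lt.1 hj)
      · exact lt_of_lt_of_le (hcdeg x i) (by exact_mod_cast not_lt.1 hj)
  have hδδ : δ (ν x) = δ (ν x') := by rw [hc, hc, hcc]
  refine ⟨ν x - ν x', ?_, ?_, ?_⟩
  · rw [sub_ne_zero]
    intro h
    apply hne
    funext j i
    exact polyOfFn_injective (congrFun (congrFun h j) i)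
  · intro j i
    have : (ν x - ν x') j i = polyOfFn κ (x j i - x' j i) := by
      rw [polyOfFn_sub]; rfl
    rw [this]
    exact degree_polyOfFn_lt _
  · have : Nontrivial (AdjoinRoot G) := by
      apply AdjoinRoot.nontrivial
      rw [degree_eq_natDegree hG.ne_zero, hGs]
      exact_mod_cast (by omega : s ≠ 0)
    have : CharP (AdjoinRoot G) p := charP_of_injective_ringHom
      (f := (AdjoinRoot.of G).comp (C : E →+* E[X])) (RingHom.injective _) p
    rw [← sub_eq_zero.2 hδδ]
    simp only [δ, ← Finset.sum_sub_distrib, ← sub_mul]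
    refine Finset.sum_congr rfl fun j _ => ?_
    rw [← sub_pow_char_pow, ← curveElt_sub]
    rfl

theorem card_le_of_forall_exists_curve_point {E : Type u} {F : Type*} [Field E] [Fintype E]
    [Field F] [Fintype F] [Algebra F E] {s D e μ L : ℕ} (hsF : Fintype.card F = s)
    (hDs : D + 1 = s) (he : e = D * (s + 1)) (hL : L = s ^ μ)
    (hE : Fintype.card E = (s * L) ^ 2) (hlarge : s * (e ^ 2 + 2 * e) + 2 * e + 3 ≤ L)
    {A : E} (hA : A ≠ 0) (B t : E) (Z : Finset E)
    (hZ : ∀ z ∈ Z, z ≠ 0 ∧ ∃ y, y ^ s - y = A * z ^ D + B * (z ^ D)⁻¹ + t) :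
    Z.card ≤ L + s * L * (L + 2 * e + 2) := by
  classical
  have hs : 2 ≤ s := by rw [← hsF]; exact Fintype.one_lt_card
  have hD : 0 < D := by omega
  have hcop : s.Coprime e := by
    have h1 : e + 1 = s * s := by rw [he, ← hDs]; ring
    exact Nat.Coprime.coprime_dvd_left ⟨s, h1⟩ (by simp : (e + 1).Coprime e)
  obtain ⟨p, hp⟩ := CharP.exists F
  obtain ⟨n, hpp, hpn⟩ := FiniteField.card F p
  have : Fact p.Prime := ⟨hpp⟩
  have : CharP E p := charP_of_injective_algebraMap (algebraMap F E).injective p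
  have hPa : p ^ ((n : ℕ) * (μ + 1)) = s * L := by
    rw [pow_mul, ← hpn, hsF, hL, pow_succ']
  obtain ⟨G, hGdef⟩ : ∃ G, G = curvePoly s D A B t := ⟨_, rfl⟩
  have hex := exists_curve_valuation hs hD (he ▸ hcop) hA B t
  rw [← hGdef, ← he] at hex
  obtain ⟨Γ, _, v, π, hπ, hof, hroot⟩ := hex
  have hG : G.Monic := hGdef ▸ curvePoly_monic hs D A B t
  have hGs : G.natDegree = s := hGdef ▸ curvePoly_natDegree hs D A B t
  have hπ0 := zero_lt_one.trans hπ
  have heL : e ≤ L := by nlinarith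
  obtain ⟨κ, hκ⟩ : ∃ κ, κ + e = L := ⟨L - e, by omega⟩
  obtain ⟨b, hb0, hbdeg, hbsum⟩ := exists_auxiliary_family hG hGs hs hπ hof hroot hcop
    (M := L + e + 2) (N := L * (s * L) + (L + e + 2) + e) hPa hκ le_rfl (by
      have : (κ : ℤ) = L - e := by omega
      zify
      rw [this]
      zify at hlarge hs
      nlinarith)
  set mon : Fin s × Fin (L + e + 2) → AdjoinRoot G := fun j =>
    AdjoinRoot.of G (X ^ (j.2 : ℕ)) * AdjoinRoot.root G ^ (j.1 : ℕ) with hmon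
  have hvmon : ∀ j, v (mon j) = π ^ (s * (j.2 : ℕ) + e * (j.1 : ℕ)) := by
    intro j
    rw [hmon]
    simp only
    rw [curve_valuation_term hof hroot (pow_ne_zero _ X_ne_zero), natDegree_X_pow]
  set f : AdjoinRoot G := ∑ j, curveElt G (b j) * mon j ^ (s * L) with hf
  have hterm : ∀ j, b j ≠ 0 → ∃ m < s * L, v (curveElt G (b j) * mon j ^ (s * L)) =
      π ^ (m + s * L * (s * (j.2 : ℕ) + e * (j.1 : ℕ))) := by
    intro j hj
    obtain ⟨m, hm, hmv⟩ := exists_curve_valuation_eq hπ hof hroot hcop (hbdeg j) hj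
    refine ⟨m, by rwa [hκ] at hm, ?_⟩
    rw [map_mul, map_pow, hvmon, hmv, ← pow_mul, ← pow_add, mul_comm (s * L)]
  have hzero : ∀ j, b j = 0 → curveElt G (b j) * mon j ^ (s * L) = 0 := by
    intro j hj
    simp [hj, curveElt]
  obtain ⟨j0, hj0⟩ : ∃ j, b j ≠ 0 := Function.ne_iff.1 hb0
  have hfpos : v f ≠ 0 := by
    have hle := Valuation.le_map_sum_of_separated v Finset.univ
      (fun j => curveElt G (b j) * mon j ^ (s * L)) (by
        intro i _ j _ hij heq
        by_cases hi : b i = 0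
        · simp [hzero i hi]
        · by_cases hj : b j = 0
          · rw [heq]; simp [hzero j hj]
          · exfalso
            obtain ⟨m, hm, hmv⟩ := hterm i hi
            obtain ⟨m', hm', hmv'⟩ := hterm j hj
            simp only [hmv, hmv'] at heq
            have h1 := pow_right_injective₀ hπ0 hπ.ne' heq
            have h2 := congrArg (· / (s * L)) h1
            simp only [Nat.add_mul_div_left _ _ (by omega : 0 < s * L), Nat.div_eq_of_lt hm,
              Nat.div_eq_of_lt hm', zero_add] at h2
            have h3 := weight_inj hcop i.1.2 j.1.2 h2
            exact hij (Prod.ext (Fin.ext h3.1) (Fin.ext h3.2))) (Finset.mem_univ j0)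
    obtain ⟨m, -, hmv⟩ := hterm j0 hj0
    simp only [hmv] at hle
    exact ((pow_pos hπ0 _).trans_le hle).ne'
  have hflt : v f < π ^ (s * (L + s * L * (L + 2 * e + 2))) := by
    refine Valuation.map_sum_lt' v (pow_pos hπ0 _) fun j _ => ?_
    by_cases hj : b j = 0
    · rw [hzero j hj, map_zero]; exact pow_pos hπ0 _
    · obtain ⟨m, hm, hmv⟩ := hterm j hj
      rw [hmv]
      refine pow_lt_pow_right₀ hπ ?_
      have h3 := j.1.2
      have h4 := j.2.2
      have h5 : s * (j.2 : ℕ) ≤ s * (L + e + 2) := by nlinarith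
      have h6 : e * (j.1 : ℕ) ≤ s * e := by nlinarith
      have h7 : s * L * (s * (j.2 : ℕ) + e * (j.1 : ℕ)) ≤ s * L * (s * (L + e + 2) + s * e) :=
        Nat.mul_le_mul_left _ (by omega)
      calc _ < s * L + s * L * (s * (L + e + 2) + s * e) := by omega
        _ = _ := by ring
  obtain ⟨c, hc⟩ := curveElt_surjective hG hGs (by omega) f
  rw [hc] at hflt hfpos
  have hcdeg := degree_lt_of_curve_valuation_lt hπ hof hroot hcop hflt
  obtain ⟨i, hi⟩ : ∃ i, c i ≠ 0 := by
    by_contra! hcon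
    apply hfpos
    simp [curveElt, hcon]
  have hvanish : ∀ z ∈ Z, ∀ i, (c i).eval z = 0 := by
    intro z hz
    obtain ⟨hz0, y, hy⟩ := hZ z hz
    have hpt : ∀ x : F, ∑ i, (c i).eval z * (z ^ D * (y + algebraMap F E x)) ^ (i : ℕ) = 0 := by
      intro x
      have hy' : (y + algebraMap F E x) ^ s - (y + algebraMap F E x) =
          A * z ^ D + B * (z ^ D)⁻¹ + t := by
        have hxs : (algebraMap F E x) ^ s = algebraMap F E x := by
          rw [← map_pow, ← hsF, FiniteField.pow_card]
        have : (y + algebraMap F E x) ^ s = y ^ s + (algebraMap F E x) ^ s := by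
          rw [← hsF, hpn, add_pow_char_pow]
        rw [this, hxs, ← hy]; ring
      have hroot0 : G.eval₂ (evalRingHom z) (z ^ D * (y + algebraMap F E x)) = 0 := by
        rw [hGdef]
        exact curvePoly_eval₂_eq_zero hs hz0 hy'
      rw [← lift_curveElt hroot0, ← hc]
      set ev := AdjoinRoot.lift (evalRingHom z) _ hroot0
      have h1 : (ev f) ^ (s * L) = ev (∑ j, curveElt G (b j) ^ (s * L) * mon j) := by
        rw [hf, map_sum, map_sum, ← hPa, sum_pow_char_pow]
        refine Finset.sum_congr rfl fun j _ => ?_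
        rw [map_mul, mul_pow, map_mul, map_pow, map_pow, ← pow_mul, hPa, ← sq, ← hE,
          FiniteField.pow_card]
      rw [← hPa, hbsum, map_zero, hPa] at h1
      exact pow_eq_zero_iff (hPa ▸ pow_ne_zero _ hpp.ne_zero) |>.1 h1
    set q : E[X] := ∑ i : Fin s, C ((c i).eval z) * X ^ (i : ℕ) with hq
    have hq0 : q = 0 := by
      refine eq_zero_of_natDegree_lt_card_of_eval_eq_zero q
        (f := fun x : F => z ^ D * (y + algebraMap F E x)) ?_ ?_ ?_
      · intro x x' hxx
        have := mul_left_cancel₀ (pow_ne_zero D hz0) hxx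
        exact (algebraMap F E).injective (add_left_cancel this)
      · intro x
        rw [hq, eval_finsetSum, ← hpt x]
        simp
      · rw [hsF]
        by_cases hq0 : q = 0
        · rw [hq0, natDegree_zero]
          omega
        · exact (natDegree_lt_iff_degree_lt hq0).2 (degree_sum_fin_lt _)
    intro i
    have := congrArg (fun r : E[X] => r.coeff i) hq0
    simp only [hq, finsetSum_coeff, coeff_C_mul, coeff_X_pow, coeff_zero] at this
    rw [Finset.sum_eq_single i] at this
    · simpa using this
    · intro j _ hj
      simp [Fin.val_ne_of_ne hj.symm]
    · simp
  have hsub : Z ⊆ (c i).roots.toFinset := by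
    intro z hz
    rw [Multiset.mem_toFinset, mem_roots hi]
    exact hvanish z hz i
  calc Z.card ≤ (c i).roots.toFinset.card := Finset.card_le_card hsub
    _ ≤ (c i).roots.card := Multiset.toFinset_card_le _
    _ ≤ (c i).natDegree := card_roots' _
    _ ≤ _ := ((natDegree_lt_iff_degree_lt hi).2 (hcdeg i)).le

/-- The number of points, with invertible first coordinate, on the Artin–Schreier curve is
controlled by the number of first coordinates. -/
theorem card_fiber_le {E : Type u} [Field E] [Fintype E] [DecidableEq E] {s m D : ℕ} (hs : 2 ≤ s)
    {A B t : E}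
    (h : ∀ Z : Finset E,
      (∀ z ∈ Z, z ≠ 0 ∧ ∃ y, y ^ s - y = A * z ^ D + B * (z ^ D)⁻¹ + t) → Z.card ≤ m) :
    (Finset.univ.filter fun w : E × Eˣ =>
      w.1 ^ s - w.1 - (A * (w.2 : E) ^ D + B * ((w.2 : E) ^ D)⁻¹) = t).card ≤ s * m := by
  classical
  set W := Finset.univ.filter fun w : E × Eˣ =>
      w.1 ^ s - w.1 - (A * (w.2 : E) ^ D + B * ((w.2 : E) ^ D)⁻¹) = t with hW
  have h1 : (W.image fun w => (w.2 : E)).card ≤ m := by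
    refine h _ fun z hz => ?_
    obtain ⟨w, hw, rfl⟩ := Finset.mem_image.1 hz
    refine ⟨w.2.ne_zero, w.1, ?_⟩
    rw [← (Finset.mem_filter.1 hw).2]
    ring
  refine (Finset.card_le_mul_card_image (f := fun w : E × Eˣ => (w.2 : E)) W s ?_).trans
    (Nat.mul_le_mul_left s h1)
  intro z hz
  set c : E := A * z ^ D + B * (z ^ D)⁻¹ + t with hc
  set P : E[X] := X ^ s - X - C c with hP
  have hdeg : P.natDegree = s := by
    have hlt : (X + C c).natDegree < (X ^ s : E[X]).natDegree := by
      rw [natDegree_X_add_C, natDegree_X_pow]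
      omega
    rw [hP, sub_sub, natDegree_sub_eq_left_of_natDegree_lt hlt, natDegree_X_pow]
  have hP0 : P ≠ 0 := by
    intro h0
    rw [h0, natDegree_zero] at hdeg
    omega
  have hmaps : ∀ w ∈ W.filter (fun w => (w.2 : E) = z), w.1 ∈ P.roots.toFinset := by
    intro w hw
    rw [Finset.mem_filter] at hw
    have h2 := (Finset.mem_filter.1 hw.1).2
    rw [hw.2] at h2
    rw [Multiset.mem_toFinset, mem_roots hP0, IsRoot, hP]
    simp only [eval_sub, eval_pow, eval_X, eval_C, hc]
    rw [← h2]
    ring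
  calc _ ≤ P.roots.toFinset.card := by
        refine Finset.card_le_card_of_injOn (fun w => w.1) hmaps ?_
        intro w hw w' hw' hww
        refine Prod.ext hww (Units.ext ?_)
        rw [Finset.mem_coe, Finset.mem_filter] at hw hw'
        rw [hw.2, hw'.2]
    _ ≤ P.roots.card := Multiset.toFinset_card_le _
    _ ≤ P.natDegree := card_roots' _
    _ = s := hdeg

theorem MulChar.norm_apply_unit {E : Type*} [Field E] [Fintype E] (χ : MulChar E ℂ) (u : Eˣ) :
    ‖χ u‖ = 1 := by
  classical
  refine Complex.norm_eq_one_of_pow_eq_one (n := Fintype.card Eˣ) ?_ Fintype.card_ne_zero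
  rw [← map_pow, ← Units.val_pow_eq_pow_val, pow_card_eq_one, Units.val_one, map_one]

theorem norm_sum_units_le_of_card_fiber_le {E : Type*} [Field E] [Fintype E] [DecidableEq E]
    {s D K : ℕ} (χ : MulChar E ℂ) (ψ : AddChar E ℂ)
    (hψ : ψ ≠ 1) (hψs : ∀ y, ψ (y ^ s) = ψ y) (hχD : ∀ z : Eˣ, χ ((z : E) ^ D) = 1) (a b : E)
    (hK : ∀ (u : Eˣ) (t : E), (Finset.univ.filter fun w : E × Eˣ =>
      w.1 ^ s - w.1 - (a * u * (w.2 : E) ^ D + b * (u : E)⁻¹ * ((w.2 : E) ^ D)⁻¹) = t).card ≤ K) :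
    ‖∑ x : Eˣ, χ x * ψ (a * x + b * (x : E)⁻¹)‖ ≤ K - Fintype.card E + 1 := by
  set S := ∑ x : Eˣ, χ x * ψ (a * x + b * (x : E)⁻¹) with hS
  let φ : Eˣ → E × Eˣ → E := fun u w =>
    w.1 ^ s - w.1 - (a * u * (w.2 : E) ^ D + b * (u : E)⁻¹ * ((w.2 : E) ^ D)⁻¹)
  let N : Eˣ → E → ℕ := fun u t => (Finset.univ.filter fun w => φ u w = t).card
  have hNsum : ∀ (u : Eˣ) (f : E → ℂ), ∑ t, (N u t : ℂ) * f t = ∑ w, f (φ u w) := by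
    intro u f
    rw [← Finset.sum_fiberwise Finset.univ (φ u)]
    refine Finset.sum_congr rfl fun t _ => ?_
    rw [Finset.sum_congr rfl (g := fun _ => f t) fun w hw => by rw [(Finset.mem_filter.1 hw).2]]
    simp [N]
  have hQ : (Fintype.card Eˣ : ℝ) = Fintype.card E - 1 := by
    rw [Fintype.card_units, Nat.cast_sub Fintype.card_pos]; simp
  have hQ1 : (1 : ℝ) < Fintype.card E := by exact_mod_cast Fintype.one_lt_card
  have hNtot : ∀ u, ∑ t, (N u t : ℝ) = Fintype.card E * (Fintype.card E - 1) := by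
    intro u
    have := hNsum u fun _ => 1
    simp only [mul_one, Finset.sum_const, Finset.card_univ, Fintype.card_prod, nsmul_eq_mul] at this
    rw [← hQ]
    exact_mod_cast this
  have hψsum : ∑ t : E, ψ (-t) = 0 := by
    refine (Equiv.sum_comp (Equiv.neg E) (fun t => ψ t)).trans ?_
    exact AddChar.sum_eq_zero_of_ne_one hψ
  have hmain : ∑ u : Eˣ, ∑ t, χ u * ψ (-t) * ((N u t : ℂ) - K) =
      (Fintype.card E * Fintype.card Eˣ : ℂ) * S := by
    have h1 : ∀ u : Eˣ, ∑ t, χ u * ψ (-t) * ((N u t : ℂ) - K) =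
        ∑ w : E × Eˣ, χ (u * (w.2 : E) ^ D) *
          ψ (a * (u * (w.2 : E) ^ D) + b * ((u : E) * (w.2 : E) ^ D)⁻¹) := by
      intro u
      have h2 : ∑ t, χ u * ψ (-t) * ((N u t : ℂ) - K) =
          χ u * ∑ t, (N u t : ℂ) * ψ (-t) - χ u * K * ∑ t, ψ (-t) := by
        rw [Finset.mul_sum, Finset.mul_sum, ← Finset.sum_sub_distrib]
        exact Finset.sum_congr rfl fun t _ => by ring
      rw [h2, hψsum, mul_zero, sub_zero, hNsum u fun t => ψ (-t), Finset.mul_sum]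
      refine Finset.sum_congr rfl fun w _ => ?_
      have h3 : -φ u w = (w.1 - w.1 ^ s) +
          (a * (u * (w.2 : E) ^ D) + b * ((u : E) * (w.2 : E) ^ D)⁻¹) := by
        simp only [φ, mul_inv]; ring
      rw [h3, AddChar.map_add_eq_mul, AddChar.map_sub_eq_div, hψs, map_mul, hχD, mul_one,
        div_self, one_mul]
      exact (AddChar.val_isUnit ψ _).ne_zero
    rw [Finset.sum_congr rfl fun u _ => h1 u, Finset.sum_comm]
    have h4 : ∀ w : E × Eˣ, ∑ u : Eˣ, χ (u * (w.2 : E) ^ D) *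
          ψ (a * (u * (w.2 : E) ^ D) + b * ((u : E) * (w.2 : E) ^ D)⁻¹) = S := by
      intro w
      rw [hS]
      refine Eq.trans ?_ (Equiv.sum_comp (Equiv.mulRight (w.2 ^ D)) _)
      exact Finset.sum_congr rfl fun u _ => by simp
    rw [Finset.sum_congr rfl fun w _ => h4 w]
    simp
  have hle : ‖(Fintype.card E * Fintype.card Eˣ : ℂ) * S‖ ≤
      Fintype.card Eˣ * (Fintype.card E * K - Fintype.card E * (Fintype.card E - 1)) := by
    rw [← hmain]
    calc _ ≤ ∑ u : Eˣ, ∑ t, ((K : ℝ) - N u t) := by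
          refine (norm_sum_le _ _).trans (Finset.sum_le_sum fun u _ => ?_)
          refine (norm_sum_le _ _).trans (Finset.sum_le_sum fun t _ => ?_)
          have h5 : (N u t : ℝ) ≤ K := Nat.cast_le.2 (hK u t)
          rw [norm_mul, norm_mul, AddChar.norm_apply, mul_one,
            show ((N u t : ℂ) - K) = (((N u t : ℝ) - K : ℝ) : ℂ) by push_cast; ring,
            Complex.norm_real, Real.norm_of_nonpos (by linarith)]
          have h6 : ‖χ u‖ ≤ 1 := le_of_eq (χ.norm_apply_unit u)
          nlinarith
      _ = _ := by
          simp only [Finset.sum_sub_distrib, hNtot]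
          simp
          ring
  rw [norm_mul, norm_mul, Complex.norm_natCast, Complex.norm_natCast, hQ] at hle
  have hpos : (0 : ℝ) < Fintype.card E * (Fintype.card E - 1) := by nlinarith
  refine le_of_mul_le_mul_left ?_ hpos
  calc _ ≤ _ := hle
    _ = _ := by ring

/-- A bound for Kloosterman sums over a large extension of even degree, twisted by characters
coming from the base field. -/
theorem norm_sum_units_le_of_large {E : Type u} {F : Type*} [Field E] [Fintype E] [DecidableEq E]
    [Field F] [Fintype F] [Algebra F E] {s D e μ L : ℕ} (hsF : Fintype.card F = s)
    (hDs : D + 1 = s) (he : e = D * (s + 1)) (hL : L = s ^ μ)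
    (hE : Fintype.card E = (s * L) ^ 2) (hlarge : s * (e ^ 2 + 2 * e) + 2 * e + 3 ≤ L)
    (χ : MulChar E ℂ) (ψ : AddChar E ℂ)
    (hψ : ψ ≠ 1) (hψs : ∀ y, ψ (y ^ s) = ψ y) (hχD : ∀ z : Eˣ, χ ((z : E) ^ D) = 1) {a : E}
    (ha : a ≠ 0) (b : E) :
    ‖∑ x : Eˣ, χ x * ψ (a * x + b * (x : E)⁻¹)‖ ≤ (1 + s * (2 * e + 2)) * (s * L) + 1 := by
  have hs : 2 ≤ s := by rw [← hsF]; exact Fintype.one_lt_card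
  refine (norm_sum_units_le_of_card_fiber_le (K := s * (L + s * L * (L + 2 * e + 2))) χ ψ hψ hψs
    hχD a b fun u t => card_fiber_le hs fun Z hZ =>
      card_le_of_forall_exists_curve_point hsF hDs he hL hE hlarge (mul_ne_zero ha u.ne_zero) _ _
        Z hZ).trans (le_of_eq ?_)
  rw [hE]
  push_cast
  ring

theorem finite_monic_natDegree_eq (F : Type*) [Field F] [Finite F] (m : ℕ) :
    {f : F[X] | f.Monic ∧ f.natDegree = m}.Finite := by
  have := Finite.of_equiv _ (degreeLTEquiv F m).toEquiv.symm
  exact Set.finite_coe_iff.1 (Finite.of_equiv _ (monicEquivDegreeLT (R := F) m).symm)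

/-- The monic polynomials of degree `m` over a finite field. -/
def monicOfDegree (F : Type*) [Field F] [Finite F] (m : ℕ) : Finset F[X] :=
  (finite_monic_natDegree_eq F m).toFinset

theorem mem_monicOfDegree {F : Type*} [Field F] [Finite F] {m : ℕ} {f : F[X]} :
    f ∈ monicOfDegree F m ↔ f.Monic ∧ f.natDegree = m := by
  simp [monicOfDegree]

/-- The completely multiplicative weight on monic polynomials attached to a twisted Kloosterman
sum. -/
def kloostermanWeight {F : Type*} [Field F] (χ : MulChar F ℂ) (ψ : AddChar F ℂ) (a b : F)
    (f : F[X]) : ℂ :=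
  χ ((-1) ^ f.natDegree * f.coeff 0) * ψ (-(a * f.nextCoeff + b * (f.coeff 1 / f.coeff 0)))

section
variable {F : Type*} [Field F] (χ : MulChar F ℂ) (ψ : AddChar F ℂ) (a b : F)

theorem kloostermanWeight_one : kloostermanWeight χ ψ a b 1 = 1 := by
  simp [kloostermanWeight, coeff_one, nextCoeff]

theorem kloostermanWeight_of_coeff_zero {f : F[X]} (hf : f.coeff 0 = 0) :
    kloostermanWeight χ ψ a b f = 0 := by
  simp [kloostermanWeight, hf, MulChar.map_zero]

theorem kloostermanWeight_mul {f g : F[X]} (hf : f.Monic) (hg : g.Monic) :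
    kloostermanWeight χ ψ a b (f * g) =
      kloostermanWeight χ ψ a b f * kloostermanWeight χ ψ a b g := by
  by_cases hf0 : f.coeff 0 = 0
  · rw [kloostermanWeight_of_coeff_zero (f := f * g),
      kloostermanWeight_of_coeff_zero (f := f) (hf := hf0)] <;> simp [mul_coeff_zero, hf0]
  by_cases hg0 : g.coeff 0 = 0
  · rw [kloostermanWeight_of_coeff_zero (f := f * g),
      kloostermanWeight_of_coeff_zero (f := g) (hf := hg0)] <;> simp [mul_coeff_zero, hg0]
  have h1 : (f * g).coeff 1 / (f * g).coeff 0 = f.coeff 1 / f.coeff 0 + g.coeff 1 / g.coeff 0 := by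
    rw [mul_coeff_zero, mul_coeff_one]
    field_simp
    ring
  unfold kloostermanWeight
  rw [h1, hf.nextCoeff_mul hg, hf.natDegree_mul hg, mul_coeff_zero,
    show (-1 : F) ^ (f.natDegree + g.natDegree) * (f.coeff 0 * g.coeff 0) =
      ((-1) ^ f.natDegree * f.coeff 0) * ((-1) ^ g.natDegree * g.coeff 0) by ring, map_mul,
    show -(a * (f.nextCoeff + g.nextCoeff) +
      b * (f.coeff 1 / f.coeff 0 + g.coeff 1 / g.coeff 0)) =
      -(a * f.nextCoeff + b * (f.coeff 1 / f.coeff 0)) +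
      -(a * g.nextCoeff + b * (g.coeff 1 / g.coeff 0)) by ring, AddChar.map_add_eq_mul]
  ring

theorem kloostermanWeight_pow {f : F[X]} (hf : f.Monic) (e : ℕ) :
    kloostermanWeight χ ψ a b (f ^ e) = kloostermanWeight χ ψ a b f ^ e := by
  induction e with
  | zero => simp [kloostermanWeight_one]
  | succ e ih => rw [pow_succ, kloostermanWeight_mul χ ψ a b (hf.pow e) hf, ih, pow_succ]

/-- The sum of the weights of the monic polynomials of degree `m`. -/
def weightSum [Finite F] (m : ℕ) : ℂ := ∑ f ∈ monicOfDegree F m, kloostermanWeight χ ψ a b f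

theorem weightSum_zero [Finite F] : weightSum χ ψ a b 0 = 1 := by
  have : monicOfDegree F 0 = {1} := by
    ext f
    rw [mem_monicOfDegree, Finset.mem_singleton]
    constructor
    · rintro ⟨h1, h2⟩
      exact h1.natDegree_eq_zero.1 h2
    · rintro rfl
      simp
  rw [weightSum, this, Finset.sum_singleton, kloostermanWeight_one]

theorem weightSum_one [Fintype F] :
    weightSum χ ψ a b 1 = ∑ x : F, χ x * ψ (a * x + b * x⁻¹) := by
  symm
  refine Finset.sum_nbij' (fun x => X - C x) (fun f => -f.coeff 0) ?_ ?_ ?_ ?_ ?_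
  · intro x _
    exact mem_monicOfDegree.2 ⟨monic_X_sub_C x, natDegree_X_sub_C x⟩
  · simp
  · simp
  · intro f hf
    obtain ⟨h1, h2⟩ := mem_monicOfDegree.1 hf
    rw [h1.eq_X_add_C h2]
    simp
  · intro x _
    simp [kloostermanWeight, nextCoeff_X_sub_C, coeff_X, coeff_C]
    left
    congr 1
    ring

theorem AddChar.sum_mul_left_eq_zero [Fintype F] {ψ : AddChar F ℂ} (hψ : ψ ≠ 1) {c : F}
    (hc : c ≠ 0) :
    ∑ x, ψ (c * x) = 0 := by
  have := AddChar.sum_eq_zero_of_ne_one hψ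
  rw [← Equiv.sum_comp (Equiv.mulLeft₀ c hc)] at this
  exact this

variable {ψ a b}

theorem norm_weightSum_two_le [Fintype F] (hψ : ψ ≠ 1) (ha : a ≠ 0) (hb : b ≠ 0) :
    ‖weightSum χ ψ a b 2‖ ≤ Fintype.card F := by
  classical
  have h1 : weightSum χ ψ a b 2 =
      ∑ c : F × F, χ c.1 * ψ (-(a + b / c.1) * c.2) := by
    symm
    refine Finset.sum_nbij' (fun c => X ^ 2 + C c.2 * X + C c.1) (fun f => (f.coeff 0, f.coeff 1))
      ?_ ?_ ?_ ?_ ?_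
    · intro c _
      refine mem_monicOfDegree.2 ⟨by monicity!, by compute_degree!⟩
    · simp
    · intro c _
      simp [coeff_X, coeff_C]
    · intro f hf
      obtain ⟨h1, h2⟩ := mem_monicOfDegree.1 hf
      conv_rhs => rw [h1.as_sum, h2, Finset.sum_range_succ, Finset.sum_range_one]
      simp
      ring
    · intro c _
      have hd : (X ^ 2 + C c.2 * X + C c.1 : F[X]).natDegree = 2 := by compute_degree!
      have hn : (X ^ 2 + C c.2 * X + C c.1 : F[X]).nextCoeff = c.2 := by
        rw [nextCoeff_of_natDegree_pos (by omega), hd]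
        simp [coeff_C]
      rw [kloostermanWeight, hn, hd]
      simp [coeff_X, coeff_C]
      left
      congr 1
      ring
  rw [h1, Fintype.sum_prod_type]
  simp only [← Finset.mul_sum]
  rw [Finset.sum_eq_single (-(b / a))]
  · rw [norm_mul]
    have h2 : ‖χ (-(b / a))‖ ≤ 1 := by
      refine le_of_eq (Complex.norm_eq_one_of_pow_eq_one (n := Fintype.card F - 1) ?_ ?_)
      · rw [← map_pow, FiniteField.pow_card_sub_one_eq_one _ (by simp [ha, hb]), map_one]
      · have := Fintype.one_lt_card (α := F)
        omega
    have h3 : ‖∑ i : F, ψ (-(a + b / -(b / a)) * i)‖ ≤ Fintype.card F := by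
      refine (norm_sum_le _ _).trans ?_
      simp [AddChar.norm_apply]
    calc _ ≤ 1 * (Fintype.card F : ℝ) := mul_le_mul h2 h3 (norm_nonneg _) zero_le_one
      _ = _ := one_mul _
  · intro c _ hc
    by_cases hc0 : c = 0
    · simp [hc0, MulChar.map_zero]
    · rw [AddChar.sum_mul_left_eq_zero hψ, mul_zero]
      intro h
      apply hc
      field_simp at h ⊢
      linear_combination -h
  · simp

theorem weightSum_eq_zero [Fintype F] (hψ : ψ ≠ 1) (ha : a ≠ 0) {m : ℕ} (hm : 3 ≤ m) :
    weightSum χ ψ a b m = 0 := by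
  obtain ⟨y, hy⟩ := (AddChar.ne_one_iff).1 hψ
  set t := -(y / a) with ht
  have hlt : ∀ (f : F[X]) (t : F), f.Monic → f.natDegree = m →
      (C t * X ^ (m - 1)).degree < f.degree := by
    intro f t h1 h2
    refine (degree_C_mul_X_pow_le _ _).trans_lt ?_
    rw [degree_eq_natDegree h1.ne_zero, h2]
    exact_mod_cast (by omega : m - 1 < m)
  have hmem : ∀ (f : F[X]) (t : F), f ∈ monicOfDegree F m →
      f + C t * X ^ (m - 1) ∈ monicOfDegree F m := by
    intro f t hf
    obtain ⟨h1, h2⟩ := mem_monicOfDegree.1 hf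
    refine mem_monicOfDegree.2 ⟨h1.add_of_left (hlt f t h1 h2), ?_⟩
    rw [natDegree_add_eq_left_of_degree_lt (hlt f t h1 h2), h2]
  have key : weightSum χ ψ a b m = ψ y * weightSum χ ψ a b m := by
    conv_rhs => rw [weightSum, Finset.mul_sum]
    symm
    refine Finset.sum_nbij' (fun f => f + C t * X ^ (m - 1)) (fun f => f + C (-t) * X ^ (m - 1))
      (fun f hf => hmem f t hf) (fun f hf => hmem f (-t) hf) ?_ ?_ ?_
    · intro f _; simp
    · intro f _; simp
    · intro f hf
      obtain ⟨h1, h2⟩ := mem_monicOfDegree.1 hf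
      obtain ⟨-, h4⟩ := mem_monicOfDegree.1 (hmem f t hf)
      unfold kloostermanWeight
      rw [nextCoeff_of_natDegree_pos (by omega), nextCoeff_of_natDegree_pos (by omega), h2, h4]
      have e0 : (f + C t * X ^ (m - 1)).coeff 0 = f.coeff 0 := by
        rw [coeff_add, coeff_C_mul_X_pow, if_neg (by omega), add_zero]
      have e1 : (f + C t * X ^ (m - 1)).coeff 1 = f.coeff 1 := by
        rw [coeff_add, coeff_C_mul_X_pow, if_neg (by omega), add_zero]
      have e2 : (f + C t * X ^ (m - 1)).coeff (m - 1) = f.coeff (m - 1) + t := by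
        rw [coeff_add, coeff_C_mul_X_pow, if_pos rfl]
      rw [e0, e1, e2, show -(a * (f.coeff (m - 1) + t) + b * (f.coeff 1 / f.coeff 0)) =
        y + -(a * f.coeff (m - 1) + b * (f.coeff 1 / f.coeff 0)) by
          rw [ht]; field_simp; ring, AddChar.map_add_eq_mul]
      ring
  have : (ψ y - 1) * weightSum χ ψ a b m = 0 := by rw [sub_mul, ← key]; ring
  exact (mul_eq_zero.1 this).resolve_left (sub_ne_zero.2 hy)

end

/-- The monic irreducible polynomials of degree `m` over a finite field. -/
def irreducibleOfDegree (F : Type*) [Field F] [Finite F] (m : ℕ) : Finset F[X] := by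
  classical exact (monicOfDegree F m).filter Irreducible

theorem mem_irreducibleOfDegree {F : Type*} [Field F] [Finite F] {m : ℕ} {f : F[X]} :
    f ∈ irreducibleOfDegree F m ↔ f.Monic ∧ f.natDegree = m ∧ Irreducible f := by
  simp [irreducibleOfDegree, mem_monicOfDegree, and_assoc]

section
variable {F : Type*} [Field F]

theorem monic_of_mem_normalizedFactors [DecidableEq F] {f P : F[X]} (h : P ∈ normalizedFactors f) :
    P.Monic := by
  have h0 := (irreducible_of_normalized_factor P h).ne_zero
  rw [← normalize_normalized_factor P h]
  exact monic_normalize h0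

theorem pow_dvd_iff_le_count_normalizedFactors [DecidableEq F] {f P : F[X]} (hf : f ≠ 0)
    (hP : Irreducible P)
    (hPm : P.Monic) (e : ℕ) : P ^ e ∣ f ↔ e ≤ (normalizedFactors f).count P := by
  rw [pow_dvd_iff_le_emultiplicity, emultiplicity_eq_count_normalizedFactors hP hf,
    hPm.normalize_eq_self]
  norm_cast

theorem natDegree_eq_sum_count_mul [DecidableEq F] {f : F[X]} (hf : f.Monic) :
    f.natDegree = ∑ P ∈ (normalizedFactors f).toFinset,
      (normalizedFactors f).count P * P.natDegree := by
  conv_lhs => rw [← hf.normalize_eq_self, ← prod_normalizedFactors_eq hf.ne_zero]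
  rw [natDegree_multiset_prod _ (zero_notMem_normalizedFactors f), Finset.sum_multiset_map_count]
  simp

theorem natDegree_eq_sum_prime_powers [Finite F] {f : F[X]} (hf : f.Monic)
    [DecidablePred fun u => u ∣ f] :
    f.natDegree = ∑ j ∈ Finset.Icc 1 f.natDegree, ∑ x ∈ j.divisorsAntidiagonal,
      ∑ P ∈ irreducibleOfDegree F x.1, if P ^ x.2 ∣ f then x.1 else 0 := by
  classical
  conv_lhs => rw [natDegree_eq_sum_count_mul hf]
  have h1 : ∀ P ∈ (normalizedFactors f).toFinset, (normalizedFactors f).count P * P.natDegree =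
      ∑ e ∈ Finset.Icc 1 ((normalizedFactors f).count P), P.natDegree := by
    intro P _
    simp
  rw [Finset.sum_congr rfl h1, Finset.sum_sigma', Finset.sum_sigma', Finset.sum_sigma',
    ← Finset.sum_filter]
  refine Finset.sum_nbij' (fun y => ⟨⟨y.1.natDegree * y.2, (y.1.natDegree, y.2)⟩, y.1⟩)
    (fun y => ⟨y.2, y.1.2.2⟩) ?_ ?_ ?_ ?_ ?_
  · rintro ⟨P, e⟩ hy
    simp only [Finset.mem_sigma, Multiset.mem_toFinset, Finset.mem_Icc] at hy
    obtain ⟨hP, he1, he2⟩ := hy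
    have hPm := monic_of_mem_normalizedFactors hP
    have hPi := irreducible_of_normalized_factor P hP
    have hdvd := (pow_dvd_iff_le_count_normalizedFactors hf.ne_zero hPi hPm e).2 he2
    have hpos := hPi.natDegree_pos
    have hle := natDegree_le_of_dvd hdvd hf.ne_zero
    rw [natDegree_pow] at hle
    simp only [Finset.mem_filter, Finset.mem_sigma, Finset.mem_Icc, Nat.mem_divisorsAntidiagonal,
      mem_irreducibleOfDegree]
    have : 0 < P.natDegree * e := Nat.mul_pos hpos he1
    refine ⟨⟨⟨⟨this, by rwa [mul_comm]⟩, trivial, this.ne'⟩, hPm, trivial, hPi⟩, hdvd⟩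
  · rintro ⟨⟨j, δ, e⟩, P⟩ hy
    simp only [Finset.mem_filter, Finset.mem_sigma, Finset.mem_Icc, Nat.mem_divisorsAntidiagonal,
      mem_irreducibleOfDegree] at hy
    obtain ⟨⟨⟨-, h1, h2⟩, hPm, -, hPi⟩, hdvd⟩ := hy
    have he := (pow_dvd_iff_le_count_normalizedFactors hf.ne_zero hPi hPm e).1 hdvd
    have he1 : 1 ≤ e := by
      rcases Nat.eq_zero_or_pos e with h | h
      · subst h
        exact absurd h1.symm (by simpa using h2)
      · exact h
    simp only [Finset.mem_sigma, Multiset.mem_toFinset, Finset.mem_Icc]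
    exact ⟨Multiset.count_pos.1 (by omega), he1, he⟩
  · rintro ⟨P, e⟩ _
    rfl
  · rintro ⟨⟨j, δ, e⟩, P⟩ hy
    simp only [Finset.mem_filter, Finset.mem_sigma, Finset.mem_Icc, Nat.mem_divisorsAntidiagonal,
      mem_irreducibleOfDegree] at hy
    obtain ⟨⟨⟨-, rfl, h2⟩, hPm, rfl, hPi⟩, hdvd⟩ := hy
    rfl
  · rintro ⟨P, e⟩ _
    rfl

theorem sum_filter_dvd_weight [Finite F] {w : F[X] → ℂ}
    (hw : ∀ f g : F[X], f.Monic → g.Monic → w (f * g) = w f * w g) {u : F[X]} {m : ℕ}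
    (hu : u.Monic) (hum : u.natDegree ≤ m) [DecidablePred fun f => u ∣ f] :
    ∑ f ∈ (monicOfDegree F m).filter (fun f => u ∣ f), w f =
      w u * ∑ f ∈ monicOfDegree F (m - u.natDegree), w f := by
  rw [Finset.mul_sum]
  symm
  refine Finset.sum_bij (fun f _ => u * f) ?_ ?_ ?_ ?_
  · intro f hf
    obtain ⟨h1, h2⟩ := mem_monicOfDegree.1 hf
    rw [Finset.mem_filter, mem_monicOfDegree]
    refine ⟨⟨hu.mul h1, ?_⟩, dvd_mul_right _ _⟩
    rw [hu.natDegree_mul h1, h2]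
    omega
  · intro f _ g _ h
    exact mul_left_cancel₀ hu.ne_zero h
  · intro f hf
    rw [Finset.mem_filter, mem_monicOfDegree] at hf
    obtain ⟨⟨h1, h2⟩, g, rfl⟩ := hf
    have hg := hu.of_mul_monic_left h1
    refine ⟨g, ?_, rfl⟩
    rw [mem_monicOfDegree]
    rw [hu.natDegree_mul hg] at h2
    exact ⟨hg, by omega⟩
  · intro f hf
    rw [hw _ _ hu (mem_monicOfDegree.1 hf).1]

theorem natCast_mul_sum_weight [Finite F] {w : F[X] → ℂ}
    (hw : ∀ f g : F[X], f.Monic → g.Monic → w (f * g) = w f * w g)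
    (hwp : ∀ f : F[X], f.Monic → ∀ e, w (f ^ e) = w f ^ e) (m : ℕ) :
    m * ∑ f ∈ monicOfDegree F m, w f = ∑ j ∈ Finset.Icc 1 m,
      (∑ x ∈ j.divisorsAntidiagonal, ∑ P ∈ irreducibleOfDegree F x.1, x.1 * w P ^ x.2) *
        ∑ f ∈ monicOfDegree F (m - j), w f := by
  classical
  have h1 : ∀ f ∈ monicOfDegree F m, (m : ℂ) * w f =
      ∑ j ∈ Finset.Icc 1 m, ∑ x ∈ j.divisorsAntidiagonal,
      ∑ P ∈ irreducibleOfDegree F x.1, if P ^ x.2 ∣ f then x.1 * w f else 0 := by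
    intro f hf
    obtain ⟨hfm, hd⟩ := mem_monicOfDegree.1 hf
    have h2 := congrArg (fun k : ℕ => (k : ℂ) * w f) (natDegree_eq_sum_prime_powers hfm)
    simp only [hd] at h2
    rw [h2]
    push_cast
    simp only [Finset.sum_mul, ite_mul, zero_mul]
  rw [Finset.mul_sum, Finset.sum_congr rfl h1, Finset.sum_comm]
  refine Finset.sum_congr rfl fun j hj => ?_
  rw [Finset.sum_comm, Finset.sum_mul]
  refine Finset.sum_congr rfl fun x hx => ?_
  rw [Finset.sum_comm, Finset.sum_mul]
  refine Finset.sum_congr rfl fun P hP => ?_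
  obtain ⟨hPm, hPd, -⟩ := mem_irreducibleOfDegree.1 hP
  have hd : (P ^ x.2).natDegree = j := by
    rw [natDegree_pow, hPd, mul_comm, (Nat.mem_divisorsAntidiagonal.1 hx).1]
  rw [← Finset.sum_filter, ← Finset.mul_sum,
    sum_filter_dvd_weight hw (hPm.pow _) (hd.le.trans (Finset.mem_Icc.1 hj).2), hd, hwp P hPm,
    mul_assoc]

end

section
variable {F E : Type*} [Field F] [Field E] [Algebra F E]
open IntermediateField

theorem norm_eq_coeff_zero_minpoly_pow [FiniteDimensional F E] (x : E) :
    Algebra.norm F x =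
      ((-1) ^ (minpoly F x).natDegree * (minpoly F x).coeff 0) ^ Module.finrank F⟮x⟯ E := by
  have hx := Algebra.IsIntegral.isIntegral (R := F) x
  rw [Algebra.norm_eq_norm_adjoin, ← adjoin.powerBasis_gen hx,
    Algebra.PowerBasis.norm_gen_eq_coeff_zero_minpoly, adjoin.powerBasis_gen, minpoly_gen,
    adjoin.powerBasis_dim]

theorem adjoin_simple_inv (x : E) : F⟮x⁻¹⟯ = F⟮x⟯ := by
  refine le_antisymm ?_ ?_
  · rw [adjoin_simple_le_iff]
    exact inv_mem (mem_adjoin_simple_self F x)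
  · rw [adjoin_simple_le_iff]
    have := inv_mem (mem_adjoin_simple_self F x⁻¹)
    rwa [inv_inv] at this

theorem minpoly_inv_nextCoeff [FiniteDimensional F E] {x : E} (hx0 : x ≠ 0) :
    (minpoly F x⁻¹).nextCoeff = (minpoly F x).coeff 1 / (minpoly F x).coeff 0 := by
  have hx := Algebra.IsIntegral.isIntegral (R := F) x
  have hxi := Algebra.IsIntegral.isIntegral (R := F) x⁻¹
  have hc0 : (minpoly F x).coeff 0 ≠ 0 := minpoly.coeff_zero_ne_zero hx hx0
  set P := minpoly F x with hP
  have hpos : 0 < P.natDegree := minpoly.natDegree_pos hx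
  have hdeg : (minpoly F x⁻¹).natDegree = P.natDegree := by
    rw [← adjoin.finrank hxi, ← adjoin.finrank hx, adjoin_simple_inv]
  have hrev0 : P.reverse ≠ 0 := by
    rw [Ne, reverse_eq_zero]
    exact minpoly.ne_zero hx
  have hrevdeg : P.reverse.natDegree = P.natDegree := by
    rw [reverse_natDegree, natTrailingDegree_eq_zero.2 (Or.inr hc0), Nat.sub_zero]
  have hroot : aeval x⁻¹ P.reverse = 0 := by
    have : Invertible x := invertibleOfNonzero hx0
    rw [aeval_def, ← invOf_eq_inv, eval₂_reverse_eq_zero_iff]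
    exact minpoly.aeval F x
  have hdvd := minpoly.dvd F x⁻¹ hroot
  obtain ⟨c, hc⟩ := hdvd
  have hc' : c.natDegree = 0 := by
    have h2 := congrArg natDegree hc
    rw [natDegree_mul (minpoly.ne_zero hxi) (by rintro rfl; rw [mul_zero] at hc; exact hrev0 hc),
      hdeg,
      hrevdeg] at h2
    omega
  rw [eq_C_of_natDegree_eq_zero hc'] at hc
  set d := c.coeff 0
  have hlead := congrArg (fun f : F[X] => f.coeff P.natDegree) hc
  have hnext := congrArg (fun f : F[X] => f.coeff (P.natDegree - 1)) hc
  simp only [coeff_mul_C] at hlead hnext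
  rw [coeff_reverse, revAt_le le_rfl, Nat.sub_self] at hlead
  rw [coeff_reverse, revAt_le (by omega), Nat.sub_sub_self hpos] at hnext
  have hl : (minpoly F x⁻¹).coeff P.natDegree = 1 := by
    rw [← hdeg]; exact minpoly.monic hxi
  rw [hl, one_mul] at hlead
  rw [nextCoeff_of_natDegree_pos (by omega), hdeg, hnext, hlead]
  rw [hlead] at hc0
  field_simp

theorem kloostermanWeight_minpoly_pow [FiniteDimensional F E] (χ : MulChar F ℂ) (ψ : AddChar F ℂ)
    (a b : F) (x : E) :
    kloostermanWeight χ ψ a b (minpoly F x) ^ Module.finrank F⟮x⟯ E =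
      χ (Algebra.norm F x) * ψ (a * Algebra.trace F E x + b * Algebra.trace F E x⁻¹) := by
  have hne : Module.finrank F⟮x⟯ E ≠ 0 := Module.finrank_pos.ne'
  by_cases hx : x = 0
  · subst hx
    rw [minpoly.zero, kloostermanWeight_of_coeff_zero _ _ _ _ coeff_X_zero, zero_pow hne,
      Algebra.norm_zero, MulChar.map_zero, zero_mul]
  · rw [norm_eq_coeff_zero_minpoly_pow, trace_eq_finrank_mul_minpoly_nextCoeff F x,
      trace_eq_finrank_mul_minpoly_nextCoeff F x⁻¹, minpoly_inv_nextCoeff hx, adjoin_simple_inv,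
      kloostermanWeight, mul_pow, ← map_pow, ← AddChar.map_nsmul_eq_pow, nsmul_eq_mul]
    congr 2
    ring

theorem card_minpoly_eq [Fintype E] [DecidableEq F[X]] {P : F[X]} (hP : Irreducible P)
    (hPm : P.Monic)
    (hdvd : P.natDegree ∣ Module.finrank F E) :
    (Finset.univ.filter fun x : E => minpoly F x = P).card = P.natDegree := by
  have : Fact (Irreducible P) := ⟨hP⟩
  have hfr : Module.finrank F (AdjoinRoot P) = P.natDegree := by
    rw [(AdjoinRoot.powerBasis hP.ne_zero).finrank, AdjoinRoot.powerBasis_dim]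
  classical
  rw [← hfr, ← FiniteField.natCard_algHom_of_finrank_dvd (L := E) (by rwa [hfr]),
    Nat.card_congr (AdjoinRoot.equiv E F P hP.ne_zero)]
  refine (Nat.subtype_card _ fun x => ?_).symm
  simp only [Finset.mem_filter, Finset.mem_univ, true_and, mem_aroots]
  constructor
  · rintro rfl
    exact ⟨hP.ne_zero, minpoly.aeval F x⟩
  · rintro ⟨-, h⟩
    exact (minpoly.eq_of_irreducible_of_monic hP h hPm).symm

theorem sum_norm_trace_eq_sum_irreducible [Finite F] [Fintype E] (χ : MulChar F ℂ)
    (ψ : AddChar F ℂ) (a b : F) :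
    ∑ x : E, χ (Algebra.norm F x) * ψ (a * Algebra.trace F E x + b * Algebra.trace F E x⁻¹) =
      ∑ y ∈ (Module.finrank F E).divisorsAntidiagonal, ∑ P ∈ irreducibleOfDegree F y.1,
        y.1 * kloostermanWeight χ ψ a b P ^ y.2 := by
  classical
  have hfr : ∀ x : E, (minpoly F x).natDegree * Module.finrank F⟮x⟯ E = Module.finrank F E := by
    intro x
    rw [← adjoin.finrank (Algebra.IsIntegral.isIntegral (R := F) x), Module.finrank_mul_finrank]
  rw [Finset.sum_sigma']
  rw [← Finset.sum_fiberwise_of_maps_to (t := (Module.finrank F E).divisorsAntidiagonal.sigma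
    fun y => irreducibleOfDegree F y.1) (g := fun x : E =>
    (⟨((minpoly F x).natDegree, Module.finrank F⟮x⟯ E), minpoly F x⟩ : Σ _ : ℕ × ℕ, F[X]))]
  · refine Finset.sum_congr rfl ?_
    rintro ⟨⟨δ, e⟩, P⟩ hy
    rw [Finset.mem_sigma, Nat.mem_divisorsAntidiagonal, mem_irreducibleOfDegree] at hy
    dsimp only at hy ⊢
    obtain ⟨⟨h1, h2⟩, hPm, rfl, hPi⟩ := hy
    have hfib : (Finset.univ.filter fun x : E =>
        (⟨((minpoly F x).natDegree, Module.finrank F⟮x⟯ E), minpoly F x⟩ : Σ _ : ℕ × ℕ, F[X]) =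
          ⟨(P.natDegree, e), P⟩) = Finset.univ.filter fun x : E => minpoly F x = P := by
      ext x
      simp only [Finset.mem_filter, Finset.mem_univ, true_and, Sigma.mk.injEq, Prod.mk.injEq,
        heq_eq_eq]
      constructor
      · exact fun h => h.2
      · rintro rfl
        refine ⟨⟨rfl, ?_⟩, rfl⟩
        exact Nat.eq_of_mul_eq_mul_left hPi.natDegree_pos ((hfr x).trans h1.symm)
    rw [Finset.sum_congr rfl (g := fun _ => kloostermanWeight χ ψ a b P ^ e), Finset.sum_const,
      hfib, card_minpoly_eq hPi hPm ⟨e, h1.symm⟩, nsmul_eq_mul]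
    intro x hx
    simp only [Finset.mem_filter, Finset.mem_univ, true_and, Sigma.mk.injEq, Prod.mk.injEq,
        heq_eq_eq] at hx
    rw [← kloostermanWeight_minpoly_pow, hx.1.2, hx.2]
  · rintro x -
    rw [Finset.mem_sigma, Nat.mem_divisorsAntidiagonal, mem_irreducibleOfDegree]
    have hx := Algebra.IsIntegral.isIntegral (R := F) x
    exact ⟨⟨hfr x, Module.finrank_pos.ne'⟩, minpoly.monic hx, rfl, minpoly.irreducible hx⟩

end

theorem sum_units_eq_sum {E M : Type*} [Field E] [Fintype E] [DecidableEq E] [AddCommMonoid M]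
    {f : E → M} (hf : f 0 = 0) : ∑ u : Eˣ, f u = ∑ x, f x := by
  rw [← Finset.sum_subset (Finset.subset_univ (Finset.univ.image fun u : Eˣ => (u : E))),
    Finset.sum_image fun u _ v _ h => Units.ext h]
  intro x _ hx
  by_cases h : x = 0
  · rw [h, hf]
  · exact absurd (Finset.mem_image.2 ⟨Units.mk0 x h, Finset.mem_univ _, rfl⟩) hx

/-- The pullback of a multiplicative character along the norm. -/
def normChar {F : Type*} (E : Type*) [Field F] [Field E] [Algebra F E] [FiniteDimensional F E]
    (χ : MulChar F ℂ) : MulChar E ℂ where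
  toMonoidHom := χ.toMonoidHom.comp (Algebra.norm F)
  map_nonunit' := by
    intro x hx
    rw [isUnit_iff_ne_zero, not_not] at hx
    subst hx
    exact (congrArg χ Algebra.norm_zero).trans χ.map_zero

theorem normChar_apply {F E : Type*} [Field F] [Field E] [Algebra F E] [FiniteDimensional F E]
    (χ : MulChar F ℂ) (x : E) : normChar E χ x = χ (Algebra.norm F x) := rfl

/-- The pullback of an additive character along the trace. -/
def traceChar {F : Type*} (E : Type*) [Field F] [Field E] [Algebra F E]
    (ψ : AddChar F ℂ) : AddChar E ℂ :=
  ψ.compAddMonoidHom (Algebra.trace F E).toAddMonoidHom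

theorem traceChar_apply {F E : Type*} [Field F] [Field E] [Algebra F E]
    (ψ : AddChar F ℂ) (x : E) : traceChar E ψ x = ψ (Algebra.trace F E x) := rfl

theorem trace_pow_card {F E : Type*} [Field F] [Fintype F] [Field E] [Finite E] [Algebra F E]
    (x : E) : Algebra.trace F E (x ^ Fintype.card F) = Algebra.trace F E x := by
  rw [← show FiniteField.frobeniusAlgEquivOfAlgebraic F E x = x ^ Fintype.card F from
    congrFun (FiniteField.coe_frobeniusAlgEquivOfAlgebraic F E) x]
  exact Algebra.trace_eq_of_algEquiv _ _

theorem norm_sum_norm_trace_le {F E : Type*} [Field F] [Fintype F] [Field E] [Fintype E]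
    [Algebra F E] (χ : MulChar F ℂ) {ψ : AddChar F ℂ} (hψ : ψ ≠ 1) {a : F} (ha : a ≠ 0) (b : F)
    {s e μ : ℕ} (hs : Fintype.card F = s) (he : e = (s - 1) * (s + 1))
    (hE : Module.finrank F E = 2 * (μ + 1)) (hμ : s * (e ^ 2 + 2 * e) + 2 * e + 3 ≤ s ^ μ) :
    ‖∑ x : E, χ (Algebra.norm F x) * ψ (a * Algebra.trace F E x + b * Algebra.trace F E x⁻¹)‖ ≤
      (1 + s * (2 * e + 2)) * s ^ (μ + 1) + 1 := by
  classical
  have hs2 : 2 ≤ s := hs ▸ Fintype.one_lt_card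
  have hcard : Fintype.card E = (s * s ^ μ) ^ 2 := by
    rw [Module.card_eq_pow_finrank (K := F), hE, hs]; ring
  have hψ' : traceChar E ψ ≠ 1 := by
    obtain ⟨y, hy⟩ := AddChar.ne_one_iff.1 hψ
    obtain ⟨x, rfl⟩ := Algebra.trace_surjective F E y
    exact AddChar.ne_one_iff.2 ⟨x, hy⟩
  have hψs : ∀ y, traceChar E ψ (y ^ s) = traceChar E ψ y := by
    intro y
    rw [traceChar_apply, traceChar_apply, ← hs, trace_pow_card]
  have hχD : ∀ z : Eˣ, normChar E χ ((z : E) ^ (s - 1)) = 1 := by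
    intro z
    rw [normChar_apply, map_pow, ← hs, FiniteField.pow_card_sub_one_eq_one, map_one]
    exact Algebra.norm_ne_zero_iff.2 z.ne_zero
  have := norm_sum_units_le_of_large (F := F) hs (by omega : s - 1 + 1 = s) he rfl hcard hμ
    (normChar E χ) (traceChar E ψ) hψ' hψs hχD (a := algebraMap F E a) (by simpa using ha)
    (algebraMap F E b)
  rw [sum_units_eq_sum (f := fun x => normChar E χ x *
    traceChar E ψ (algebraMap F E a * x + algebraMap F E b * x⁻¹))
    (by rw [MulChar.map_zero, zero_mul])] at this
  simp only [normChar_apply, traceChar_apply, map_add, ← Algebra.smul_def, map_smul,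
    smul_eq_mul] at this
  refine this.trans (le_of_eq ?_)
  push_cast
  ring

theorem norm_sq_le_of_norm_pow_add_pow_le {ω₁ ω₂ : ℂ} {s C : ℝ} {M : ℕ} (hs : 1 ≤ s)
    (hprod : ‖ω₁ * ω₂‖ ≤ s)
    (h : ∀ μ, M ≤ μ → ‖ω₁ ^ (2 * μ) + ω₂ ^ (2 * μ)‖ ≤ C * s ^ μ + 1) : ‖ω₁‖ ^ 2 ≤ s := by
  by_contra! hcon
  have hs0 : 0 < s := by linarith
  have hy : ‖ω₂‖ ^ 2 ≤ s := by
    by_contra! hy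
    rw [norm_mul] at hprod
    have h1 : (‖ω₁‖ * ‖ω₂‖) ^ 2 ≤ s ^ 2 := pow_le_pow_left₀ (by positivity) hprod 2
    rw [mul_pow] at h1
    nlinarith
  have hlt : 1 < ‖ω₁‖ ^ 2 / s := by rwa [one_lt_div hs0]
  obtain ⟨n, hn⟩ := pow_unbounded_of_one_lt (C + 2) hlt
  have hn' : C + 2 < (‖ω₁‖ ^ 2 / s) ^ (max n M) :=
    hn.trans_le (pow_le_pow_right₀ hlt.le (le_max_left _ _))
  have h2 := h (max n M) (le_max_right _ _)
  set ν := max n M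
  have h3 : ‖ω₁ ^ (2 * ν)‖ ≤ ‖ω₁ ^ (2 * ν) + ω₂ ^ (2 * ν)‖ + ‖ω₂ ^ (2 * ν)‖ := by
    have := norm_sub_le (ω₁ ^ (2 * ν) + ω₂ ^ (2 * ν)) (ω₂ ^ (2 * ν))
    rwa [add_sub_cancel_right] at this
  rw [norm_pow ω₁, norm_pow ω₂, pow_mul ‖ω₁‖, pow_mul ‖ω₂‖] at h3
  have h4 : (‖ω₂‖ ^ 2) ^ ν ≤ s ^ ν := pow_le_pow_left₀ (by positivity) hy ν
  have h5 : 1 ≤ s ^ ν := one_le_pow₀ hs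
  rw [div_pow, lt_div_iff₀ (by positivity)] at hn'
  nlinarith

theorem norm_kloosterman_le {F : Type*} [Field F] [Fintype F] (χ : MulChar F ℂ)
    {ψ : AddChar F ℂ} (hψ : ψ ≠ 1) {a b : F} (ha : a ≠ 0) (hb : b ≠ 0) :
    ‖∑ x : F, χ x * ψ (a * x + b * x⁻¹)‖ ≤ 2 * √(Fintype.card F) := by
  classical
  obtain ⟨p, hp⟩ := CharP.exists F
  obtain ⟨n, hpp, hpn⟩ := FiniteField.card F p
  have : Fact p.Prime := ⟨hpp⟩
  obtain ⟨s, hs⟩ : ∃ s, Fintype.card F = s := ⟨_, rfl⟩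
  have hs2 : 2 ≤ s := hs ▸ Fintype.one_lt_card
  obtain ⟨e, he⟩ : ∃ e, e = (s - 1) * (s + 1) := ⟨_, rfl⟩
  set A := weightSum χ ψ a b with hA
  set S : ℕ → ℂ := fun j => ∑ y ∈ j.divisorsAntidiagonal, ∑ P ∈ irreducibleOfDegree F y.1,
        y.1 * kloostermanWeight χ ψ a b P ^ y.2 with hS
  have hrec : ∀ m : ℕ, m * A m = ∑ j ∈ Finset.Icc 1 m, S j * A (m - j) :=
    natCast_mul_sum_weight (fun f g => kloostermanWeight_mul χ ψ a b)
      fun f hf e => kloostermanWeight_pow χ ψ a b hf e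
  have hA0 : A 0 = 1 := weightSum_zero χ ψ a b
  have hA3 : ∀ m, 3 ≤ m → A m = 0 := fun m hm => weightSum_eq_zero χ hψ ha hm
  have hA2 : ‖A 2‖ ≤ s := hs ▸ norm_weightSum_two_le χ hψ ha hb
  obtain ⟨ω₁, hω₁⟩ : ∃ ω : ℂ, ω ^ 2 + A 1 * ω + A 2 = 0 := by
    obtain ⟨ω, hω⟩ := IsAlgClosed.exists_root (X ^ 2 + C (A 1) * X + C (A 2) : ℂ[X]) (by
      rw [show (X ^ 2 + C (A 1) * X + C (A 2) : ℂ[X]).degree = 2 by compute_degree!]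
      norm_num)
    exact ⟨ω, by simpa using hω⟩
  obtain ⟨ω₂, hω₂⟩ : ∃ ω₂, ω₂ = -A 1 - ω₁ := ⟨_, rfl⟩
  have hsum : A 1 = -(ω₁ + ω₂) := by rw [hω₂]; ring
  have hprod : A 2 = ω₁ * ω₂ := by rw [hω₂]; linear_combination hω₁
  have hSω : ∀ m, S (m + 1) = -(ω₁ ^ (m + 1) + ω₂ ^ (m + 1)) := by
    intro m
    induction m using Nat.twoStepInduction with
    | zero =>
      have := hrec 1
      simp only [Finset.Icc_self, Finset.sum_singleton, Nat.sub_self, hA0] at this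
      linear_combination hsum - this
    | one =>
      have h1 := hrec 1
      have h2 := hrec 2
      simp only [Finset.Icc_self, Finset.sum_singleton, Nat.sub_self, hA0] at h1
      rw [show Finset.Icc 1 2 = {1, 2} by rfl, Finset.sum_pair (by norm_num)] at h2
      simp only [Nat.sub_self, hA0, Nat.reduceSub] at h2
      push_cast at h1 h2
      have h3 : S 2 = 2 * A 2 - A 1 ^ 2 := by linear_combination -h2 + A 1 * h1
      rw [show 1 + 1 = 2 from rfl, h3, hsum, hprod]
      ring
    | more m ih1 ih2 =>
      have h := hrec (m + 3)
      rw [hA3 _ (by omega), mul_zero, Finset.sum_Icc_succ_top (by omega),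
        Finset.sum_Icc_succ_top (by omega), Finset.sum_Icc_succ_top (by omega),
        Finset.sum_eq_zero] at h
      · rw [show m + 3 - (m + 1) = 2 by omega, show m + 3 - (m + 1 + 1) = 1 by omega,
          show m + 3 - (m + 2 + 1) = 0 by omega, hA0, ih1, ih2, hsum, hprod] at h
        rw [show m + 2 + 1 = m + 1 + 1 + 1 by rfl]
        rw [show m + 2 + 1 = m + 1 + 1 + 1 by rfl] at h
        linear_combination -h
      · intro j hj
        rw [Finset.mem_Icc] at hj
        rw [hA3 _ (by omega), mul_zero]
  have hbound : ∀ μ, s * (e ^ 2 + 2 * e) + 2 * e + 3 + 1 ≤ μ →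
      ‖ω₁ ^ (2 * μ) + ω₂ ^ (2 * μ)‖ ≤ (1 + s * (2 * e + 2)) * (s : ℝ) ^ μ + 1 := by
    intro μ hμ
    obtain ⟨ν, rfl⟩ : ∃ ν, μ = ν + 1 := ⟨μ - 1, by omega⟩
    have h1 := hSω (2 * ν + 1)
    rw [show 2 * (ν + 1) = 2 * ν + 1 + 1 by ring, ← norm_neg, ← h1,
      show 2 * ν + 1 + 1 = 2 * (ν + 1) by ring]
    have : NeZero (2 * (ν + 1)) := ⟨by omega⟩
    have hfr : Module.finrank F (FiniteField.Extension F p (2 * (ν + 1))) = 2 * (ν + 1) :=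
      FiniteField.finrank_extension F p _
    have := Fintype.ofFinite (FiniteField.Extension F p (2 * (ν + 1)))
    have h2 := norm_sum_norm_trace_le (E := FiniteField.Extension F p (2 * (ν + 1))) χ hψ ha b hs he
      hfr ((by omega : _ ≤ ν).trans (Nat.lt_pow_self hs2).le)
    rw [sum_norm_trace_eq_sum_irreducible, hfr] at h2
    exact h2
  have hs1 : (1 : ℝ) ≤ s := by exact_mod_cast (by omega : 1 ≤ s)
  have hw1 := norm_sq_le_of_norm_pow_add_pow_le hs1 (hprod ▸ hA2) hbound
  have hw2 := norm_sq_le_of_norm_pow_add_pow_le (ω₁ := ω₂) (ω₂ := ω₁) hs1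
    (by rw [mul_comm]; exact hprod ▸ hA2)
    (fun μ hμ => by rw [add_comm]; exact hbound μ hμ)
  rw [← weightSum_one, hs, ← hA, hsum, norm_neg]
  have h1 := Real.le_sqrt_of_sq_le hw1
  have h2 := Real.le_sqrt_of_sq_le hw2
  linarith [norm_add_le ω₁ ω₂]

theorem AddChar.exists_eq_mulShift {F : Type*} [Field F] [Fintype F] {ψ : AddChar F ℂ}
    (hψ : ψ ≠ 1) (φ : AddChar F ℂ) : ∃ b, φ = ψ.mulShift b := by
  have hinj : Function.Injective ψ.mulShift :=
    AddChar.to_mulShift_inj_of_isPrimitive (AddChar.IsPrimitive.of_ne_one hψ)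
  have hsurj : Function.Surjective ψ.mulShift :=
    ((Fintype.bijective_iff_injective_and_card _).2 ⟨hinj, AddChar.card_eq.symm⟩).2
  exact (hsurj φ).imp fun _ h => h.symm

theorem norm_gaussSum_le {F : Type*} [Field F] [Fintype F] (χ : MulChar F ℂ)
    {ψ : AddChar F ℂ} (hψ : ψ ≠ 1) : ‖gaussSum χ ψ‖ ≤ √(Fintype.card F) := by
  by_cases hχ : χ = 1
  · subst hχ
    rw [gaussSum_one_left hψ, norm_neg, norm_one]
    exact Real.one_le_sqrt.2 (by exact_mod_cast Fintype.card_pos)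
  · have h := gaussSum_mul_gaussSum_eq_card hχ (AddChar.IsPrimitive.of_ne_one hψ)
    have hs : gaussSum χ⁻¹ ψ⁻¹ = star (gaussSum χ ψ) := by
      rw [star_gaussSum_eq]
    rw [hs] at h
    apply Real.le_sqrt_of_sq_le
    have h' := congrArg norm h
    rw [norm_mul, norm_star, Complex.norm_natCast] at h'
    nlinarith

theorem norm_kloosterman_le_of_ne_one {F : Type*} [Field F] [Fintype F] (χ : MulChar F ℂ)
    (ψ₁ ψ₂ : AddChar F ℂ) (h : ¬(χ = 1 ∧ ψ₁ = 1 ∧ ψ₂ = 1)) :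
    ‖∑ x : F, χ x * (ψ₁ x * ψ₂ x⁻¹)‖ ≤ 2 * √(Fintype.card F) := by
  have hs := Real.sqrt_nonneg (Fintype.card F)
  by_cases h₁ : ψ₁ = 1 <;> by_cases h₂ : ψ₂ = 1
  · subst h₁ h₂
    simp only [AddChar.one_apply, mul_one]
    rw [MulChar.sum_eq_zero_of_ne_one (by tauto), norm_zero]
    positivity
  · subst h₁
    have : ∑ x : F, χ x * ((1 : AddChar F ℂ) x * ψ₂ x⁻¹) = gaussSum χ⁻¹ ψ₂ := by
      rw [gaussSum]
      refine Fintype.sum_equiv (Equiv.inv F) _ _ fun x => ?_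
      rw [AddChar.one_apply, one_mul, Equiv.inv_apply, MulChar.inv_apply', inv_inv]
    rw [this]
    linarith [norm_gaussSum_le χ⁻¹ h₂]
  · subst h₂
    simp only [AddChar.one_apply, mul_one]
    have := norm_gaussSum_le χ h₁
    rw [gaussSum] at this
    linarith
  · obtain ⟨b, rfl⟩ := AddChar.exists_eq_mulShift h₁ ψ₂
    have hb : b ≠ 0 := by
      rintro rfl
      exact h₂ (AddChar.mulShift_zero _)
    have := norm_kloosterman_le χ h₁ one_ne_zero hb
    simpa only [one_mul, AddChar.map_add_eq_mul, AddChar.mulShift_apply] using this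

/-- Every linear functional bounded by `B` on the additive characters of `G` is bounded by
`C * B` at `φ`; that is, the Fourier coefficients of `φ` have `ℓ¹` norm at most `C`. -/
def FourierBound {G : Type*} [AddCommGroup G] (φ : G → ℂ) (C : ℝ) : Prop :=
  ∀ (L : (G → ℂ) →ₗ[ℂ] ℂ) (B : ℝ), (∀ ψ : AddChar G ℂ, ‖L ψ‖ ≤ B) → ‖L φ‖ ≤ C * B

namespace FourierBound

variable {G : Type*} [AddCommGroup G]

theorem of_addChar (ψ : AddChar G ℂ) : FourierBound (ψ : G → ℂ) 1 := fun L B h => by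
  rw [one_mul]
  exact h ψ

theorem mul {φ φ' : G → ℂ} {C C' : ℝ} (hφ : FourierBound φ C) (hφ' : FourierBound φ' C') :
    FourierBound (φ * φ') (C * C') := by
  intro L B hL
  have key : ∀ ψ : AddChar G ℂ, ‖L (φ * ψ)‖ ≤ C * B := by
    intro ψ
    refine (mul_comm φ (ψ : G → ℂ)) ▸ hφ (L ∘ₗ LinearMap.mulLeft ℂ (ψ : G → ℂ)) B fun θ => ?_
    simpa using hL (ψ * θ)
  have := hφ' (L ∘ₗ LinearMap.mulLeft ℂ φ) (C * B) fun ψ => by simpa using key ψ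
  rw [LinearMap.comp_apply, LinearMap.mulLeft_apply] at this
  linarith

theorem mono {φ : G → ℂ} {C C' : ℝ} (hφ : FourierBound φ C) (h : C ≤ C') :
    FourierBound φ C' := fun L B hL =>
  (hφ L B hL).trans (mul_le_mul_of_nonneg_right h ((norm_nonneg _).trans (hL 1)))

end FourierBound

section Annihilator

variable {G : Type*} [AddCommGroup G]

theorem injective_compAddMonoidHom_mk (S : AddSubgroup G) :
    Function.Injective fun θ : AddChar (G ⧸ S) ℂ =>
      θ.compAddMonoidHom (QuotientAddGroup.mk' S) := by
  intro θ θ' h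
  ext x
  obtain ⟨x, rfl⟩ := QuotientAddGroup.mk'_surjective S x
  exact DFunLike.congr_fun h x

variable [Finite G]

/-- The additive characters of `G` that are trivial on `S`. -/
def AddSubgroup.annihilator (S : AddSubgroup G) : Finset (AddChar G ℂ) :=
  haveI := Fintype.ofFinite (G ⧸ S)
  Finset.univ.map ⟨_, injective_compAddMonoidHom_mk S⟩

theorem AddSubgroup.card_annihilator (S : AddSubgroup G) : S.annihilator.card = S.index := by
  have := Fintype.ofFinite (G ⧸ S)
  rw [annihilator, Finset.card_map, Finset.card_univ, AddSubgroup.index,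
    Nat.card_eq_fintype_card]
  convert AddChar.card_eq (α := G ⧸ S)

theorem AddSubgroup.mem_annihilator {S : AddSubgroup G} {ψ : AddChar G ℂ} :
    ψ ∈ S.annihilator ↔ ∀ x ∈ S, ψ x = 1 := by
  have := Fintype.ofFinite (G ⧸ S)
  simp only [annihilator, Finset.mem_map, Finset.mem_univ, true_and, Function.Embedding.coeFn_mk]
  constructor
  · rintro ⟨θ, rfl⟩ x hx
    rw [AddChar.compAddMonoidHom_apply, QuotientAddGroup.mk'_apply,
      (QuotientAddGroup.eq_zero_iff x).2 hx, AddChar.map_zero_eq_one]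
  · intro h
    refine ⟨AddChar.toAddMonoidHomEquiv.symm
      (QuotientAddGroup.lift S (AddChar.toAddMonoidHomEquiv ψ) fun x hx => ?_), ?_⟩
    · exact congrArg Additive.ofMul (h x hx)
    · ext x
      rfl

theorem AddSubgroup.sum_annihilator (S : AddSubgroup G) :
    ∑ ψ ∈ S.annihilator, (ψ : G → ℂ) = (S.index : ℂ) • (S : Set G).indicator 1 := by
  classical
  have := Fintype.ofFinite (G ⧸ S)
  ext x
  have h := AddChar.sum_apply_eq_ite (QuotientAddGroup.mk' S x)
  rw [Finset.sum_apply, annihilator, Finset.sum_map]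
  simp only [Function.Embedding.coeFn_mk, AddChar.compAddMonoidHom_apply]
  simp only [QuotientAddGroup.mk'_apply, QuotientAddGroup.eq_zero_iff] at h
  rw [Pi.smul_apply, Set.indicator_apply, AddSubgroup.index, Nat.card_eq_fintype_card,
    QuotientAddGroup.mk'_apply, smul_eq_mul, Pi.one_apply]
  simpa using h

theorem FourierBound.indicator (S : AddSubgroup G) :
    FourierBound ((S : Set G).indicator 1) 1 := by
  intro L B hL
  have hi : (0 : ℝ) < S.index := by exact_mod_cast Nat.pos_of_ne_zero S.index_ne_zero_of_finite
  have h := congrArg (fun f => ‖L f‖) S.sum_annihilator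
  simp only [map_sum, map_smul, norm_smul, Complex.norm_natCast] at h
  have h2 : ‖∑ ψ ∈ S.annihilator, L ψ‖ ≤ S.index * B :=
    (norm_sum_le_of_le _ fun ψ _ => hL ψ).trans_eq (by
      rw [Finset.sum_const, S.card_annihilator, nsmul_eq_mul])
  rw [h] at h2
  rw [one_mul]
  exact le_of_mul_le_mul_left h2 hi

theorem FourierBound.indicator_sub_indicator {S T : AddSubgroup G} (h : T ≤ S) :
    FourierBound ((S : Set G).indicator 1 - (T : Set G).indicator 1)
      (2 * (1 - S.index / T.index)) := by
  classical
  intro L B hL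
  have hi : (0 : ℝ) < S.index := by exact_mod_cast Nat.pos_of_ne_zero S.index_ne_zero_of_finite
  have hj : (0 : ℝ) < T.index := by exact_mod_cast Nat.pos_of_ne_zero T.index_ne_zero_of_finite
  have hsub : S.annihilator ⊆ T.annihilator := fun ψ hψ =>
    AddSubgroup.mem_annihilator.2 fun x hx => AddSubgroup.mem_annihilator.1 hψ x (h hx)
  have hle : S.index ≤ T.index := by
    rw [← S.card_annihilator, ← T.card_annihilator]
    exact Finset.card_le_card hsub
  have h1 : ‖∑ ψ ∈ T.annihilator \ S.annihilator, L ψ‖ ≤ (T.index - S.index) * B :=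
    (norm_sum_le_of_le _ fun ψ _ => hL ψ).trans_eq (by
      rw [Finset.sum_const, Finset.card_sdiff_of_subset hsub, T.card_annihilator,
        S.card_annihilator, nsmul_eq_mul, Nat.cast_sub hle])
  have hS := congrArg L S.sum_annihilator
  have hT := congrArg L T.sum_annihilator
  rw [← Finset.sum_sdiff hsub, map_add, hS, map_smul, map_smul, map_sum, smul_eq_mul,
    smul_eq_mul] at hT
  have h2 := FourierBound.indicator S L B hL
  rw [one_mul] at h2
  rw [map_sub]
  set x := L ((S : Set G).indicator 1)
  set y := L ((T : Set G).indicator 1)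
  set z := ∑ ψ ∈ T.annihilator \ S.annihilator, L ψ
  have hj' : (T.index : ℂ) ≠ 0 := by exact_mod_cast T.index_ne_zero_of_finite
  have h3 : x - y = ((T.index : ℂ))⁻¹ * ((T.index - S.index) * x - z) := by
    field_simp
    linear_combination hT
  have h4 : ‖((T.index : ℂ) - S.index)‖ = T.index - S.index := by
    rw [← Nat.cast_sub hle, Complex.norm_natCast, Nat.cast_sub hle]
  have h5 : (0 : ℝ) ≤ (T.index : ℝ) - S.index := by
    rw [sub_nonneg]; exact_mod_cast hle
  rw [h3, norm_mul, norm_inv, Complex.norm_natCast, inv_mul_le_iff₀ hj]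
  calc _ ≤ ‖((T.index : ℂ) - S.index) * x‖ + ‖z‖ := norm_sub_le _ _
    _ ≤ (T.index - S.index) * B + (T.index - S.index) * B := by
      rw [norm_mul, h4]
      gcongr
    _ = _ := by
      field_simp
      ring

end Annihilator

/-- The average of a complex-valued function on a finite type. -/
def meanValue (G : Type*) [Fintype G] : (G → ℂ) →ₗ[ℂ] ℂ :=
  (Fintype.card G : ℂ)⁻¹ • ∑ x, LinearMap.proj x

theorem meanValue_apply {G : Type*} [Fintype G] (φ : G → ℂ) :
    meanValue G φ = (Fintype.card G : ℂ)⁻¹ * ∑ x, φ x := by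
  simp [meanValue, LinearMap.sum_apply]

theorem meanValue_addChar {G : Type*} [AddCommGroup G] [Fintype G] [DecidableEq (AddChar G ℂ)]
    (ψ : AddChar G ℂ) : meanValue G ψ = if ψ = 1 then 1 else 0 := by
  have hc : (Fintype.card G : ℂ) ≠ 0 := by exact_mod_cast Fintype.card_ne_zero
  rw [meanValue_apply, AddChar.sum_eq_ite]
  by_cases h : ψ = 1
  · rw [if_pos h, if_pos (by rw [h]; rfl), inv_mul_cancel₀ hc]
  · rw [if_neg h, if_neg (by exact h), mul_zero]

theorem meanValue_indicator {G : Type*} [AddCommGroup G] [Fintype G] (S : AddSubgroup G) :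
    meanValue G ((S : Set G).indicator 1) = ((S.index : ℝ)⁻¹ : ℝ) := by
  classical
  have hc : (Fintype.card G : ℂ) ≠ 0 := by exact_mod_cast Fintype.card_ne_zero
  have hi : (S.index : ℂ) ≠ 0 := by exact_mod_cast S.index_ne_zero_of_finite
  have h : (Nat.card S * S.index : ℂ) = Fintype.card G := by
    rw [← Nat.card_eq_fintype_card]
    exact_mod_cast S.card_mul_index
  have h2 : ∑ x, (S : Set G).indicator (1 : G → ℂ) x = Nat.card S := by
    rw [Finset.sum_indicator_eq_sum_filter]
    simp [Nat.card_eq_fintype_card, Fintype.card_subtype]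
  rw [meanValue_apply, h2]
  push_cast
  field_simp
  exact h

section Module

variable {R : Type*} (G : Type*) [CommRing R] [AddCommGroup G] [Module R G]

/-- The subgroup of multiples `c • x` of a ring element `c`. -/
def smulRange (c : R) : AddSubgroup G := (DistribSMul.toAddMonoidHom G c).range

variable {G}

theorem mem_smulRange {c : R} {x : G} : x ∈ smulRange G c ↔ ∃ y, c • y = x := Iff.rfl

theorem smul_mem_smulRange (c : R) (x : G) : c • x ∈ smulRange G c := ⟨x, rfl⟩

theorem smulRange_le_of_dvd {c l : R} (h : c ∣ l) : smulRange G l ≤ smulRange G c := by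
  obtain ⟨e, rfl⟩ := h
  rintro _ ⟨y, rfl⟩
  exact ⟨e • y, (mul_smul c e y).symm⟩

theorem smulRange_one : smulRange G (1 : R) = ⊤ :=
  top_le_iff.1 fun x _ => ⟨x, one_smul R x⟩

theorem IsCoprime.mem_smulRange_mul {a b : R} (hab : IsCoprime a b) {x : G}
    (ha : x ∈ smulRange G a) (hb : x ∈ smulRange G b) : x ∈ smulRange G (a * b) := by
  obtain ⟨u, v, huv⟩ := hab
  obtain ⟨y, hy⟩ := mem_smulRange.1 ha
  obtain ⟨z, hz⟩ := mem_smulRange.1 hb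
  refine ⟨u • z + v • y, ?_⟩
  calc (a * b) • (u • z + v • y) = (u * a) • b • z + (v * b) • a • y := by
        simp only [smul_add, smul_smul]
        congr 2 <;> ring
    _ = x := by rw [hz, hy, ← add_smul, huv, one_smul]

theorem mem_smulRange_prod {ι : Type*} {s : Finset ι} {a : ι → R}
    (ha : (s : Set ι).Pairwise fun i j => IsCoprime (a i) (a j)) {x : G}
    (hx : ∀ i ∈ s, x ∈ smulRange G (a i)) : x ∈ smulRange G (∏ i ∈ s, a i) := by
  classical
  induction s using Finset.induction_on with
  | empty => rw [Finset.prod_empty, smulRange_one]; trivial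
  | insert i s hi ih =>
    rw [Finset.prod_insert hi]
    refine IsCoprime.mem_smulRange_mul (IsCoprime.prod_right fun j hj => ?_)
      (hx i (Finset.mem_insert_self i s))
      (ih (ha.mono (by simp)) fun j hj => hx j (Finset.mem_insert_of_mem hj))
    exact ha (by simp) (by simp [hj]) (by rintro rfl; exact hi hj)

theorem indicator_smulRange_add_smul {c l : R} (h : c ∣ l) (x y : G) :
    (smulRange G c : Set G).indicator (1 : G → ℂ) (x + l • y) =
      (smulRange G c : Set G).indicator 1 x := by
  classical
  have : x + l • y ∈ smulRange G c ↔ x ∈ smulRange G c :=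
    AddSubgroup.add_mem_cancel_right _ (smulRange_le_of_dvd h (smul_mem_smulRange l y))
  simp only [Set.indicator_apply, SetLike.mem_coe, this, Pi.one_apply]

variable [Fintype G]

/-- `φ` is periodic modulo `l • G`, has positive mean, and the `ℓ¹` norm of its Fourier
coefficients is at most `C` times its mean. -/
def IsSieveWeight (φ : G → ℂ) (l : R) (C : ℝ) : Prop :=
  (∀ x y, φ (x + l • y) = φ x) ∧
    ∃ m : ℝ, 0 < m ∧ meanValue G φ = m ∧ FourierBound φ (C * m)

namespace IsSieveWeight

theorem one : IsSieveWeight (1 : G → ℂ) (1 : R) 1 := by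
  classical
  refine ⟨fun _ _ => rfl, 1, one_pos, ?_, ?_⟩
  · have := meanValue_addChar (1 : AddChar G ℂ)
    rw [if_pos rfl] at this
    rw [Complex.ofReal_one, ← this]
    rfl
  · rw [mul_one]
    exact FourierBound.of_addChar 1

theorem mono {φ : G → ℂ} {l : R} {C C' : ℝ} (h : IsSieveWeight φ l C) (hC : C ≤ C') :
    IsSieveWeight φ l C' := by
  obtain ⟨h1, m, h2, h3, h4⟩ := h
  exact ⟨h1, m, h2, h3, h4.mono (by gcongr)⟩

theorem indicator (c : R) :
    IsSieveWeight ((smulRange G c : Set G).indicator 1) c (smulRange G c).index := by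
  have hi : (0 : ℝ) < (smulRange G c).index := by
    exact_mod_cast Nat.pos_of_ne_zero (smulRange G c).index_ne_zero_of_finite
  refine ⟨indicator_smulRange_add_smul dvd_rfl, _, inv_pos.2 hi, meanValue_indicator _, ?_⟩
  rw [mul_inv_cancel₀ hi.ne']
  exact FourierBound.indicator _

theorem indicator_sub_indicator {c l : R} (h : c ∣ l)
    (hlt : (smulRange G c).index < (smulRange G l).index) :
    IsSieveWeight ((smulRange G c : Set G).indicator 1 - (smulRange G l : Set G).indicator 1) l
      (2 * (smulRange G c).index) := by
  have hi : (0 : ℝ) < (smulRange G c).index := by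
    exact_mod_cast Nat.pos_of_ne_zero (smulRange G c).index_ne_zero_of_finite
  have hlt' : ((smulRange G c).index : ℝ) < (smulRange G l).index := by exact_mod_cast hlt
  have hj := hi.trans hlt'
  refine ⟨fun x y => ?_, ((smulRange G c).index : ℝ)⁻¹ - ((smulRange G l).index : ℝ)⁻¹,
    sub_pos.2 (inv_strictAnti₀ hi hlt'), ?_, ?_⟩
  · rw [Pi.sub_apply, Pi.sub_apply, indicator_smulRange_add_smul h,
      indicator_smulRange_add_smul dvd_rfl]
  · rw [map_sub, meanValue_indicator, meanValue_indicator, Complex.ofReal_sub]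
  · refine (FourierBound.indicator_sub_indicator (smulRange_le_of_dvd h)).mono (le_of_eq ?_)
    field_simp

theorem meanValue_mul {φ φ' : G → ℂ} {l l' : R} (hl : IsCoprime l l')
    (h : ∀ x y, φ (x + l • y) = φ x) (h' : ∀ x y, φ' (x + l' • y) = φ' x) :
    meanValue G (φ * φ') = meanValue G φ * meanValue G φ' := by
  have hc : (Fintype.card G : ℂ) ≠ 0 := by exact_mod_cast Fintype.card_ne_zero
  obtain ⟨a, b, hab⟩ := hl
  have h1 : ∀ x z, φ' (x + l • a • z) = φ' (x + z) := by
    intro x z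
    rw [← h' (x + l • a • z) (b • z), add_assoc, smul_smul, smul_smul, ← add_smul,
      mul_comm l, mul_comm l', hab, one_smul]
  have h2 : ∀ z, ∑ x, φ x * φ' x = ∑ x, φ x * φ' (x + z) := by
    intro z
    rw [← Equiv.sum_comp (Equiv.addRight (l • a • z))]
    exact Finset.sum_congr rfl fun x _ => by rw [Equiv.coe_addRight, h, h1]
  have h3 : (Fintype.card G : ℂ) * ∑ x, φ x * φ' x = (∑ x, φ x) * ∑ x, φ' x := by
    rw [← nsmul_eq_mul, ← Finset.card_univ, ← Finset.sum_const, Finset.sum_congr rfl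
      fun z _ => h2 z, Finset.sum_comm, Finset.sum_mul]
    refine Finset.sum_congr rfl fun x _ => ?_
    rw [← Finset.mul_sum]
    congr 1
    exact Equiv.sum_comp (Equiv.addLeft x) φ'
  rw [meanValue_apply, meanValue_apply, meanValue_apply]
  simp only [Pi.mul_apply]
  field_simp
  exact h3

theorem mul {φ φ' : G → ℂ} {l l' : R} {C C' : ℝ} (hl : IsCoprime l l')
    (h : IsSieveWeight φ l C) (h' : IsSieveWeight φ' l' C') :
    IsSieveWeight (φ * φ') (l * l') (C * C') := by
  obtain ⟨h1, m, h2, h3, h4⟩ := h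
  obtain ⟨h1', m', h2', h3', h4'⟩ := h'
  refine ⟨fun x y => ?_, m * m', by positivity, ?_, (h4.mul h4').mono (le_of_eq (by ring))⟩
  · rw [Pi.mul_apply, Pi.mul_apply, mul_smul, h1, smul_comm, h1']
  · rw [meanValue_mul hl h1 h1', h3, h3', Complex.ofReal_mul]

theorem prod {ι : Type*} {s : Finset ι} {φ : ι → G → ℂ} {l : ι → R} {C : ι → ℝ}
    (hl : (s : Set ι).Pairwise fun i j => IsCoprime (l i) (l j))
    (h : ∀ i ∈ s, IsSieveWeight (φ i) (l i) (C i)) :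
    IsSieveWeight (∏ i ∈ s, φ i) (∏ i ∈ s, l i) (∏ i ∈ s, C i) := by
  classical
  induction s using Finset.induction_on with
  | empty => simpa using one
  | insert i s hi ih =>
    rw [Finset.prod_insert hi, Finset.prod_insert hi, Finset.prod_insert hi]
    refine mul (IsCoprime.prod_right fun j hj => ?_)
      (h i (Finset.mem_insert_self i s))
      (ih (hl.mono (by simp)) fun j hj => h j (Finset.mem_insert_of_mem hj))
    exact hl (by simp) (by simp [hj]) (by rintro rfl; exact hi hj)

end IsSieveWeight

end Module

/-- `M` annihilates the finite module `G`, and for divisors `m` of `M` the kernel of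
multiplication by `m` has at most `ν m` elements, where `ν m * ν m' = |G|` whenever
`m * m' = M`. -/
structure HasKernelBound {R : Type*} (G : Type*) [CommRing R] [AddCommGroup G] [Module R G]
    [Fintype G] (M : R) (ν : R → ℕ) : Prop where
  smul_eq_zero : ∀ x : G, M • x = 0
  mul_eq_card : ∀ m m', m * m' = M → ν m * ν m' = Fintype.card G
  card_ker_le : ∀ m, m ∣ M → Nat.card (DistribSMul.toAddMonoidHom G m).ker ≤ ν m

namespace HasKernelBound

variable {R G : Type*} [CommRing R] [AddCommGroup G] [Module R G] [Fintype G] {M : R} {ν : R → ℕ}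

theorem card_smulRange_mul (m : R) :
    Nat.card (smulRange G m) * Nat.card (DistribSMul.toAddMonoidHom G m).ker =
      Fintype.card G := by
  rw [← Nat.card_eq_fintype_card, mul_comm, smulRange, ← AddSubgroup.index_ker,
    AddSubgroup.card_mul_index]

theorem smulRange_le_ker (hK : HasKernelBound G M ν) {m m' : R} (h : m * m' = M) :
    smulRange G m ≤ (DistribSMul.toAddMonoidHom G m').ker := by
  rintro _ ⟨y, rfl⟩
  change m' • m • y = 0
  rw [smul_smul, mul_comm, h, hK.smul_eq_zero]

theorem card_smulRange_and_ker (hK : HasKernelBound G M ν) {m m' : R} (h : m * m' = M) :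
    Nat.card (smulRange G m) = ν m' ∧
      Nat.card (DistribSMul.toAddMonoidHom G m').ker ≤ Nat.card (smulRange G m) := by
  have h1 := card_smulRange_mul (G := G) m
  have h2 := AddSubgroup.card_le_of_le (hK.smulRange_le_ker h)
  have h3 := hK.card_ker_le m' ⟨m, by rw [mul_comm, h]⟩
  have h4 := hK.card_ker_le m ⟨m', h.symm⟩
  have h5 := hK.mul_eq_card m m' h
  have h6 : 0 < Fintype.card G := Fintype.card_pos
  have h7 : 0 < ν m := Nat.pos_of_ne_zero fun h0 => by rw [h0] at h5; omega
  have h8 : ν m' ≤ Nat.card (smulRange G m) := by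
    refine Nat.le_of_mul_le_mul_left ?_ h7
    rw [h5, ← h1, mul_comm]
    exact Nat.mul_le_mul_right _ h4
  omega

theorem index_smulRange (hK : HasKernelBound G M ν) {m : R} (h : m ∣ M) :
    (smulRange G m).index = ν m := by
  obtain ⟨m', rfl⟩ := h
  have h1 := (smulRange G m).card_mul_index
  have h2 := hK.mul_eq_card m m' rfl
  rw [(hK.card_smulRange_and_ker rfl).1, Nat.card_eq_fintype_card, ← h2, mul_comm] at h1
  refine Nat.eq_of_mul_eq_mul_right (Nat.pos_of_ne_zero fun h0 => ?_) h1
  rw [h0, mul_zero] at h2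
  exact Fintype.card_ne_zero h2.symm

theorem mem_smulRange_of_smul_eq_zero (hK : HasKernelBound G M ν) {m m' : R} (h : m * m' = M)
    {x : G} (hx : m' • x = 0) : x ∈ smulRange G m := by
  rw [AddSubgroup.eq_of_le_of_card_ge (hK.smulRange_le_ker h) (hK.card_smulRange_and_ker h).2]
  exact hx

theorem exists_sieveWeight (hK : HasKernelBound G M ν) {ι : Type*} {s : Finset ι} {a : ι → R}
    (ha : (s : Set ι).Pairwise fun i j => IsCoprime (a i) (a j)) (b : ι → ℕ) (P : ι → Prop)
    [DecidablePred P] (hdvd : ∀ i ∈ s, a i ^ b i ∣ M)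
    (hP : ∀ i ∈ s, P i → a i ^ (b i + 1) ∣ M ∧ ν (a i ^ b i) < ν (a i ^ (b i + 1))) :
    ∃ (φ : G → ℂ) (l : R),
      IsSieveWeight φ l (∏ i ∈ s, ((ν (a i ^ b i) : ℝ) * if P i then 2 else 1)) ∧
      ∀ x, φ x ≠ 0 → ∀ i ∈ s, x ∈ smulRange G (a i ^ b i) ∧
        (P i → x ∉ smulRange G (a i ^ (b i + 1))) := by
  classical
  refine ⟨∏ i ∈ s, if P i then (smulRange G (a i ^ b i) : Set G).indicator 1 -
      (smulRange G (a i ^ (b i + 1)) : Set G).indicator 1 else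
      (smulRange G (a i ^ b i) : Set G).indicator 1,
    ∏ i ∈ s, if P i then a i ^ (b i + 1) else a i ^ b i,
    IsSieveWeight.prod (fun i hi j hj hij => ?_) (fun i hi => ?_), fun x hx i hi => ?_⟩
  · have : IsCoprime (a i) (a j) := ha hi hj hij
    dsimp only
    split_ifs <;> exact this.pow
  · rw [← hK.index_smulRange (hdvd i hi)]
    split_ifs with h
    · rw [mul_comm]
      refine IsSieveWeight.indicator_sub_indicator (pow_dvd_pow _ (Nat.le_succ _)) ?_
      rw [hK.index_smulRange (hdvd i hi), hK.index_smulRange (hP i hi h).1]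
      exact (hP i hi h).2
    · rw [mul_one]
      exact IsSieveWeight.indicator _
  · rw [Finset.prod_apply, Finset.prod_ne_zero_iff] at hx
    have hxi := hx i hi
    have hle : x ∈ smulRange G (a i ^ (b i + 1)) → x ∈ smulRange G (a i ^ b i) := fun h =>
      smulRange_le_of_dvd (pow_dvd_pow _ (Nat.le_succ _)) h
    split_ifs at hxi with h
    · rw [Pi.sub_apply] at hxi
      by_cases h1 : x ∈ smulRange G (a i ^ b i)
      · refine ⟨h1, fun _ h2 => hxi ?_⟩
        rw [Set.indicator_of_mem (SetLike.mem_coe.2 h1),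
          Set.indicator_of_mem (SetLike.mem_coe.2 h2), sub_self]
      · refine absurd ?_ hxi
        rw [Set.indicator_of_notMem (by exact h1),
          Set.indicator_of_notMem (by exact fun h2 => h1 (hle h2)), sub_zero]
    · refine ⟨by_contra fun h1 => hxi (Set.indicator_of_notMem (by exact h1) _), fun h1 => ?_⟩
      exact absurd h1 h

end HasKernelBound

theorem norm_sum_addChar_mul_comp_le {G : Type*} [AddCommGroup G] [Fintype G] (γ : G →+ G)
    {w : G → ℂ} {B : ℝ} (hB : ∀ ψ : AddChar G ℂ, ‖∑ x, ψ x * w x‖ ≤ B) (ψ : AddChar G ℂ) :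
    ‖∑ x, ψ x * w (γ x)‖ ≤ Nat.card γ.ker * B := by
  classical
  have hB0 : 0 ≤ B := (norm_nonneg _).trans (hB 1)
  have hc : (Fintype.card G : ℂ) ≠ 0 := by exact_mod_cast Fintype.card_ne_zero
  set s : Finset (AddChar G ℂ) := Finset.univ.filter fun θ => ψ * θ.compAddMonoidHom γ = 1
  have hinv : ∀ y, (Fintype.card G : ℂ) * w y =
      ∑ θ : AddChar G ℂ, θ y * ∑ x, θ⁻¹ x * w x := by
    intro y
    simp only [Finset.mul_sum]
    rw [Finset.sum_comm]
    have : ∀ x, ∑ θ : AddChar G ℂ, θ y * (θ⁻¹ x * w x) =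
        if x = y then (Fintype.card G : ℂ) * w y else 0 := by
      intro x
      have h := AddChar.sum_apply_eq_ite (y - x)
      simp only [sub_eq_zero, AddChar.map_sub_eq_div, eq_comm (a := y)] at h
      rw [show (if x = y then (Fintype.card G : ℂ) * w y else 0) =
        (if x = y then (Fintype.card G : ℂ) else 0) * w x by split_ifs with hxy <;> simp [hxy],
        ← h, Finset.sum_mul]
      refine Finset.sum_congr rfl fun θ _ => ?_
      rw [AddChar.inv_apply', div_eq_mul_inv, mul_assoc]
    rw [Finset.sum_congr rfl fun x _ => this x, Finset.sum_ite_eq' , if_pos (Finset.mem_univ _)]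
  have hsum : ∑ x, ψ x * w (γ x) = ∑ θ ∈ s, ∑ x, θ⁻¹ x * w x := by
    refine mul_left_cancel₀ hc ?_
    rw [Finset.mul_sum]
    calc ∑ x, (Fintype.card G : ℂ) * (ψ x * w (γ x))
        = ∑ x, ∑ θ : AddChar G ℂ, (ψ * θ.compAddMonoidHom γ) x * ∑ y, θ⁻¹ y * w y := by
          refine Finset.sum_congr rfl fun x _ => ?_
          rw [mul_left_comm, hinv, Finset.mul_sum]
          refine Finset.sum_congr rfl fun θ _ => ?_
          rw [AddChar.mul_apply, AddChar.compAddMonoidHom_apply, mul_assoc]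
      _ = ∑ θ : AddChar G ℂ, (if ψ * θ.compAddMonoidHom γ = 1 then (Fintype.card G : ℂ) else 0) *
            ∑ y, θ⁻¹ y * w y := by
          rw [Finset.sum_comm]
          refine Finset.sum_congr rfl fun θ _ => ?_
          rw [← Finset.sum_mul, AddChar.sum_eq_ite]
          rfl
      _ = _ := by
          simp only [ite_mul, zero_mul]
          rw [← Finset.sum_filter, Finset.mul_sum]
  have hcard : s.card ≤ Nat.card γ.ker := by
    have hk : γ.range.annihilator.card = Nat.card γ.ker := by
      rw [AddSubgroup.card_annihilator]
      have h1 := γ.range.card_mul_index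
      have h2 := γ.ker.card_mul_index
      rw [AddSubgroup.index_ker, ← h1, mul_comm] at h2
      exact (Nat.eq_of_mul_eq_mul_left Nat.card_pos h2).symm
    rw [← hk]
    obtain hs | ⟨θ₀, hθ₀⟩ := s.eq_empty_or_nonempty
    · rw [hs]; exact Nat.zero_le _
    refine Finset.card_le_card_of_injOn (fun θ => θ * θ₀⁻¹) (fun θ hθ => ?_)
      (fun θ _ θ' _ h => mul_right_cancel h)
    have h1 : ψ * θ.compAddMonoidHom γ = 1 := (Finset.mem_filter.1 hθ).2
    have h2 : ψ * θ₀.compAddMonoidHom γ = 1 := (Finset.mem_filter.1 hθ₀).2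
    have h3 := mul_left_cancel (h1.trans h2.symm)
    refine AddSubgroup.mem_annihilator.2 ?_
    rintro _ ⟨x, rfl⟩
    have h4 : θ (γ x) = θ₀ (γ x) := DFunLike.congr_fun h3 x
    have h5 : θ₀ (γ x) ≠ 0 := (θ₀.val_isUnit (γ x)).ne_zero
    rw [AddChar.mul_apply, AddChar.inv_apply', h4, mul_inv_cancel₀ h5]
  rw [hsum]
  refine (norm_sum_le_of_le _ fun θ _ => hB θ⁻¹).trans ?_
  rw [Finset.sum_const, nsmul_eq_mul]
  gcongr

/-- The multiplicative character of `F` attached to a character of `Fˣ`. -/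
def AddChar.toMulChar {F : Type*} [Field F] (χ : AddChar (Additive Fˣ) ℂ) : MulChar F ℂ :=
  MulChar.ofUnitHom (MonoidHom.toHomUnits
    { toFun := fun u => χ (Additive.ofMul u)
      map_one' := χ.map_zero_eq_one
      map_mul' := fun _ _ => χ.map_add_eq_mul _ _ })

theorem AddChar.toMulChar_coe {F : Type*} [Field F] (χ : AddChar (Additive Fˣ) ℂ) (u : Fˣ) :
    χ.toMulChar (u : F) = χ (Additive.ofMul u) := by
  rw [toMulChar, MulChar.ofUnitHom_coe]
  rfl

theorem AddChar.toMulChar_eq_one_iff {F : Type*} [Field F] {χ : AddChar (Additive Fˣ) ℂ} :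
    χ.toMulChar = 1 ↔ χ = 1 := by
  constructor
  · intro h
    ext u
    have := χ.toMulChar_coe u.toMul
    rw [h, MulChar.one_apply_coe] at this
    exact this.symm
  · rintro rfl
    ext u
    rw [AddChar.toMulChar_coe, MulChar.one_apply_coe]
    rfl

/-- Evaluation at `x` of the extension by zero of a function on `Fˣ`. -/
def evalUnits {F : Type*} [Field F] [DecidableEq F] (x : F) : (Additive Fˣ → ℂ) →ₗ[ℂ] ℂ :=
  if h : x = 0 then 0 else LinearMap.proj (Additive.ofMul (Units.mk0 x h))

theorem evalUnits_addChar {F : Type*} [Field F] [DecidableEq F] (x : F)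
    (χ : AddChar (Additive Fˣ) ℂ) : evalUnits x χ = χ.toMulChar x := by
  rw [evalUnits]
  split_ifs with h
  · rw [h, MulChar.map_zero, LinearMap.zero_apply]
  · rw [LinearMap.proj_apply, ← AddChar.toMulChar_coe, Units.val_mk0]

theorem norm_weighted_sum_sub_le_of_chars {F : Type*} [Field F] [Fintype F] [DecidableEq F]
    (γ : F →+ F) (ψ₁ ψ₃ : AddChar F ℂ) (χ : AddChar (Additive Fˣ) ℂ) :
    ‖∑ x, ψ₁ x * (evalUnits (γ x) χ * ψ₃ (γ x)⁻¹) -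
      Fintype.card F * (meanValue F ψ₁ * (meanValue (Additive Fˣ) χ * meanValue F ψ₃))‖ ≤
      Nat.card γ.ker * (2 * √(Fintype.card F)) := by
  classical
  have hc : (Fintype.card F : ℂ) ≠ 0 := by exact_mod_cast Fintype.card_ne_zero
  set δ : ℂ := meanValue (Additive Fˣ) χ * meanValue F ψ₃ with hδ
  rw [meanValue_addChar, meanValue_addChar] at hδ
  have key : ∀ ψ : AddChar F ℂ, ‖∑ x, ψ x * (evalUnits x χ * ψ₃ x⁻¹ - δ)‖ ≤
      2 * √(Fintype.card F) := by
    intro ψ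
    by_cases h : χ = 1 ∧ ψ₃ = 1
    · obtain ⟨rfl, rfl⟩ := h
      rw [if_pos rfl, if_pos rfl, one_mul] at hδ
      have : ∀ x, ψ x * (evalUnits x (1 : AddChar (Additive Fˣ) ℂ) *
          (1 : AddChar F ℂ) x⁻¹ - δ) = if x = 0 then -1 else 0 := by
        intro x
        rw [hδ, evalUnits]
        split_ifs with hx
        · simp [hx]
        · simp
      rw [Finset.sum_congr rfl fun x _ => this x, Finset.sum_ite_eq',
        if_pos (Finset.mem_univ _), norm_neg, norm_one]
      have : 1 ≤ √(Fintype.card F) :=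
        Real.one_le_sqrt.2 (by exact_mod_cast Fintype.card_pos)
      linarith
    · have hδ0 : δ = 0 := by
        rw [hδ]
        by_cases h1 : χ = 1
        · rw [if_neg (fun h2 => h ⟨h1, h2⟩), mul_zero]
        · rw [if_neg h1, zero_mul]
      have := norm_kloosterman_le_of_ne_one χ.toMulChar ψ ψ₃
        (by rw [AddChar.toMulChar_eq_one_iff]; tauto)
      simp only [hδ0, sub_zero, evalUnits_addChar]
      exact (congrArg norm (Finset.sum_congr rfl fun x _ => mul_left_comm _ _ _)).trans_le this
  have := norm_sum_addChar_mul_comp_le γ key ψ₁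
  simp only [mul_sub, Finset.sum_sub_distrib, ← Finset.sum_mul] at this
  convert this using 3
  rw [meanValue_apply]
  field_simp

theorem exists_ne_zero_of_fourierBound {F : Type*} [Field F] [Fintype F] [DecidableEq F]
    (γ : F →+ F)
    {φ₁ φ₃ : F → ℂ} {φ₂ : Additive Fˣ → ℂ} {m₁ m₂ m₃ C₁ C₂ C₃ : ℝ} (hm₁ : 0 < m₁)
    (hm₂ : 0 < m₂) (hm₃ : 0 < m₃) (hφ₁ : meanValue F φ₁ = m₁)
    (hφ₂ : meanValue (Additive Fˣ) φ₂ = m₂)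
    (hφ₃ : meanValue F φ₃ = m₃) (h₁ : FourierBound φ₁ (C₁ * m₁))
    (h₂ : FourierBound φ₂ (C₂ * m₂)) (h₃ : FourierBound φ₃ (C₃ * m₃))
    (h : C₁ * C₂ * C₃ * (Nat.card γ.ker * (2 * √(Fintype.card F))) < Fintype.card F) :
    ∃ (x : F) (u : Fˣ), γ x = u ∧ φ₁ x ≠ 0 ∧ φ₂ (Additive.ofMul u) ≠ 0 ∧ φ₃ (u⁻¹ : Fˣ) ≠ 0 := by
  by_contra! hcon
  set B := Nat.card γ.ker * (2 * √(Fintype.card F))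
  have b₃ : ∀ (ψ : AddChar F ℂ) (χ : AddChar (Additive Fˣ) ℂ),
      ‖∑ x, ψ x * (evalUnits (γ x) χ * φ₃ (γ x)⁻¹) -
        Fintype.card F * (meanValue F ψ * (meanValue (Additive Fˣ) χ * meanValue F φ₃))‖ ≤
        C₃ * m₃ * B := by
    intro ψ χ
    have := h₃ (∑ x, (ψ x * evalUnits (γ x) χ) • LinearMap.proj (γ x)⁻¹ -
      (Fintype.card F * (meanValue F ψ * meanValue (Additive Fˣ) χ)) • meanValue F) B
      fun ψ₃ => by
        convert norm_weighted_sum_sub_le_of_chars γ ψ ψ₃ χ using 2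
        simp [LinearMap.sum_apply, mul_assoc]
    convert this using 2
    simp [LinearMap.sum_apply, mul_assoc]
  have b₂ : ∀ ψ : AddChar F ℂ,
      ‖∑ x, ψ x * (evalUnits (γ x) φ₂ * φ₃ (γ x)⁻¹) -
        Fintype.card F * (meanValue F ψ * (meanValue (Additive Fˣ) φ₂ * meanValue F φ₃))‖ ≤
        C₂ * m₂ * (C₃ * m₃ * B) := by
    intro ψ
    have := h₂ (∑ x, (ψ x * φ₃ (γ x)⁻¹) • evalUnits (γ x) -
      (Fintype.card F * (meanValue F ψ * meanValue F φ₃)) • meanValue (Additive Fˣ)) (C₃ * m₃ * B)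
      fun χ => by
        convert b₃ ψ χ using 2
        simp [LinearMap.sum_apply, mul_assoc, mul_comm, mul_left_comm]
    convert this using 2
    simp [LinearMap.sum_apply, mul_assoc, mul_comm, mul_left_comm]
  have b₁ := h₁ (∑ x, (evalUnits (γ x) φ₂ * φ₃ (γ x)⁻¹) • LinearMap.proj x -
      (Fintype.card F * (meanValue (Additive Fˣ) φ₂ * meanValue F φ₃)) • meanValue F)
      (C₂ * m₂ * (C₃ * m₃ * B))
      fun ψ => by
        convert b₂ ψ using 2
        simp [LinearMap.sum_apply, mul_comm, mul_left_comm]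
  have hzero : ∀ x, (evalUnits (γ x) φ₂ * φ₃ (γ x)⁻¹) * φ₁ x = 0 := by
    intro x
    by_cases hx : γ x = 0
    · rw [evalUnits, dif_pos hx, LinearMap.zero_apply, zero_mul, zero_mul]
    · by_contra hne
      rw [evalUnits, dif_neg hx, LinearMap.proj_apply] at hne
      refine right_ne_zero_of_mul (left_ne_zero_of_mul hne) ?_
      have := hcon x (Units.mk0 _ hx) rfl (right_ne_zero_of_mul hne)
        (left_ne_zero_of_mul (left_ne_zero_of_mul hne))
      rwa [Units.val_inv_eq_inv_val, Units.val_mk0] at this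
  rw [LinearMap.sub_apply, LinearMap.sum_apply] at b₁
  simp only [LinearMap.smul_apply, LinearMap.proj_apply, smul_eq_mul, hzero, hφ₁, hφ₂, hφ₃,
    Finset.sum_const_zero, zero_sub, norm_neg, norm_mul, Complex.norm_natCast,
    Complex.norm_real, Real.norm_of_nonneg hm₁.le, Real.norm_of_nonneg hm₂.le,
    Real.norm_of_nonneg hm₃.le] at b₁
  have hm : 0 < m₁ * m₂ * m₃ := by positivity
  nlinarith

theorem hasKernelBound_units (F : Type*) [Field F] [Fintype F] :
    HasKernelBound (Additive Fˣ) ((Fintype.card F - 1 : ℕ) : ℤ) Int.natAbs := by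
  have hcard : Fintype.card (Additive Fˣ) = Fintype.card F - 1 := by
    rw [Fintype.card_additive, Fintype.card_units]
  refine ⟨fun x => ?_, fun m m' h => ?_, fun m hm => ?_⟩
  · rw [natCast_zsmul, ← hcard, card_nsmul_eq_zero]
  · rw [← Int.natAbs_mul, h, Int.natAbs_natCast, hcard]
  · have hm0 : m ≠ 0 := by
      rintro rfl
      rw [zero_dvd_iff, Nat.cast_eq_zero] at hm
      have := Fintype.one_lt_card (α := F)
      omega
    have : NeZero m.natAbs := ⟨Int.natAbs_ne_zero.2 hm0⟩
    refine le_trans ?_ (card_rootsOfUnity F m.natAbs)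
    refine Nat.card_le_card_of_injective
      (fun x => ⟨x.1.toMul, (mem_rootsOfUnity _ _).2 ?_⟩) fun x y h => ?_
    · obtain ⟨x, hx⟩ := x
      change m • x = 0 at hx
      rcases Int.natAbs_eq m with h | h
      · rw [h, natCast_zsmul] at hx
        exact hx
      · rw [h, neg_smul, neg_eq_zero, natCast_zsmul] at hx
        exact hx
    · exact Subtype.ext (Additive.toMul.injective (Subtype.mk.inj h))

theorem gcd_div_orderOf_eq_one {F : Type*} [Field F] [Fintype F] {d : ℕ} (u : Fˣ)
    (h : ∀ p ∈ d.primeFactors, Additive.ofMul u ∉ smulRange (Additive Fˣ) (p : ℤ)) (hd : d ≠ 0) :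
    Nat.gcd d ((Fintype.card F - 1) / orderOf (u : F)) = 1 := by
  refine Nat.Coprime.gcd_eq_one (Nat.coprime_of_dvd fun p hp hpd hpo => ?_)
  refine h p (Nat.mem_primeFactors.2 ⟨hp, hpd, hd⟩) ?_
  rw [orderOf_units] at hpo
  have hdvd : orderOf u ∣ Fintype.card F - 1 := by
    rw [← Fintype.card_units]
    exact orderOf_dvd_card
  refine smulRange_le_of_dvd (Int.natCast_dvd_natCast.2 hpo) ?_
  refine (hasKernelBound_units F).mem_smulRange_of_smul_eq_zero (m' := (orderOf u : ℤ)) ?_ ?_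
  · rw [← Nat.cast_mul, Nat.div_mul_cancel hdvd]
  · rw [natCast_zsmul]
    exact pow_orderOf_eq_one u

section FrobeniusModule

variable (Fq F : Type*) [Field Fq] [Field F] [Fintype Fq] [Algebra Fq F]

/-- The `Fq[X]`-module structure on `F` for which `X` acts as the `q`-power Frobenius map. -/
abbrev frobeniusModule : Module Fq[X] F :=
  Module.compHom F (aeval (R := Fq) (FiniteField.frobeniusAlgHom Fq F).toLinearMap).toRingHom

attribute [local instance] frobeniusModule

variable {Fq F}

theorem frobeniusAlgHom_toLinearMap_pow_apply (i : ℕ) (β : F) :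
    ((FiniteField.frobeniusAlgHom Fq F).toLinearMap ^ i) β = β ^ Fintype.card Fq ^ i := by
  induction i with
  | zero => simp
  | succ i ih =>
    rw [pow_succ', Module.End.mul_apply, ih, pow_succ, pow_mul]
    rfl

theorem X_pow_smul_frobenius (i : ℕ) (β : F) :
    (X ^ i : Fq[X]) • β = β ^ Fintype.card Fq ^ i := by
  change aeval (R := Fq) (FiniteField.frobeniusAlgHom Fq F).toLinearMap (X ^ i) β = _
  rw [map_pow, aeval_X, frobeniusAlgHom_toLinearMap_pow_apply]

theorem polyAct_eq_smul (f : Fq[X]) (β : F) : polyAct (Fintype.card Fq) f β = f • β := by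
  change _ = aeval (R := Fq) (FiniteField.frobeniusAlgHom Fq F).toLinearMap f β
  rw [polyAct, aeval_def, eval₂_eq_sum, Polynomial.sum, Polynomial.sum, LinearMap.sum_apply]
  refine Finset.sum_congr rfl fun i _ => ?_
  rw [Module.End.mul_apply, frobeniusAlgHom_toLinearMap_pow_apply, Module.algebraMap_end_apply,
    Algebra.smul_def]

theorem card_smul_ker_le [Finite F] {f : Fq[X]} (hf : f ≠ 0) :
    Nat.card (DistribSMul.toAddMonoidHom F f).ker ≤ Fintype.card Fq ^ f.natDegree := by
  set q := Fintype.card Fq with hq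
  have hq1 : 1 < q := Fintype.one_lt_card
  set P : F[X] := f.sum fun i a => C (algebraMap Fq F a) * X ^ q ^ i with hP
  have heval : ∀ β, P.eval β = f • β := by
    intro β
    rw [← polyAct_eq_smul, polyAct, hP, Polynomial.sum, Polynomial.sum, eval_finsetSum]
    simp [hq]
  have hcoeff : P.coeff (q ^ f.natDegree) ≠ 0 := by
    rw [hP, Polynomial.sum, finsetSum_coeff, Finset.sum_eq_single f.natDegree]
    · rw [coeff_C_mul, coeff_X_pow, if_pos rfl, mul_one]
      simpa using hf
    · intro i _ hi
      rw [coeff_C_mul, coeff_X_pow, if_neg (fun h => hi (Nat.pow_right_injective hq1 h).symm),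
        mul_zero]
    · intro h
      exact absurd (natDegree_mem_support_of_nonzero hf) h
  have hP0 : P ≠ 0 := fun h => hcoeff (by rw [h, coeff_zero])
  have hdeg : P.natDegree ≤ q ^ f.natDegree := by
    refine natDegree_sum_le_of_forall_le _ _ fun i hi => ?_
    refine (natDegree_C_mul_X_pow_le _ _).trans (Nat.pow_le_pow_right (by omega) ?_)
    exact le_natDegree_of_mem_supp i hi
  refine le_trans ?_ ((Multiset.toFinset_card_le _).trans ((card_roots' P).trans hdeg))
  rw [← Fintype.card_coe, ← Nat.card_eq_fintype_card]
  refine Nat.card_le_card_of_injective (fun x => ⟨x.1, ?_⟩) fun x y h => ?_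
  · rw [Multiset.mem_toFinset, mem_roots hP0, IsRoot.def, heval]
    exact x.2
  · exact Subtype.ext (Subtype.mk.inj h)

theorem hasKernelBound_frobenius [Fintype F] {n : ℕ} (hn : 0 < n)
    (hdim : Module.finrank Fq F = n) :
    HasKernelBound F (X ^ n - 1 : Fq[X]) fun f => Fintype.card Fq ^ f.natDegree := by
  have hM : (X ^ n - 1 : Fq[X]) ≠ 0 := (monic_X_pow_sub_C (1 : Fq) hn.ne').ne_zero
  have hcard : Fintype.card F = Fintype.card Fq ^ n := by
    rw [Module.card_eq_pow_finrank (K := Fq), hdim]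
  refine ⟨fun x => ?_, fun m m' h => ?_, fun m hm => card_smul_ker_le ?_⟩
  · rw [sub_smul, one_smul, X_pow_smul_frobenius, ← hcard, FiniteField.pow_card, sub_self]
  · have h1 : m ≠ 0 := by rintro rfl; exact hM (by rw [← h, zero_mul])
    have h2 : m' ≠ 0 := by rintro rfl; exact hM (by rw [← h, mul_zero])
    rw [← pow_add, ← natDegree_mul h1 h2, h, hcard]
    congr 1
    exact natDegree_X_pow_sub_C (r := (1 : Fq))
  · rintro rfl
    exact hM (zero_dvd_iff.1 hm)

theorem isPolyFree_of_forall_notMem [Fintype F] {n : ℕ} (hn : 0 < n)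
    (hdim : Module.finrank Fq F = n) {h : Fq[X]} (h0 : h ≠ 0) {β : F}
    (hβ : ∀ f ∈ (normalizedFactors h).toFinset, β ∉ smulRange F f) :
    IsPolyFree (Fintype.card Fq) n h β := by
  have hK := hasKernelBound_frobenius (F := F) hn hdim
  have hMm : (X ^ n - 1 : Fq[X]).Monic := monic_X_pow_sub_C (1 : Fq) hn.ne'
  obtain ⟨f, ⟨hf1, hf2, hf3⟩, hf4⟩ := exists_minimalFor_of_wellFoundedLT
    (fun f : Fq[X] => f.Monic ∧ f ∣ (X ^ n - 1 : Fq[X]) ∧ polyAct (Fintype.card Fq) f β = 0)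
    natDegree ⟨_, hMm, dvd_rfl, by rw [polyAct_eq_smul, hK.smul_eq_zero]⟩
  refine ⟨f, ⟨hf1, hf2, hf3, fun h' h1 h2 h3 => ?_⟩, ?_⟩
  · by_contra! hlt
    exact absurd (hf4 ⟨h1, h2, h3⟩ hlt.le) (by omega)
  · refine isCoprime_of_irreducible_dvd (fun h => h0 h.1) fun e he heh hef => ?_
    obtain ⟨e', he', hass⟩ := exists_mem_normalizedFactors_of_dvd h0 he heh
    refine hβ e' (Multiset.mem_toFinset.2 he') (smulRange_le_of_dvd (hass.symm.dvd.trans hef) ?_)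
    refine hK.mem_smulRange_of_smul_eq_zero (m' := f) ?_ (by rw [← polyAct_eq_smul, hf3])
    rw [mul_comm, EuclideanDomain.mul_div_cancel' hf1.ne_zero hf2]

end FrobeniusModule

theorem isCoprime_of_monic_irreducible_of_ne {K : Type*} [Field K] {P Q : K[X]} (hP : P.Monic)
    (hQ : Q.Monic) (hP' : Irreducible P) (hQ' : Irreducible Q) (h : P ≠ Q) : IsCoprime P Q :=
  hP'.coprime_iff_not_dvd.2 fun hdvd =>
    h (eq_of_monic_of_associated hP hQ (hP'.associated_of_dvd hQ' hdvd))

theorem pairwise_isCoprime_of_monic_irreducible {K : Type*} [Field K] {s : Finset K[X]}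
    (hs : ∀ P ∈ s, P.Monic ∧ Irreducible P) :
    (s : Set K[X]).Pairwise fun P Q => IsCoprime P Q := fun P hP Q hQ h =>
  isCoprime_of_monic_irreducible_of_ne (hs P hP).1 (hs Q hQ).1 (hs P hP).2 (hs Q hQ).2 h

theorem monic_irreducible_of_mem_normalizedFactors {K : Type*} [Field K] {f P : K[X]}
    (h : P ∈ (normalizedFactors f).toFinset) : P.Monic ∧ Irreducible P := by
  rw [Multiset.mem_toFinset] at h
  exact ⟨monic_of_mem_normalizedFactors h, irreducible_of_normalized_factor P h⟩

theorem mem_of_dvd_prod_of_monic_irreducible {K : Type*} [Field K] {s : Finset K[X]} {P : K[X]}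
    (hP : P.Monic) (hP' : Irreducible P) (hs : ∀ Q ∈ s, Q.Monic ∧ Irreducible Q)
    (h : P ∣ s.prod id) : P ∈ s := by
  obtain ⟨Q, hQ, hdvd⟩ := (hP'.prime.dvd_finsetProd_iff _).1 h
  rwa [eq_of_monic_of_associated hP (hs Q hQ).1 (hP'.associated_of_dvd (hs Q hQ).2 hdvd)]

theorem finite_monic_divisors {K : Type*} [Field K] {f : K[X]} (hf : f ≠ 0) :
    {g : K[X] | g.Monic ∧ Squarefree g ∧ g ∣ f}.Finite := by
  refine ((normalizedFactors f).powerset.toFinset.image Multiset.prod).finite_toSet.subset ?_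
  rintro g ⟨hg, -, hgf⟩
  rw [Finset.mem_coe, Finset.mem_image]
  refine ⟨normalizedFactors g, ?_, ?_⟩
  · rw [Multiset.mem_toFinset, Multiset.mem_powerset]
    exact (dvd_iff_normalizedFactors_le_normalizedFactors hg.ne_zero hf).1 hgf
  · rw [prod_normalizedFactors_eq hg.ne_zero, hg.normalize_eq_self]

theorem two_pow_card_le_Wpoly {K : Type*} [Field K] {f : K[X]} (hf : f ≠ 0) :
    2 ^ (normalizedFactors f).toFinset.card ≤ Wpoly f := by
  set s := (normalizedFactors f).toFinset with hs
  have hmi : ∀ P ∈ s, P.Monic ∧ Irreducible P := fun P hP =>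
    monic_irreducible_of_mem_normalizedFactors hP
  rw [← Finset.card_powerset, Wpoly, ← Set.ncard_coe_finset]
  refine Set.ncard_le_ncard_of_injOn (fun t => t.prod id) (fun t ht => ?_) (fun t ht t' ht' h => ?_)
    (finite_monic_divisors hf)
  · have ht := Finset.mem_powerset.1 (Finset.mem_coe.1 ht)
    refine ⟨monic_prod_of_monic _ _ fun P hP => (hmi P (ht hP)).1, ?_, ?_⟩
    · refine Finset.squarefree_prod_of_pairwise_isCoprime (fun P hP Q hQ h => ?_) fun P hP =>
        (hmi P (ht hP)).2.squarefree
      exact (pairwise_isCoprime_of_monic_irreducible hmi (ht hP) (ht hQ) h).isRelPrime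
    · refine Finset.prod_dvd_of_coprime (fun P hP Q hQ h => ?_) fun P hP => ?_
      · exact pairwise_isCoprime_of_monic_irreducible hmi (ht hP) (ht hQ) h
      · exact dvd_of_mem_normalizedFactors (Multiset.mem_toFinset.1 (ht hP))
  · have ht := Finset.mem_powerset.1 (Finset.mem_coe.1 ht)
    have ht' := Finset.mem_powerset.1 (Finset.mem_coe.1 ht')
    have key : ∀ u v : Finset K[X], u ⊆ s → v ⊆ s → u.prod id = v.prod id → u ⊆ v := by
      intro u v hu hv huv P hP
      refine mem_of_dvd_prod_of_monic_irreducible (hmi P (hu hP)).1 (hmi P (hu hP)).2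
        (fun Q hQ => hmi Q (hv hQ)) ?_
      rw [← huv]
      exact Finset.dvd_prod_of_mem id hP
    exact (key _ _ ht ht' h).antisymm (key _ _ ht' ht h.symm)

theorem two_pow_card_primeFactors_eq_Wnat {d : ℕ} (hd : d ≠ 0) :
    2 ^ d.primeFactors.card = Wnat d := by
  have h := congrArg Multiset.card (Nat.divisors_filter_squarefree hd)
  rw [Multiset.card_map, Finset.card_val, Finset.card_val, Finset.card_powerset,
    Nat.factors_eq] at h
  rw [Wnat]
  convert h.symm using 2
  rfl

theorem mem_primeFactors_of_dvd_radN_div {r M d : ℕ} (hM : M ≠ 0) (hr : r ∣ M)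
    (hd : d ∣ radN M / radN r) :
    d ≠ 0 ∧ ∀ p ∈ d.primeFactors, p ∣ M ∧ p ∉ r.primeFactors := by
  have h1 : radN M / radN r = ∏ p ∈ M.primeFactors \ r.primeFactors, p := by
    rw [radN, radN, ← Finset.prod_sdiff (Nat.primeFactors_mono hr hM)]
    exact Nat.mul_div_cancel _ (Finset.prod_pos fun p hp => Nat.pos_of_mem_primeFactors hp)
  rw [h1] at hd
  refine ⟨?_, fun p hp => ?_⟩
  · rintro rfl
    refine Finset.prod_ne_zero_iff.2 (fun p hp => ?_) (zero_dvd_iff.1 hd)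
    exact (Nat.pos_of_mem_primeFactors (Finset.mem_sdiff.1 hp).1).ne'
  · have hpp := Nat.prime_of_mem_primeFactors hp
    obtain ⟨p', hp', hdvd⟩ := (hpp.prime.dvd_finsetProd_iff _).1
      ((Nat.dvd_of_mem_primeFactors hp).trans hd)
    rw [Finset.mem_sdiff] at hp'
    rw [(Nat.prime_dvd_prime_iff_eq hpp (Nat.prime_of_mem_primeFactors hp'.1)).1 hdvd]
    exact ⟨Nat.dvd_of_mem_primeFactors hp'.1, hp'.2⟩

theorem mem_normalizedFactors_of_dvd_radPoly_div {K : Type*} [Field K] {g M H : K[X]}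
    (hM : M ≠ 0) (hg : g ∣ M) (hH : H ∣ radPoly M / radPoly g) {f : K[X]}
    (hf : f ∈ (normalizedFactors H).toFinset) :
    f ∣ M ∧ f ∉ (normalizedFactors g).toFinset := by
  have hsub : (normalizedFactors g).toFinset ⊆ (normalizedFactors M).toFinset :=
    Multiset.toFinset_subset.2 (Multiset.subset_of_le
      ((dvd_iff_normalizedFactors_le_normalizedFactors (ne_zero_of_dvd_ne_zero hM hg) hM).1 hg))
  have h1 : radPoly M / radPoly g =
      ((normalizedFactors M).toFinset \ (normalizedFactors g).toFinset).prod id := by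
    rw [radPoly, radPoly, ← Finset.prod_sdiff hsub]
    refine mul_div_cancel_right₀ _ (Finset.prod_ne_zero_iff.2 fun P hP => ?_)
    exact (monic_irreducible_of_mem_normalizedFactors hP).1.ne_zero
  obtain ⟨hfm, hfi⟩ := monic_irreducible_of_mem_normalizedFactors hf
  rw [h1] at hH
  have := mem_of_dvd_prod_of_monic_irreducible hfm hfi
    (fun Q hQ => monic_irreducible_of_mem_normalizedFactors (Finset.mem_sdiff.1 hQ).1)
    ((dvd_of_mem_normalizedFactors (Multiset.mem_toFinset.1 hf)).trans hH)
  rw [Finset.mem_sdiff, Multiset.mem_toFinset] at this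
  exact ⟨dvd_of_mem_normalizedFactors this.1, this.2⟩

theorem exists_sieveWeight_QSet {F : Type*} [Field F] [Fintype F] {q n r d : ℕ}
    (hcard : Fintype.card F = q ^ n) (hr : r ∣ q ^ n - 1)
    (hd : d ∣ radN (q ^ n - 1) / radN r) :
    ∃ (φ : Additive Fˣ → ℂ) (l : ℤ), IsSieveWeight φ l (r * radN r * Wnat d) ∧
      ∀ u : Fˣ, φ (Additive.ofMul u) ≠ 0 → (u : F) ∈ QSet F q n r d := by
  have hM : q ^ n - 1 ≠ 0 := by
    have := Fintype.one_lt_card (α := F)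
    omega
  have hr0 : r ≠ 0 := ne_zero_of_dvd_ne_zero hM hr
  obtain ⟨hd0, hdp⟩ := mem_primeFactors_of_dvd_radN_div hM hr hd
  have hK := hasKernelBound_units F
  rw [hcard] at hK
  have hdisj : Disjoint r.primeFactors d.primeFactors :=
    Finset.disjoint_right.2 fun p hp => (hdp p hp).2
  have hprime : ∀ p ∈ r.primeFactors ∪ d.primeFactors, p.Prime := fun p hp =>
    (Finset.mem_union.1 hp).elim Nat.prime_of_mem_primeFactors Nat.prime_of_mem_primeFactors
  have hzero : ∀ p, p ∉ r.primeFactors → r.factorization p = 0 := fun p hp =>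
    Finsupp.notMem_support_iff.1 (by rwa [Nat.support_factorization])
  obtain ⟨φ, l, hφ, hφ'⟩ := hK.exists_sieveWeight (s := r.primeFactors ∪ d.primeFactors)
    (a := fun p : ℕ => (p : ℤ))
    (fun p hp p' hp' h => Nat.isCoprime_iff_coprime.2
      ((Nat.coprime_primes (hprime p hp) (hprime p' hp')).2 h))
    r.factorization (fun p => p ∈ rBadPrimes r (q ^ n - 1) ∨ p ∉ r.primeFactors)
    (fun p hp => by
      rw [← Nat.cast_pow, Int.natCast_dvd_natCast]
      exact (Nat.ordProj_dvd r p).trans hr)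
    (fun p hp hP => by
      rw [← Nat.cast_pow, ← Nat.cast_pow, Int.natCast_dvd_natCast, Int.natAbs_natCast,
        Int.natAbs_natCast]
      refine ⟨?_, Nat.pow_lt_pow_right (hprime p hp).one_lt (Nat.lt_succ_self _)⟩
      rcases hP with hP | hP
      · exact (Finset.mem_filter.1 hP).2
      · rw [hzero p hP, zero_add, pow_one]
        exact (hdp p ((Finset.mem_union.1 hp).resolve_left hP)).1)
  refine ⟨φ, l, hφ.mono ?_, fun u hu => ⟨u.ne_zero, ?_, ?_, fun p hp β hβ => ?_⟩⟩
  · rw [Finset.prod_union hdisj]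
    have h1 : ∏ p ∈ r.primeFactors, ((((p : ℤ) ^ r.factorization p).natAbs : ℝ) *
        if p ∈ rBadPrimes r (q ^ n - 1) ∨ p ∉ r.primeFactors then 2 else 1) ≤ r * radN r := by
      calc _ ≤ ∏ p ∈ r.primeFactors, ((p ^ r.factorization p : ℕ) : ℝ) * (p : ℝ) := by
            refine Finset.prod_le_prod (fun p _ => by positivity) fun p hp => ?_
            rw [← Nat.cast_pow, Int.natAbs_natCast]
            have : (2 : ℝ) ≤ p := by exact_mod_cast (Nat.prime_of_mem_primeFactors hp).two_le
            gcongr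
            split_ifs <;> linarith
        _ = r * radN r := by
            rw [Finset.prod_mul_distrib, ← Nat.cast_prod, ← Nat.cast_prod, radN]
            congr 2
            exact Nat.prod_factorization_pow_eq_self hr0
    have h2 : ∏ p ∈ d.primeFactors, ((((p : ℤ) ^ r.factorization p).natAbs : ℝ) *
        if p ∈ rBadPrimes r (q ^ n - 1) ∨ p ∉ r.primeFactors then 2 else 1) = Wnat d := by
      rw [← two_pow_card_primeFactors_eq_Wnat hd0, Nat.cast_pow, ← Finset.prod_const]
      refine Finset.prod_congr rfl fun p hp => ?_
      rw [hzero p (hdp p hp).2, if_pos (Or.inr (hdp p hp).2)]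
      simp
    rw [h2]
    gcongr
  · rw [← hcard]
    refine gcd_div_orderOf_eq_one u (fun p hp => ?_) hd0
    have := (hφ' _ hu p (Finset.mem_union_right _ hp)).2 (Or.inr (hdp p hp).2)
    rwa [hzero p (hdp p hp).2, zero_add, pow_one] at this
  · have := mem_smulRange_prod (s := r.primeFactors)
      (a := fun p : ℕ => (p : ℤ) ^ r.factorization p)
      (fun p hp p' hp' h => (Nat.isCoprime_iff_coprime.2 ((Nat.coprime_primes
        (Nat.prime_of_mem_primeFactors hp) (Nat.prime_of_mem_primeFactors hp')).2 h)).pow)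
      (fun p hp => (hφ' _ hu p (Finset.mem_union_left _ hp)).1)
    obtain ⟨y, hy⟩ := mem_smulRange.1 this
    have hprod : ∏ p ∈ r.primeFactors, (p : ℤ) ^ r.factorization p = (r : ℤ) := by
      conv_rhs => rw [← Nat.prod_factorization_pow_eq_self hr0]
      rw [Finsupp.prod, Nat.support_factorization]
      push_cast
      rfl
    rw [hprod, natCast_zsmul] at hy
    exact ⟨(y.toMul : Fˣ), by rw [← Units.val_pow_eq_pow_val]; exact congrArg Units.val hy⟩
  · have hpr := (Finset.mem_filter.1 hp).1
    refine (hφ' _ hu p (Finset.mem_union_left _ hpr)).2 (Or.inl hp) ?_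
    have hβ0 : β ≠ 0 := by
      rintro rfl
      rw [zero_pow (pow_ne_zero _ (Nat.prime_of_mem_primeFactors hpr).ne_zero)] at hβ
      exact u.ne_zero hβ.symm
    refine mem_smulRange.2 ⟨Additive.ofMul (Units.mk0 β hβ0), ?_⟩
    rw [← Nat.cast_pow, natCast_zsmul, ← ofMul_pow]
    congr 1
    exact Units.ext (by simpa using hβ)

section FrobeniusModule

variable {Fq F : Type*} [Field Fq] [Field F] [Fintype Fq] [Fintype F] [Algebra Fq F]

attribute [local instance] frobeniusModule

theorem card_pow_natDegree_lt {f : Fq[X]} (hf : Irreducible f) (b : ℕ) :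
    Fintype.card Fq ^ (f ^ b).natDegree < Fintype.card Fq ^ (f ^ (b + 1)).natDegree := by
  refine Nat.pow_lt_pow_right Fintype.one_lt_card ?_
  rw [natDegree_pow, natDegree_pow]
  exact Nat.mul_lt_mul_of_pos_right (Nat.lt_succ_self b) hf.natDegree_pos

theorem exists_sieveWeight_isPolyFree {n : ℕ} (hn : 0 < n) (hdim : Module.finrank Fq F = n)
    {h : Fq[X]} (hh : h ∣ (X ^ n - 1 : Fq[X])) :
    ∃ (φ : F → ℂ) (l : Fq[X]), IsSieveWeight φ l (Wpoly h) ∧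
      ∀ x, φ x ≠ 0 → IsPolyFree (Fintype.card Fq) n h x := by
  have hM : (X ^ n - 1 : Fq[X]) ≠ 0 := (monic_X_pow_sub_C (1 : Fq) hn.ne').ne_zero
  have h0 : h ≠ 0 := ne_zero_of_dvd_ne_zero hM hh
  have hmi : ∀ P ∈ (normalizedFactors h).toFinset, P.Monic ∧ Irreducible P := fun P hP =>
    monic_irreducible_of_mem_normalizedFactors hP
  obtain ⟨φ, l, hφ, hφ'⟩ := (hasKernelBound_frobenius (F := F) hn hdim).exists_sieveWeight
    (a := id) (pairwise_isCoprime_of_monic_irreducible hmi) (fun _ => 0) (fun _ => True)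
    (fun f _ => by rw [pow_zero]; exact one_dvd _)
    (fun f hf _ => ⟨by
      rw [zero_add, pow_one]
      exact (dvd_of_mem_normalizedFactors (Multiset.mem_toFinset.1 hf)).trans hh,
      card_pow_natDegree_lt (hmi f hf).2 0⟩)
  refine ⟨φ, l, hφ.mono ?_, fun x hx => isPolyFree_of_forall_notMem hn hdim h0 fun f hf => ?_⟩
  · refine le_trans (le_of_eq ?_) (Nat.cast_le.2 (two_pow_card_le_Wpoly h0))
    simp
  · have := (hφ' x hx f hf).2 trivial
    rwa [zero_add, pow_one] at this

theorem exists_sieveWeight_TSet {n k : ℕ} (hn : 0 < n) (hdim : Module.finrank Fq F = n)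
    {g H : Fq[X]} (hgm : g.Monic) (hgd : g.natDegree = k) (hg : g ∣ (X ^ n - 1 : Fq[X]))
    (hHm : H.Monic) (hH : H ∣ radPoly (X ^ n - 1 : Fq[X]) / radPoly g) :
    ∃ (φ : F → ℂ) (l : Fq[X]), IsSieveWeight φ l (Fintype.card Fq ^ k *
        (if Nat.gcd (Fintype.card Fq) n = 1 then 1 else (Fintype.card Fq : ℝ) ^ k) * Wpoly H) ∧
      ∀ x, φ x ≠ 0 → x ∈ TSet F (Fintype.card Fq) n g H := by
  set q := Fintype.card Fq with hq
  have hM : (X ^ n - 1 : Fq[X]) ≠ 0 := (monic_X_pow_sub_C (1 : Fq) hn.ne').ne_zero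
  set sg := (normalizedFactors g).toFinset with hsg
  set sH := (normalizedFactors H).toFinset with hsH
  set b : Fq[X] → ℕ := fun f => (normalizedFactors g).count f with hb
  have hHf : ∀ f ∈ sH, f ∣ (X ^ n - 1 : Fq[X]) ∧ f ∉ sg := fun f hf =>
    mem_normalizedFactors_of_dvd_radPoly_div hM hg hH hf
  have hdisj : Disjoint sg sH := Finset.disjoint_right.2 fun f hf => (hHf f hf).2
  have hmi : ∀ P ∈ sg ∪ sH, P.Monic ∧ Irreducible P := fun P hP =>
    (Finset.mem_union.1 hP).elim monic_irreducible_of_mem_normalizedFactors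
      monic_irreducible_of_mem_normalizedFactors
  have hzero : ∀ f, f ∉ sg → b f = 0 := fun f hf =>
    Multiset.count_eq_zero_of_notMem fun h => hf (Multiset.mem_toFinset.2 h)
  have hpos : ∀ f ∈ sg, 0 < b f := fun f hf =>
    Multiset.count_pos.2 (Multiset.mem_toFinset.1 hf)
  have hpow : ∀ f ∈ sg ∪ sH, f ^ b f ∣ g := fun f hf =>
    (pow_dvd_iff_le_count_normalizedFactors hgm.ne_zero (hmi f hf).2 (hmi f hf).1 _).2 le_rfl
  obtain ⟨φ, l, hφ, hφ'⟩ := (hasKernelBound_frobenius (F := F) hn hdim).exists_sieveWeight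
    (a := id) (pairwise_isCoprime_of_monic_irreducible hmi) b
    (fun f => f ∈ gBadFactors g (X ^ n - 1 : Fq[X]) ∨ f ∉ sg)
    (fun f hf => (hpow f hf).trans hg)
    (fun f hf hP => ⟨by
      rcases hP with hP | hP
      · exact (Finset.mem_filter.1 hP).2
      · rw [hzero f hP, zero_add, pow_one]
        exact (hHf f ((Finset.mem_union.1 hf).resolve_left hP)).1,
      card_pow_natDegree_lt (hmi f hf).2 _⟩)
  refine ⟨φ, l, hφ.mono ?_, fun x hx => ⟨isPolyFree_of_forall_notMem hn hdim hHm.ne_zero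
    fun f hf => ?_, ?_, fun f hf β hβ => ?_⟩⟩
  · rw [Finset.prod_union hdisj]
    have h1 : ∏ f ∈ sg, (((q ^ (id f ^ b f).natDegree : ℕ) : ℝ) *
        if f ∈ gBadFactors g (X ^ n - 1 : Fq[X]) ∨ f ∉ sg then 2 else 1) ≤
        q ^ k * (if Nat.gcd q n = 1 then 1 else (q : ℝ) ^ k) := by
      calc _ ≤ ∏ f ∈ sg, ((q : ℝ) ^ (b f * f.natDegree) *
              if Nat.gcd q n = 1 then 1 else (q : ℝ) ^ (b f * f.natDegree)) := by
            refine Finset.prod_le_prod (fun f _ => by positivity) fun f hf => ?_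
            have hfi := (hmi f (Finset.mem_union_left _ hf)).2
            rw [id, natDegree_pow, Nat.cast_pow]
            gcongr
            split_ifs with hP hc hc
            · exfalso
              have hbad := (Finset.mem_filter.1 (hP.resolve_right (not_not.2 hf))).2
              have hsq : Squarefree (X ^ n - 1 : Fq[X]) := by
                refine (X_pow_sub_one_separable_iff.2 fun hn0 => ?_).squarefree
                obtain ⟨p, hp⟩ := CharP.exists Fq
                obtain ⟨e, hpp, he⟩ := FiniteField.card Fq p
                have hpn := (CharP.cast_eq_zero_iff Fq p n).1 hn0
                have hpq : p ∣ q := by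
                  rw [hq, he]
                  exact dvd_pow_self p e.ne_zero
                exact hpp.one_lt.ne' (Nat.dvd_one.1 (hc ▸ Nat.dvd_gcd hpq hpn))
              have h2 : f * f ∣ (X ^ n - 1 : Fq[X]) := by
                rw [← pow_two]
                exact (pow_dvd_pow f (Nat.succ_le_succ (hpos f hf))).trans hbad
              exact hfi.not_isUnit (hsq f h2)
            · have hq2 : (2 : ℝ) ≤ q := by exact_mod_cast Fintype.one_lt_card (α := Fq)
              exact hq2.trans (le_self_pow₀ (by linarith)
                (Nat.mul_pos (hpos f hf) hfi.natDegree_pos).ne')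
            · exact le_rfl
            · exact one_le_pow₀ (by exact_mod_cast Fintype.card_pos)
        _ = _ := by
            have hk : ∑ f ∈ sg, b f * f.natDegree = k := by
              rw [← hgd]
              exact (natDegree_eq_sum_count_mul hgm).symm
            rw [Finset.prod_mul_distrib, Finset.prod_pow_eq_pow_sum, hk]
            congr 1
            split_ifs
            · exact Finset.prod_const_one
            · rw [Finset.prod_pow_eq_pow_sum, hk]
    have h2 : ∏ f ∈ sH, (((q ^ (id f ^ b f).natDegree : ℕ) : ℝ) *
        if f ∈ gBadFactors g (X ^ n - 1 : Fq[X]) ∨ f ∉ sg then 2 else 1) ≤ Wpoly H := by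
      refine le_trans (le_of_eq ?_) (Nat.cast_le.2 (two_pow_card_le_Wpoly hHm.ne_zero))
      rw [Nat.cast_pow, ← Finset.prod_const]
      refine Finset.prod_congr rfl fun f hf => ?_
      rw [hzero f (hHf f hf).2, if_pos (Or.inr (hHf f hf).2)]
      simp
    exact mul_le_mul h1 h2 (Finset.prod_nonneg fun f _ => by positivity) (by positivity)
  · have := (hφ' x hx f (Finset.mem_union_right _ hf)).2 (Or.inr (hHf f hf).2)
    rwa [hzero f (hHf f hf).2, zero_add, pow_one] at this
  · have := mem_smulRange_prod (s := sg) (a := fun f => f ^ b f)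
      (fun f hf f' hf' h => (pairwise_isCoprime_of_monic_irreducible hmi
        (Finset.mem_union_left _ hf) (Finset.mem_union_left _ hf') h).pow)
      (fun f hf => (hφ' x hx f (Finset.mem_union_left _ hf)).1)
    have hprod : ∏ f ∈ sg, f ^ b f = g := by
      conv_rhs => rw [← hgm.normalize_eq_self, ← prod_normalizedFactors_eq hgm.ne_zero]
      exact (Finset.prod_multiset_count _).symm
    rw [hprod] at this
    obtain ⟨y, hy⟩ := mem_smulRange.1 this
    exact ⟨y, by rw [polyAct_eq_smul, hy]⟩
  · have hfg := (Finset.mem_filter.1 hf).1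
    refine (hφ' x hx f (Finset.mem_union_left _ hfg)).2 (Or.inl hf) (mem_smulRange.2 ⟨β, ?_⟩)
    rw [← hβ, polyAct_eq_smul]
    rfl

end FrobeniusModule

theorem lt_card_of_rpow_gt {q n k : ℕ} (hq : 0 < q) {P : Prop} [Decidable P] {C κ : ℝ}
    (hC : 0 ≤ C) (hκ : κ ≤ q ^ k)
    (h : 2 * C < (q : ℝ) ^ ((n : ℝ) / 2 - (if P then 2 * k else 3 * k : ℕ))) :
    C * ((q : ℝ) ^ k * if P then 1 else (q : ℝ) ^ k) * (κ * (2 * √((q : ℝ) ^ n))) <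
      (q : ℝ) ^ n := by
  have hq0 : (0 : ℝ) < q := by exact_mod_cast hq
  have hs : (q : ℝ) ^ ((n : ℝ) / 2) = √((q : ℝ) ^ n) := by
    rw [Real.sqrt_eq_rpow, ← Real.rpow_natCast, ← Real.rpow_mul hq0.le]
    congr 1
    ring
  rw [Real.rpow_sub hq0, hs, Real.rpow_natCast, lt_div_iff₀ (by positivity)] at h
  have hs0 : 0 < √((q : ℝ) ^ n) := by positivity
  have he : (q : ℝ) ^ k * (if P then 1 else (q : ℝ) ^ k) * q ^ k =
      (q : ℝ) ^ (if P then 2 * k else 3 * k) := by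
    split_ifs <;> ring
  calc _ ≤ C * ((q : ℝ) ^ k * if P then 1 else (q : ℝ) ^ k) *
        (q ^ k * (2 * √((q : ℝ) ^ n))) := by
        have : (0 : ℝ) ≤ if P then 1 else (q : ℝ) ^ k := by positivity
        gcongr
    _ = 2 * C * (q : ℝ) ^ (if P then 2 * k else 3 * k) * √((q : ℝ) ^ n) := by
        rw [← he]
        ring
    _ < √((q : ℝ) ^ n) * √((q : ℝ) ^ n) := by gcongr
    _ = _ := Real.mul_self_sqrt (by positivity)

/-- Sufficient condition: if `q^{n/2 - ϑ} > 2·r·rad(r)·W(h)·W(d)·W(H)`, where `ϑ = 2k`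
if `gcd(q,n) = 1` and `ϑ = 3k` otherwise, then `N_{r,k,g}(h, d, H) > 0`. -/
theorem Ncnt_pos_of_inequality
    (q n r k : ℕ) (hq : IsPrimePow q) (hn : 0 < n) (hr : 0 < r)
    (hrdvd : r ∣ q ^ n - 1)
    (Fq F : Type*) [Field Fq] [Field F] [Fintype Fq] [Fintype F] [Algebra Fq F]
    (hcard : Fintype.card Fq = q) (hdim : Module.finrank Fq F = n)
    (g : Fq[X]) (hgm : g.Monic) (hgd : g.natDegree = k)
    (hgdvd : g ∣ (X ^ n - 1 : Fq[X]))
    (h : Fq[X]) (hhm : h.Monic) (hhdvd : h ∣ (X ^ n - 1 : Fq[X]))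
    (d : ℕ) (hd : d ∣ radN (q ^ n - 1) / radN r)
    (H : Fq[X]) (hHm : H.Monic)
    (hHdvd : H ∣ radPoly (X ^ n - 1 : Fq[X]) / radPoly g)
    (hineq : (q : ℝ) ^ ((n : ℝ) / 2 -
        (if Nat.gcd q n = 1 then 2 * k else 3 * k : ℕ)) >
      2 * r * radN r * Wpoly h * Wnat d * Wpoly H) :
    0 < Ncnt F q n r g h d H := by
  subst hcard
  let _ := frobeniusModule Fq F
  have hF : Fintype.card F = Fintype.card Fq ^ n := by
    rw [Module.card_eq_pow_finrank (K := Fq) (V := F), hdim]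
  obtain ⟨φ₁, l₁, ⟨-, m₁, hm₁, hφ₁, h₁⟩, hfree⟩ := exists_sieveWeight_isPolyFree hn hdim hhdvd
  obtain ⟨φ₂, l₂, ⟨-, m₂, hm₂, hφ₂, h₂⟩, hQ⟩ := exists_sieveWeight_QSet hF hrdvd hd
  obtain ⟨φ₃, l₃, ⟨-, m₃, hm₃, hφ₃, h₃⟩, hT⟩ :=
    exists_sieveWeight_TSet hn hdim hgm hgd hgdvd hHm hHdvd
  have hker : (Nat.card (DistribSMul.toAddMonoidHom F g).ker : ℝ) ≤
      (Fintype.card Fq : ℝ) ^ k := by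
    rw [← hgd]
    exact_mod_cast card_smul_ker_le (F := F) hgm.ne_zero
  obtain ⟨x, u, hxu, hx₁, hx₂, hx₃⟩ := exists_ne_zero_of_fourierBound
    (DistribSMul.toAddMonoidHom F g) hm₁ hm₂ hm₃ hφ₁ hφ₂ hφ₃ h₁ h₂ h₃ (by
      have := lt_card_of_rpow_gt (C := r * radN r * Wpoly h * Wnat d * Wpoly H)
        Fintype.card_pos (by positivity) hker (by convert hineq using 1; ring)
      rw [hF, Nat.cast_pow]
      refine lt_of_eq_of_lt ?_ this
      ring)
  have hact : polyAct (Fintype.card Fq) g x = u := (polyAct_eq_smul g x).trans hxu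
  refine (Set.ncard_pos (Set.toFinite _)).2 ⟨x, hfree x hx₁, ?_, ?_⟩
  · rw [hact]
    exact hQ u hx₂
  · rw [hact, ← Units.val_inv_eq_inv_val]
    exact hT _ hx₃

end
end
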